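/- Fix an integer r ≥ 3. There exist a real constant d̃_r (depending only on r) and a constant C > 0 such that for all sufficiently large N one has |μ̄_r^+(N) − c̃_r·N^{r/2 − 3/4}·I_{r−3/2}(π√N) − d̃_r·N^{r/2 − 5/4}·I_{r−5/2}(π√N)| ≤ C·N^{r/2 − 7/4}·e^{π√N}, where c̃_r = 2^{r−5/2}·π^{1−r}·ζ(r)(1−2^{1−r}). -/

import Mathlib

open scoped BigOperators
open Filter MeasureTheory

/-- An overpartition of `n`: a partition of `n` in which the first occurrence of
each part size may be overlined.  We encode it as a finite set of (distinct)
overlined parts together with a multiset of non-overlined parts, all positive,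
with total sum `n`. -/
structure Overpartition (n : ℕ) where
  overlined : Finset ℕ
  nonoverlined : Multiset ℕ
  overlined_pos : ∀ i ∈ overlined, 0 < i
  nonoverlined_pos : ∀ i ∈ nonoverlined, 0 < i
  total : (overlined.sum id) + nonoverlined.sum = n

namespace Overpartition

/-- The multiset of all parts of an overpartition. -/
def parts {n : ℕ} (p : Overpartition n) : Multiset ℕ := p.overlined.val + p.nonoverlined

/-- Dyson's rank of an overpartition: largest part minus number of parts. -/
def rank {n : ℕ} (p : Overpartition n) : ℤ :=
  (p.parts.sup : ℤ) - (Multiset.card p.parts : ℤ)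

end Overpartition

/-- The crank of a partition (given as a multiset of positive parts):
the largest part if there are no 1's, and otherwise `μ(λ) - o(λ)` where `o(λ)`
is the number of 1's and `μ(λ)` is the number of parts larger than `o(λ)`. -/
def multisetCrank (s : Multiset ℕ) : ℤ :=
  if s.count 1 = 0 then (s.sup : ℤ)
  else ((s.filter (fun part => s.count 1 < part)).card : ℤ) - (s.count 1 : ℤ)

/-- The first residual crank of an overpartition: the crank of the subpartition
consisting of the non-overlined parts. -/
def Overpartition.crank {n : ℕ} (p : Overpartition n) : ℤ := multisetCrank p.nonoverlined

/-- `Mbar m n` is the number of overpartitions of `n` with first residual crank `m`. -/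
noncomputable def Mbar (m : ℤ) (n : ℕ) : ℕ :=
  Nat.card {p : Overpartition n // p.crank = m}

/-- `Nbar m n` is the number of overpartitions of `n` with Dyson rank `m`. -/
noncomputable def Nbar (m : ℤ) (n : ℕ) : ℕ :=
  Nat.card {p : Overpartition n // p.rank = m}

/-- The `r`-th positive crank moment `M̄_r^+(N) = Σ_{m ≥ 1} m^r M̄(m,N)`. -/
noncomputable def Mplus (r N : ℕ) : ℝ :=
  ∑' m : ℕ, ((m : ℝ) + 1) ^ r * (Mbar ((m : ℤ) + 1) N : ℝ)

/-- The `r`-th positive rank moment `N̄_r^+(N) = Σ_{m ≥ 1} m^r N̄(m,N)`. -/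
noncomputable def Nplus (r N : ℕ) : ℝ :=
  ∑' m : ℕ, ((m : ℝ) + 1) ^ r * (Nbar ((m : ℤ) + 1) N : ℝ)

/-- Positive symmetrized crank moment `μ̄_r^+(n) = Σ_{m ≥ 1} C(m + ⌊(r-1)/2⌋, r) M̄(m,n)`. -/
noncomputable def mubar (r n : ℕ) : ℝ :=
  ∑' m : ℕ, (Nat.choose (m + 1 + (r - 1) / 2) r : ℝ) * (Mbar ((m : ℤ) + 1) n : ℝ)

/-- Positive symmetrized rank moment `η̄_r^+(n) = Σ_{m ≥ 1} C(m + ⌊(r-1)/2⌋, r) N̄(m,n)`. -/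
noncomputable def etabar (r n : ℕ) : ℝ :=
  ∑' m : ℕ, (Nat.choose (m + 1 + (r - 1) / 2) r : ℝ) * (Nbar ((m : ℤ) + 1) n : ℝ)

/-- The Dirichlet eta function at positive integers:
`η(1) = log 2` and `η(r) = (1 - 2^{1-r}) ζ(r)` for `r ≥ 2`. -/
noncomputable def dirichletEtaNat (r : ℕ) : ℝ :=
  if r = 1 then Real.log 2 else (1 - 2 ^ (1 - (r : ℝ))) * (riemannZeta r).re

/-- The infinite Pochhammer symbol `(a; q)_∞ = Π_{j ≥ 0} (1 - a q^j)`. -/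
noncomputable def poch (a q : ℂ) : ℂ := ∏' j : ℕ, (1 - a * q ^ j)

/-- The (integral) exponent `n²/2 + (r/2 + ρ_C(r)) n`, where `ρ_C(r) = 0` for odd `r`
and `1/2` for even `r`. -/
def eC (r n : ℕ) : ℕ := (n * n + r * n + (if r % 2 = 0 then n else 0)) / 2

/-- The (integral) exponent `n² + (r/2 + ρ_R(r)) n`, where `ρ_R(r) = 1/2` for odd `r`
and `1` for even `r`. -/
def eR (r n : ℕ) : ℕ := (2 * n * n + r * n + (if r % 2 = 1 then n else 2 * n)) / 2

/-- `S_r(q) = Σ_{n ≥ 1} (-1)^{n+1} q^{n²/2 + (r/2 + ρ_C(r)) n} / (1 - q^n)^r`. -/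
noncomputable def Sr (r : ℕ) (q : ℂ) : ℂ :=
  ∑' n : ℕ, (-1 : ℂ) ^ n * q ^ eC r (n + 1) / (1 - q ^ (n + 1)) ^ r

/-- `S̃_r(q) = Σ_{n ≥ 1} (-1)^{n+1} q^{n² + (r/2 + ρ_R(r)) n} / ((1 - q^n)^r (1 + q^n))`. -/
noncomputable def Str (r : ℕ) (q : ℂ) : ℂ :=
  ∑' n : ℕ, (-1 : ℂ) ^ n * q ^ eR r (n + 1) / ((1 - q ^ (n + 1)) ^ r * (1 + q ^ (n + 1)))

/-- `SC_r(q) = ((-q;q)_∞/(q;q)_∞) S_r(q)`, the generating function of the positive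
symmetrized crank moments. -/
noncomputable def SCr (r : ℕ) (q : ℂ) : ℂ := (poch (-q) q / poch q q) * Sr r q

/-- `SR_r(q) = 2 ((-q;q)_∞/(q;q)_∞) S̃_r(q)`, the generating function of the positive
symmetrized rank moments. -/
noncomputable def SRr (r : ℕ) (q : ℂ) : ℂ := 2 * (poch (-q) q / poch q q) * Str r q

/-- `c_r = ζ(r) (1 - 2^{1-r})`. -/
noncomputable def cconst (r : ℕ) : ℂ := riemannZeta r * (1 - 2 ^ (1 - (r : ℂ)))

/-- `d_r = -(ζ(r-2)(1-2^{3-r})/2 + ρ_C(r) ζ(r-1)(1-2^{1-r}))`. -/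
noncomputable def dconst (r : ℕ) : ℂ :=
  -(riemannZeta ((r : ℂ) - 2) * (1 - 2 ^ (3 - (r : ℂ))) / 2 +
    (if r % 2 = 0 then (1 : ℂ) / 2 else 0) * riemannZeta ((r : ℂ) - 1) * (1 - 2 ^ (1 - (r : ℂ))))

/-- `d'_r = -(ζ(r-2)(1-2^{3-r}) + (ρ_R(r)/2) ζ(r-1)(1-2^{1-r}))`. -/
noncomputable def dconst' (r : ℕ) : ℂ :=
  -(riemannZeta ((r : ℂ) - 2) * (1 - 2 ^ (3 - (r : ℂ))) +
    (if r % 2 = 1 then (1 : ℂ) / 4 else (1 : ℂ) / 2) * riemannZeta ((r : ℂ) - 1) *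
      (1 - 2 ^ (1 - (r : ℂ))))

/-- The modified Bessel function of the first kind,
`I_s(x) = Σ_{k ≥ 0} (x/2)^{2k+s} / (k! Γ(k+s+1))`. -/
noncomputable def besselI (s x : ℝ) : ℝ :=
  ∑' k : ℕ, (x / 2) ^ (2 * (k : ℝ) + s) / ((k.factorial : ℝ) * Real.Gamma ((k : ℝ) + s + 1))

/-- The point `τ = x + i y` in the upper half plane. -/
noncomputable def mkTau (x y : ℝ) : ℂ := (x : ℂ) + (y : ℂ) * Complex.I

open scoped BigOperators
open Filter MeasureTheory

namespace MA
open Topology Finset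

/-- `(q;q)_k`. -/
noncomputable def qp (q : ℂ) (k : ℕ) : ℂ := ∏ i ∈ range k, (1 - q ^ (i + 1))
/-- `(q;q)_∞`. -/
noncomputable def qinf (q : ℂ) : ℂ := ∏' i : ℕ, (1 - q ^ (i + 1))
/-- `(-q;q)_∞`. -/
noncomputable def qpinf (q : ℂ) : ℂ := ∏' i : ℕ, (1 + q ^ (i + 1))

lemma pow_lt_one' {q : ℂ} (hq : ‖q‖ < 1) (i : ℕ) : ‖q ^ (i + 1)‖ < 1 := by
  rw [norm_pow]; exact pow_lt_one₀ (norm_nonneg _) hq (by omega)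

lemma one_sub_ne {q : ℂ} (hq : ‖q‖ < 1) (i : ℕ) : 1 - q ^ (i + 1) ≠ 0 := by
  intro h
  have := pow_lt_one' hq i
  rw [← sub_eq_zero.mp h] at this
  simp at this

lemma one_add_ne {q : ℂ} (hq : ‖q‖ < 1) (i : ℕ) : 1 + q ^ (i + 1) ≠ 0 := by
  intro h
  have := pow_lt_one' hq i
  rw [← neg_eq_of_add_eq_zero_right h] at this
  simp at this

lemma one_add_ne' {q : ℂ} (hq : ‖q‖ < 1) (i : ℕ) : 1 + q ^ i ≠ 0 := by
  cases i with
  | zero => norm_num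
  | succ i => exact one_add_ne hq i

lemma summ_pow {q : ℂ} (hq : ‖q‖ < 1) : Summable fun i : ℕ => ‖q ^ (i + 1)‖ := by
  simp_rw [norm_pow]
  exact (summable_nat_add_iff 1).2 (summable_geometric_of_lt_one (norm_nonneg _) hq)

lemma qp_ne {q : ℂ} (hq : ‖q‖ < 1) (k : ℕ) : qp q k ≠ 0 :=
  prod_ne_zero_iff.2 fun i _ => one_sub_ne hq i

lemma qp_succ (q : ℂ) (k : ℕ) : qp q (k + 1) = qp q k * (1 - q ^ (k + 1)) := prod_range_succ _ _

lemma qp_zero (q : ℂ) : qp q 0 = 1 := rfl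

lemma mult_sub {q : ℂ} (hq : ‖q‖ < 1) : Multipliable fun i : ℕ => (1 - q ^ (i + 1)) := by
  have := multipliable_one_add_of_summable (f := fun i : ℕ => - q ^ (i + 1))
    (by simpa using summ_pow hq)
  simpa [sub_eq_add_neg] using this

lemma mult_add {q : ℂ} (hq : ‖q‖ < 1) : Multipliable fun i : ℕ => (1 + q ^ (i + 1)) :=
  multipliable_one_add_of_summable (summ_pow hq)

lemma qp_tendsto {q : ℂ} (hq : ‖q‖ < 1) : Tendsto (qp q) atTop (𝓝 (qinf q)) :=
  (mult_sub hq).hasProd.tendsto_prod_nat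

lemma qinf_ne {q : ℂ} (hq : ‖q‖ < 1) : qinf q ≠ 0 := by
  have := tprod_one_add_ne_zero_of_summable (f := fun i : ℕ => - q ^ (i + 1))
    (by intro i; simpa [sub_eq_add_neg] using one_sub_ne hq i) (by simpa using summ_pow hq)
  simpa [sub_eq_add_neg, qinf] using this

lemma qpinf_ne {q : ℂ} (hq : ‖q‖ < 1) : qpinf q ≠ 0 :=
  tprod_one_add_ne_zero_of_summable (f := fun i : ℕ => q ^ (i + 1)) (one_add_ne hq) (summ_pow hq)

/-- partial products of (q)∞/(-q)∞ -/
noncomputable def Ap (q : ℂ) (k : ℕ) : ℂ := ∏ i ∈ range k, ((1 - q ^ (i + 1)) / (1 + q ^ (i + 1)))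

lemma Ap_ne {q : ℂ} (hq : ‖q‖ < 1) (k : ℕ) : Ap q k ≠ 0 :=
  prod_ne_zero_iff.2 fun i _ => div_ne_zero (one_sub_ne hq i) (one_add_ne hq i)

lemma Ap_tendsto {q : ℂ} (hq : ‖q‖ < 1) : Tendsto (Ap q) atTop (𝓝 (qinf q / qpinf q)) := by
  have h1 := (mult_sub hq).hasProd.tendsto_prod_nat
  have h2 := (mult_add hq).hasProd.tendsto_prod_nat
  have := h1.div h2 (qpinf_ne hq)
  refine this.congr fun n => ?_
  simp [Ap, prod_div_distrib]

lemma inv_bdd {f : ℕ → ℂ} {a : ℂ} (h : Tendsto f atTop (𝓝 a)) (ha : a ≠ 0) :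
    ∃ C : ℝ, 0 < C ∧ ∀ k, ‖(f k)⁻¹‖ ≤ C := by
  have := (h.inv₀ ha).norm.bddAbove_range
  obtain ⟨C, hC⟩ := this
  exact ⟨max C 1, by positivity, fun k => (hC ⟨k, rfl⟩).trans (le_max_left _ _)⟩

lemma bdd {f : ℕ → ℂ} {a : ℂ} (h : Tendsto f atTop (𝓝 a)) :
    ∃ C : ℝ, 0 < C ∧ ∀ k, ‖f k‖ ≤ C := by
  have := (h).norm.bddAbove_range
  obtain ⟨C, hC⟩ := this
  exact ⟨max C 1, by positivity, fun k => (hC ⟨k, rfl⟩).trans (le_max_left _ _)⟩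

noncomputable def gt (q : ℂ) (n s : ℕ) : ℂ :=
  (-1) ^ s * (Ap q n / Ap q s) * (2 * q ^ (s * (n + 1)) / (1 + q ^ s))

noncomputable def gW (q : ℂ) (n k : ℕ) : ℂ :=
  (-1) ^ k * (Ap q n / Ap q k) * (q ^ (k * (n + 1)) * ((1 - q ^ k) / (1 + q ^ k)))

lemma gauss_step {q : ℂ} (hq : ‖q‖ < 1) (n s : ℕ) :
    gt q (n + 1) s - gt q n s = (2 / (1 + q ^ (n + 1))) * (gW q n (s + 1) - gW q n s) := by
  unfold gt gW
  have hA : Ap q (n + 1) = Ap q n * ((1 - q ^ (n + 1)) / (1 + q ^ (n + 1))) := prod_range_succ _ _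
  have hs : Ap q (s + 1) = Ap q s * ((1 - q ^ (s + 1)) / (1 + q ^ (s + 1))) := prod_range_succ _ _
  rw [hA, hs]
  have e1 := Ap_ne hq n
  have e2 := Ap_ne hq s
  have e3 := one_add_ne hq n
  have e4 := one_sub_ne hq n
  have e5 := one_add_ne hq s
  have e6 := one_sub_ne hq s
  have e7 := one_add_ne' hq s
  have p1 : q ^ (s * (n + 1 + 1)) = q ^ (s * (n + 1)) * q ^ s := by rw [← pow_add]; ring_nf
  have p2 : q ^ ((s + 1) * (n + 1)) = q ^ (s * (n + 1)) * q ^ (n + 1) := by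
    rw [← pow_add]; ring_nf
  rw [p1, p2, pow_succ (-1 : ℂ) s]
  generalize q ^ (s * (n + 1)) = x at *
  generalize q ^ (n + 1) = y at *
  generalize q ^ (s + 1) = z at *
  generalize q ^ s = w at *
  field_simp
  ring

lemma gauss_fin {q : ℂ} (hq : ‖q‖ < 1) (n : ℕ) :
    ∑ s ∈ range (n + 1), gt q n s = 1 + 2 * ∑ j ∈ range n, (-1) ^ (j + 1) * q ^ ((j + 1) ^ 2) := by
  induction n with
  | zero => norm_num [gt, Ap]
  | succ n ih =>
    rw [sum_range_succ _ (n + 1), sum_range_succ (fun j => (-1 : ℂ) ^ (j + 1) * q ^ ((j + 1) ^ 2)) n, mul_add, ← add_assoc, ← ih]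
    have : ∑ s ∈ range (n + 1), gt q (n + 1) s - ∑ s ∈ range (n + 1), gt q n s
        = (2 / (1 + q ^ (n + 1))) * (gW q n (n + 1) - gW q n 0) := by
      rw [← sum_sub_distrib, ← sum_range_sub, mul_sum]
      exact sum_congr rfl fun s _ => gauss_step hq n s
    rw [sub_eq_iff_eq_add] at this
    rw [this]
    have hA : Ap q (n + 1) = Ap q n * ((1 - q ^ (n + 1)) / (1 + q ^ (n + 1))) := prod_range_succ _ _
    simp only [gW, gt, pow_zero, sub_self, zero_div, mul_zero, sub_zero]
    rw [div_self (Ap_ne hq (n+1)), hA]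
    have e1 := Ap_ne hq n
    have e3 := one_add_ne hq n
    have e4 := one_sub_ne hq n
    have p1 : q ^ ((n + 1) * (n + 1 + 1)) = q ^ ((n + 1) ^ 2) * q ^ (n + 1) := by
      rw [← pow_add]; ring_nf
    have p2 : q ^ ((n + 1) * (n + 1)) = q ^ ((n + 1) ^ 2) := by ring_nf
    rw [p1, p2]
    generalize q ^ ((n + 1) ^ 2) = x at *
    generalize q ^ (n + 1) = y at *
    field_simp
    ring

theorem gauss {q : ℂ} (hq : ‖q‖ < 1) :
    Tendsto (fun n => 1 + 2 * ∑ j ∈ range n, (-1) ^ (j + 1) * q ^ ((j + 1) ^ 2)) atTop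
      (𝓝 (qinf q / qpinf q)) := by
  have hne : qinf q / qpinf q ≠ 0 := div_ne_zero (qinf_ne hq) (qpinf_ne hq)
  obtain ⟨C, hC0, hC⟩ := bdd (Ap_tendsto hq)
  obtain ⟨D, hD0, hD⟩ := inv_bdd (Ap_tendsto hq) hne
  have hA := Ap_tendsto hq
  have key : ∀ n, (1 + 2 * ∑ j ∈ range n, (-1) ^ (j + 1) * q ^ ((j + 1) ^ 2)) = Ap q n +
      ∑ s ∈ range n, gt q n (s + 1) := by
    intro n
    rw [← gauss_fin hq n, sum_range_succ', add_comm]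
    congr 1
    norm_num [gt, Ap]
  simp_rw [key]
  rw [← add_zero (qinf q / qpinf q)]
  refine hA.add ?_
  set x := ‖q‖ with hx
  have hx0 : 0 ≤ x := norm_nonneg _
  -- bound
  have hb : ∀ n, ‖∑ s ∈ range n, gt q n (s + 1)‖ ≤ (C * D * (2 / (1 - x)) * (1 / (1 - x))) * x ^ n := by
    intro n
    have h1x : 0 < 1 - x := by linarith
    calc ‖∑ s ∈ range n, gt q n (s + 1)‖ ≤ ∑ s ∈ range n, ‖gt q n (s + 1)‖ := norm_sum_le _ _
      _ ≤ ∑ s ∈ range n, (C * D * (2 / (1 - x)) * x ^ n) * x ^ s := by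
          refine sum_le_sum fun s _ => ?_
          unfold gt
          rw [norm_mul, norm_mul, norm_pow, norm_neg, norm_one, one_pow, one_mul, div_eq_mul_inv,
            norm_mul, norm_div, norm_mul, norm_pow, ← hx, Complex.norm_ofNat]
          have l1 : 1 - x ≤ ‖1 + q ^ (s + 1)‖ := by
            have := norm_sub_norm_le (1 : ℂ) (-q ^ (s + 1))
            rw [norm_neg, norm_pow, ← hx, norm_one, sub_neg_eq_add] at this
            have : x ^ (s + 1) ≤ x := by
              rw [pow_succ]; exact mul_le_of_le_one_left hx0 (pow_le_one₀ hx0 hq.le)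
            linarith
          have l2 : x ^ ((s + 1) * (n + 1)) ≤ x ^ n * x ^ s := by
            rw [← pow_add]
            exact pow_le_pow_of_le_one hx0 hq.le (by nlinarith)
          calc ‖Ap q n‖ * ‖(Ap q (s + 1))⁻¹‖ * (2 * x ^ ((s + 1) * (n + 1)) / ‖1 + q ^ (s + 1)‖)
              ≤ C * D * (2 * (x ^ n * x ^ s) / (1 - x)) := by
                gcongr
                · exact hC n
                · exact hD _
            _ = _ := by ring
      _ = (C * D * (2 / (1 - x)) * x ^ n) * ∑ s ∈ range n, x ^ s := by rw [mul_sum]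
      _ ≤ (C * D * (2 / (1 - x)) * x ^ n) * (1 / (1 - x)) := by
          gcongr
          rw [one_div, ← tsum_geometric_of_lt_one hx0 hq]
          exact (summable_geometric_of_lt_one hx0 hq).sum_le_tsum _ (fun _ _ => by positivity)
      _ = _ := by ring
  refine squeeze_zero_norm hb ?_
  rw [← mul_zero (C * D * (2 / (1 - x)) * (1 / (1 - x)))]
  exact (tendsto_pow_atTop_nhds_zero_of_lt_one hx0 hq).const_mul _

end MA

open scoped BigOperators
open Filter MeasureTheory

namespace MA
open Topology Finset

lemma rec_unique {q : ℂ} (hq : ‖q‖ < 1) (K : ℕ → ℂ)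
    (hK : ∀ m, K m = (1 - q ^ (m + 1)) * K (m + 1) + q ^ (m + 3) * K (m + 2))
    (h0 : Tendsto K atTop (𝓝 0)) (m : ℕ) : K m = 0 := by
  set x := ‖q‖ with hx
  have hx0 : 0 ≤ x := norm_nonneg _
  let e : ℕ → ℝ := fun m => max ‖K m‖ ‖K (m + 1)‖
  have he : ∀ m, e m ≤ Real.exp (2 * x ^ m) * e (m + 1) := by
    intro m
    have h1 : (1 : ℝ) ≤ Real.exp (2 * x ^ m) := Real.one_le_exp (by positivity)
    have h2 : 1 + 2 * x ^ m ≤ Real.exp (2 * x ^ m) := by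
      have := Real.add_one_le_exp (2 * x ^ m); linarith
    have h3 : 0 ≤ e (m + 1) := le_max_of_le_left (norm_nonneg _)
    refine max_le ?_ ?_
    · rw [hK m]
      have a1 : ‖K (m + 1)‖ ≤ e (m + 1) := le_max_left _ _
      have a2 : ‖K (m + 2)‖ ≤ e (m + 1) := le_max_right _ _
      have a3 : ‖1 - q ^ (m + 1)‖ ≤ 1 + x ^ m := by
        refine (norm_sub_le _ _).trans ?_
        rw [norm_one, norm_pow, ← hx]
        have := pow_le_pow_of_le_one hx0 hq.le (show m ≤ m + 1 by omega)
        linarith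
      have a4 : ‖q ^ (m + 3)‖ ≤ x ^ m := by
        rw [norm_pow, ← hx]
        exact pow_le_pow_of_le_one hx0 hq.le (show m ≤ m + 3 by omega)
      calc _ ≤ ‖1 - q ^ (m + 1)‖ * ‖K (m + 1)‖ + ‖q ^ (m + 3)‖ * ‖K (m + 2)‖ := by
            refine (norm_add_le _ _).trans ?_
            rw [norm_mul, norm_mul]
        _ ≤ (1 + x ^ m) * e (m + 1) + x ^ m * e (m + 1) := by gcongr
        _ = (1 + 2 * x ^ m) * e (m + 1) := by ring
        _ ≤ _ := by gcongr
    · calc ‖K (m + 1)‖ ≤ 1 * e (m + 1) := by rw [one_mul]; exact le_max_left _ _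
        _ ≤ _ := by gcongr
  have he2 : ∀ k, e m ≤ Real.exp (∑ i ∈ range k, 2 * x ^ (m + i)) * e (m + k) := by
    intro k
    induction k with
    | zero => simp
    | succ k ih =>
      refine ih.trans ?_
      rw [sum_range_succ, Real.exp_add, mul_assoc]
      exact mul_le_mul_of_nonneg_left (he (m + k)) (Real.exp_pos _).le
  have he3 : ∀ k, e m ≤ Real.exp (2 * (1 - x)⁻¹) * e (m + k) := by
    intro k
    refine (he2 k).trans ?_
    have h3 : 0 ≤ e (m + k) := le_max_of_le_left (norm_nonneg _)
    gcongr
    rw [← mul_sum]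
    gcongr
    rw [← tsum_geometric_of_lt_one hx0 hq]
    calc _ ≤ ∑ i ∈ range k, x ^ i := sum_le_sum fun i _ =>
            pow_le_pow_of_le_one hx0 hq.le (by omega)
      _ ≤ _ := (summable_geometric_of_lt_one hx0 hq).sum_le_tsum _ (fun _ _ => by positivity)
  have hlim : Tendsto (fun k => Real.exp (2 * (1 - x)⁻¹) * e (m + k)) atTop (𝓝 0) := by
    have t1 : Tendsto (fun k => ‖K (m + k)‖) atTop (𝓝 0) := by
      have := h0.norm.comp (tendsto_add_atTop_nat m)
      simpa [Function.comp_def, add_comm] using this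
    have t2 : Tendsto (fun k => ‖K (m + k + 1)‖) atTop (𝓝 0) := by
      have := h0.norm.comp (tendsto_add_atTop_nat (m + 1))
      simpa [Function.comp_def, add_comm, add_left_comm, add_assoc] using this
    have := (t1.max t2).const_mul (Real.exp (2 * (1 - x)⁻¹))
    simpa using this
  have : e m ≤ 0 := ge_of_tendsto' hlim he3
  have : ‖K m‖ ≤ 0 := (le_max_left _ _).trans this
  simpa using this

noncomputable def Gt (q : ℂ) (m j : ℕ) : ℂ := q ^ (j ^ 2 + (m + 2) * j) / (qp q j * qp q (m + j))
noncomputable def G (q : ℂ) (m : ℕ) : ℂ := ∑' j, Gt q m j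

def tri (n : ℕ) : ℕ := n * (n + 1) / 2
lemma tri_succ (n : ℕ) : tri (n + 1) = tri n + (n + 1) := by
  unfold tri
  rw [show (n + 1) * (n + 1 + 1) = n * (n + 1) + (n + 1) * 2 by ring, Nat.add_mul_div_right _ _ (by norm_num)]
lemma tri_ge (n : ℕ) : n ≤ tri n := by
  induction n with
  | zero => simp
  | succ n ih => rw [tri_succ]; omega

noncomputable def Tt (q : ℂ) (m n : ℕ) : ℂ := (-1) ^ n * q ^ (tri n + n * m) * (1 - q ^ (n + 1))
noncomputable def T (q : ℂ) (m : ℕ) : ℂ := ∑' n, Tt q m n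

lemma Gt_bound {q : ℂ} (hq : ‖q‖ < 1) : ∃ C : ℝ, 0 < C ∧ ∀ m j, ‖Gt q m j‖ ≤ C * ‖q‖ ^ ((m + 1) * j) := by
  obtain ⟨D, hD0, hD⟩ := inv_bdd (qp_tendsto hq) (qinf_ne hq)
  refine ⟨D * D, by positivity, fun m j => ?_⟩
  unfold Gt
  rw [div_eq_mul_inv, mul_inv, norm_mul, norm_mul, norm_pow, mul_comm]
  have h3 : ‖q‖ ^ (j ^ 2 + (m + 2) * j) ≤ ‖q‖ ^ ((m + 1) * j) :=
    pow_le_pow_of_le_one (norm_nonneg _) hq.le (by nlinarith)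
  gcongr
  · exact hD _
  · exact hD _

lemma Gt_summable {q : ℂ} (hq : ‖q‖ < 1) (m : ℕ) : Summable (Gt q m) := by
  obtain ⟨C, hC0, hC⟩ := Gt_bound hq
  refine Summable.of_norm_bounded (g := fun j => C * ‖q‖ ^ j) 
    ((summable_geometric_of_lt_one (norm_nonneg _) hq).mul_left _) fun j => (hC m j).trans ?_
  gcongr ?_ * ?_
  exact pow_le_pow_of_le_one (norm_nonneg _) hq.le (by nlinarith)

lemma G_tendsto {q : ℂ} (hq : ‖q‖ < 1) : Tendsto (G q) atTop (𝓝 (qinf q)⁻¹) := by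
  obtain ⟨C, hC0, hC⟩ := Gt_bound hq
  have := tendsto_tsum_of_dominated_convergence (𝓕 := atTop) (f := Gt q)
    (g := fun j => if j = 0 then (qinf q)⁻¹ else 0) (bound := fun j => C * ‖q‖ ^ j)
    ((summable_geometric_of_lt_one (norm_nonneg _) hq).mul_left _) ?_ ?_
  · rw [tsum_ite_eq] at this
    exact this
  · intro j
    rcases Nat.eq_zero_or_pos j with rfl | hj
    · simp only [if_true]
      refine ((qp_tendsto hq).inv₀ (qinf_ne hq)).congr fun m => ?_
      simp [Gt, qp_zero]
    · simp only [hj.ne', if_false]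
      refine squeeze_zero_norm (a := fun m => C * ‖q‖ ^ m) (fun m => (hC m j).trans ?_) ?_
      · gcongr ?_ * ?_
        exact pow_le_pow_of_le_one (norm_nonneg _) hq.le (by nlinarith)
      · simpa using (tendsto_pow_atTop_nhds_zero_of_lt_one (norm_nonneg q) hq).const_mul C
  · refine Eventually.of_forall fun m j => (hC m j).trans ?_
    gcongr ?_ * ?_
    exact pow_le_pow_of_le_one (norm_nonneg _) hq.le (by nlinarith)

lemma Tt_bound {q : ℂ} (hq : ‖q‖ < 1) (m n) : ‖Tt q m n‖ ≤ 2 * ‖q‖ ^ (tri n + n * m) := by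
  unfold Tt
  rw [norm_mul, norm_mul, norm_pow, norm_neg, norm_one, one_pow, one_mul, norm_pow, mul_comm]
  gcongr
  refine (norm_sub_le _ _).trans ?_
  have := pow_lt_one' hq n
  rw [norm_one]; linarith

lemma Tt_summable {q : ℂ} (hq : ‖q‖ < 1) (m : ℕ) : Summable (Tt q m) := by
  refine Summable.of_norm_bounded (g := fun j => 2 * ‖q‖ ^ j) 
    ((summable_geometric_of_lt_one (norm_nonneg _) hq).mul_left _) fun j => (Tt_bound hq m j).trans ?_
  gcongr ?_ * ?_
  exact pow_le_pow_of_le_one (norm_nonneg _) hq.le (by have := tri_ge j; nlinarith)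

lemma T_tendsto {q : ℂ} (hq : ‖q‖ < 1) : Tendsto (T q) atTop (𝓝 (1 - q)) := by
  have := tendsto_tsum_of_dominated_convergence (𝓕 := atTop) (f := Tt q)
    (g := fun j => if j = 0 then (1 - q) else 0) (bound := fun j => 2 * ‖q‖ ^ j)
    ((summable_geometric_of_lt_one (norm_nonneg _) hq).mul_left _) ?_ ?_
  · rw [tsum_ite_eq] at this
    exact this
  · intro j
    rcases Nat.eq_zero_or_pos j with rfl | hj
    · simp [Tt, tri]
    · simp only [hj.ne', if_false]
      refine squeeze_zero_norm (a := fun m => 2 * ‖q‖ ^ m) (fun m => (Tt_bound hq m j).trans ?_) ?_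
      · gcongr ?_ * ?_
        exact pow_le_pow_of_le_one (norm_nonneg _) hq.le (by nlinarith)
      · simpa using (tendsto_pow_atTop_nhds_zero_of_lt_one (norm_nonneg q) hq).const_mul 2
  · refine Eventually.of_forall fun m j => (Tt_bound hq m j).trans ?_
    gcongr ?_ * ?_
    exact pow_le_pow_of_le_one (norm_nonneg _) hq.le (by have := tri_ge j; nlinarith)

lemma G_rec {q : ℂ} (hq : ‖q‖ < 1) (m : ℕ) :
    G q m = (1 - q ^ (m + 1)) * G q (m + 1) + q ^ (m + 3) * G q (m + 2) := by
  have h0 : Gt q m 0 = (1 - q ^ (m + 1)) * Gt q (m + 1) 0 := by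
    simp only [Gt, qp_zero, add_zero, qp_succ]
    have := qp_ne hq m
    have := one_sub_ne hq m
    field_simp
    simp
  have h1 : ∀ j, Gt q m (j + 1) = (1 - q ^ (m + 1)) * Gt q (m + 1) (j + 1) + q ^ (m + 3) * Gt q (m + 2) j := by
    intro j
    simp only [Gt]
    have e1 : m + 1 + (j + 1) = (m + j + 1) + 1 := by omega
    have e2 : m + (j + 1) = (m + j + 1) := by omega
    have e3 : m + 2 + j = (m + j + 1) + 1 := by omega
    rw [e1, e2, e3, qp_succ q (m + j + 1), qp_succ q j]
    have := qp_ne hq (m + j + 1)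
    have := qp_ne hq j
    have h3 := one_sub_ne hq j
    have h4 := one_sub_ne hq (m + j + 1)
    have p1 : q ^ ((j + 1) ^ 2 + (m + 1 + 2) * (j + 1)) = q ^ ((j + 1) ^ 2 + (m + 2) * (j + 1)) * q ^ (j + 1) := by
      rw [← pow_add]; ring_nf
    have p2 : q ^ ((j + 1) ^ 2 + (m + 2) * (j + 1)) = q ^ (m + 3) * q ^ (j ^ 2 + (m + 2 + 2) * j) := by
      rw [← pow_add]; ring_nf
    have p3 : q ^ (m + j + 1 + 1) = q ^ (m + 1) * q ^ (j + 1) := by rw [← pow_add]; ring_nf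
    rw [p1, p2]
    rw [p3] at h4 ⊢
    generalize q ^ (m + 1) = x at *
    generalize q ^ (j + 1) = y at *
    generalize q ^ (m + 3) = z at *
    generalize q ^ (j ^ 2 + (m + 2 + 2) * j) = w at *
    have h5 : 1 - y * x ≠ 0 := by rwa [mul_comm]
    field_simp
    ring
  have s0 := Gt_summable hq m
  have s1 := Gt_summable hq (m + 1)
  have s2 := Gt_summable hq (m + 2)
  unfold G
  rw [s0.tsum_eq_zero_add, s1.tsum_eq_zero_add, h0, tsum_congr h1, Summable.tsum_add, tsum_mul_left, tsum_mul_left]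
  · ring
  · exact ((summable_nat_add_iff 1).2 s1).mul_left _
  · exact s2.mul_left _

lemma T_rec {q : ℂ} (hq : ‖q‖ < 1) (m : ℕ) :
    T q m = (1 - q ^ (m + 1)) * T q (m + 1) + q ^ (m + 3) * T q (m + 2) := by
  let V : ℕ → ℂ := fun n => Tt q m n * (1 - q ^ n)
  have h : ∀ n, Tt q m n - (1 - q ^ (m + 1)) * Tt q (m + 1) n - q ^ (m + 3) * Tt q (m + 2) n
      = V n - V (n + 1) := by
    intro n
    simp only [V, Tt, tri_succ]
    have p1 : q ^ (tri n + n * (m + 1)) = q ^ (tri n + n * m) * q ^ n := by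
      rw [← pow_add]; ring_nf
    have p2 : q ^ (tri n + n * (m + 2)) = q ^ (tri n + n * m) * q ^ n * q ^ n := by
      rw [← pow_add, ← pow_add]; ring_nf
    have p3 : q ^ (tri n + (n + 1) + (n + 1) * m) = q ^ (tri n + n * m) * q ^ n * (q ^ m * q) := by
      rw [← pow_succ, ← pow_add, ← pow_add]; ring_nf
    rw [p1, p2, p3]
    simp only [pow_succ]
    ring
  have sV : Summable V := by
    have : Summable fun n => 2 * ‖Tt q m n‖ := (Tt_summable hq m).norm.mul_left 2
    refine Summable.of_norm_bounded this fun n => ?_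
    simp only [V]
    rw [norm_mul, mul_comm]
    gcongr
    refine (norm_sub_le _ _).trans ?_
    rw [norm_one, norm_pow]
    have := pow_le_one₀ (norm_nonneg q) hq.le (n := n)
    linarith
  have s0 := Tt_summable hq m
  have s1 := (Tt_summable hq (m + 1)).mul_left (1 - q ^ (m + 1))
  have s2 := (Tt_summable hq (m + 2)).mul_left (q ^ (m + 3))
  have e : ∑' n, (Tt q m n - (1 - q ^ (m + 1)) * Tt q (m + 1) n - q ^ (m + 3) * Tt q (m + 2) n) = 0 := by
    rw [tsum_congr h, Summable.tsum_sub sV ((summable_nat_add_iff 1).2 sV), sV.tsum_eq_zero_add]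
    simp [V]
  rw [Summable.tsum_sub (s0.sub s1) s2, Summable.tsum_sub s0 s1, tsum_mul_left, tsum_mul_left] at e
  unfold T
  linear_combination e

theorem GT {q : ℂ} (hq : ‖q‖ < 1) (m : ℕ) : (1 - q) * G q m = (qinf q)⁻¹ * T q m := by
  have := rec_unique hq (fun m => (1 - q) * G q m - (qinf q)⁻¹ * T q m) ?_ ?_ m
  · exact sub_eq_zero.mp this
  · intro m
    rw [G_rec hq m, T_rec hq m]; ring
  · have := ((G_tendsto hq).const_mul (1 - q)).sub ((T_tendsto hq).const_mul (qinf q)⁻¹)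
    rw [mul_comm (1 - q), sub_self] at this
    exact this

end MA

open scoped BigOperators
open Filter MeasureTheory

namespace MA
open Topology Finset

lemma HS_congr {ι : Type*} {f g : ι → ℂ} {a : ℂ} (h : ∀ i, f i = g i) :
    HasSum f a ↔ HasSum g a := by rw [funext h]

lemma HS_mul {ι κ : Type*} {f : ι → ℂ} {g : κ → ℂ} {a b : ℂ} (hf : HasSum f a) (hg : HasSum g b) :
    HasSum (fun p : ι × κ => f p.1 * g p.2) (a * b) :=
  HasSum.mul hf hg (summable_mul_of_summable_norm (f := f) (g := g) hf.summable.norm hg.summable.norm)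

lemma hasSum_H_aux (k : ℕ) : Function.Bijective
    (fun p : ℕ × {s : Multiset ℕ // s.card = k} =>
      (⟨p.1 ::ₘ p.2.1.map (· + p.1), by simp [p.2.2]⟩ : {s : Multiset ℕ // s.card = k + 1})) := by
  constructor
  · rintro ⟨c, s, hs⟩ ⟨c', s', hs'⟩ h
    simp only [Subtype.mk.injEq] at h
    have h1 : c ∈ c' ::ₘ s'.map (· + c') := h ▸ Multiset.mem_cons_self _ _
    have h2 : c' ∈ c ::ₘ s.map (· + c) := h ▸ Multiset.mem_cons_self _ _
    have hc : c = c' := by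
      simp only [Multiset.mem_cons, Multiset.mem_map] at h1 h2
      rcases h1 with h1 | ⟨a, _, h1⟩ <;> rcases h2 with h2 | ⟨b, _, h2⟩ <;> omega
    subst hc
    rw [Multiset.cons_inj_right] at h
    have := Multiset.map_injective (add_left_injective c) h
    simp [this]
  · rintro ⟨s, hs⟩
    have hne : s.toFinset.Nonempty := by
      rw [Multiset.toFinset_nonempty]; rintro rfl; simp at hs
    obtain ⟨c, hc, hmin⟩ := s.toFinset.exists_min_image id hne
    simp only [Multiset.mem_toFinset, id] at hc hmin
    refine ⟨⟨c, (s.erase c).map (· - c), ?_⟩, ?_⟩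
    · simp [Multiset.card_erase_of_mem hc, hs]
    · simp only [Subtype.mk.injEq, Multiset.map_map]
      rw [Multiset.map_congr rfl (g := id), Multiset.map_id, Multiset.cons_erase hc]
      intro x hx
      have := hmin x (Multiset.mem_of_mem_erase hx)
      simp only [Function.comp, id]; omega

lemma sum_map_add (s : Multiset ℕ) (c : ℕ) : (s.map (· + c)).sum = s.sum + s.card * c := by
  induction s using Multiset.induction_on with
  | empty => simp
  | cons a s ih => simp [ih]; ring

lemma hasSum_H {q : ℂ} (hq : ‖q‖ < 1) (k : ℕ) :
    HasSum (fun s : {s : Multiset ℕ // s.card = k} => q ^ s.1.sum) (qp q k)⁻¹ := by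
  induction k with
  | zero =>
    have : Unique {s : Multiset ℕ // s.card = 0} :=
      ⟨⟨⟨0, rfl⟩⟩, fun s => Subtype.ext (Multiset.card_eq_zero.1 s.2)⟩
    have h := hasSum_unique (fun s : {s : Multiset ℕ // s.card = 0} => q ^ s.1.sum)
    convert h using 1
    have : (default : {s : Multiset ℕ // s.card = 0}).1 = 0 :=
      Multiset.card_eq_zero.1 (default : {s : Multiset ℕ // s.card = 0}).2
    simp [this, qp_zero]
  | succ k ih =>
    rw [← (Equiv.ofBijective _ (hasSum_H_aux k)).hasSum_iff]
    have hg := hasSum_geometric_of_norm_lt_one (pow_lt_one' hq k)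
    have := HS_mul hg ih
    rw [qp_succ, mul_inv, mul_comm]
    refine (HS_congr fun p => ?_).2 this
    simp only [Function.comp, Equiv.ofBijective_apply, Multiset.sum_cons, sum_map_add, p.2.2]
    rw [← pow_mul, ← pow_add]; congr 1; ring

lemma hasSum_U_aux (k j : ℕ) : Function.Bijective
    (fun p : {s : Multiset ℕ // s.card = k} =>
      (⟨p.1.map (· + (j + 1)), by simp [p.2], by simp; omega⟩ :
        {s : Multiset ℕ // s.card = k ∧ ∀ i ∈ s, j < i})) := by
  constructor
  · rintro ⟨s, hs⟩ ⟨s', hs'⟩ h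
    simp only [Subtype.mk.injEq] at h
    have := Multiset.map_injective (add_left_injective (j + 1)) h
    simp [this]
  · rintro ⟨s, hs, hj⟩
    refine ⟨⟨s.map (· - (j + 1)), by simp [hs]⟩, ?_⟩
    simp only [Subtype.mk.injEq, Multiset.map_map]
    rw [Multiset.map_congr rfl (g := id), Multiset.map_id]
    intro x hx
    have := hj x hx
    simp only [Function.comp, id]; omega

lemma hasSum_U {q : ℂ} (hq : ‖q‖ < 1) (k j : ℕ) :
    HasSum (fun s : {s : Multiset ℕ // s.card = k ∧ ∀ i ∈ s, j < i} => q ^ s.1.sum)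
      (q ^ ((j + 1) * k) * (qp q k)⁻¹) := by
  rw [← (Equiv.ofBijective _ (hasSum_U_aux k j)).hasSum_iff]
  refine (HS_congr fun p => ?_).2 ((hasSum_H hq k).mul_left (q ^ ((j + 1) * k)))
  simp only [Function.comp, Equiv.ofBijective_apply, sum_map_add, p.2]
  rw [← pow_add]; congr 1; ring

abbrev QT (j : ℕ) := {s : Multiset ℕ // ∀ i ∈ s, 2 ≤ i ∧ i ≤ j}

lemma hasSum_Q_aux (j : ℕ) (hj : 1 ≤ j) : Function.Bijective
    (fun p : ℕ × QT j =>
      (⟨Multiset.replicate p.1 (j + 1) + p.2.1, by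
        intro i hi
        rcases Multiset.mem_add.1 hi with h | h
        · have := Multiset.eq_of_mem_replicate h; omega
        · have := p.2.2 i h; omega⟩ : QT (j + 1))) := by
  have hcount : ∀ (s : QT j), s.1.count (j + 1) = 0 := by
    intro s
    rw [Multiset.count_eq_zero]
    intro h
    have := s.2 _ h; omega
  constructor
  · rintro ⟨c, s⟩ ⟨c', s'⟩ h
    simp only [Subtype.mk.injEq] at h
    have h1 := congrArg (Multiset.count (j + 1)) h
    simp only [Multiset.count_add, Multiset.count_replicate_self, hcount] at h1
    simp only [add_zero] at h1
    subst h1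
    have := add_left_cancel h
    simp [Subtype.ext_iff, this]
  · rintro ⟨s, hs⟩
    refine ⟨⟨s.count (j + 1), s.filter (fun x => ¬ x = j + 1), ?_⟩, ?_⟩
    · intro i hi
      rw [Multiset.mem_filter] at hi
      have := hs i hi.1; omega
    · simp only [Subtype.mk.injEq]
      rw [← Multiset.filter_eq', Multiset.filter_add_not]

lemma hasSum_Q {q : ℂ} (hq : ‖q‖ < 1) (j : ℕ) (hj : 1 ≤ j) :
    HasSum (fun s : QT j => q ^ s.1.sum) ((1 - q) * (qp q j)⁻¹) := by
  induction j, hj using Nat.le_induction with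
  | base =>
    have h0 : ∀ s : QT 1, s.1 = 0 := fun s => by
      rw [Multiset.eq_zero_iff_forall_notMem]
      intro i hi
      have := s.2 i hi; omega
    have : Unique (QT 1) :=
      ⟨⟨⟨0, by simp⟩⟩, fun s => Subtype.ext (h0 s)⟩
    have h := hasSum_unique (fun s : QT 1 => q ^ s.1.sum)
    convert h using 1
    have h1 := one_sub_ne hq 0
    rw [h0]
    simp only [zero_add, pow_one] at h1
    simp [qp, h1]
  | succ j hj ih =>
    rw [← (Equiv.ofBijective _ (hasSum_Q_aux j hj)).hasSum_iff]
    have hg := hasSum_geometric_of_norm_lt_one (pow_lt_one' hq j)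
    have := HS_mul hg ih
    rw [qp_succ, mul_inv, ← mul_assoc, mul_comm]
    refine (HS_congr fun p => ?_).2 this
    simp only [Function.comp, Equiv.ofBijective_apply, Multiset.sum_add, Multiset.sum_replicate]
    rw [← pow_mul, ← pow_add, smul_eq_mul]; congr 1; ring

/-- partitions -/
abbrev Bp := {s : Multiset ℕ // ∀ i ∈ s, 0 < i}

lemma summable_Bp {x : ℝ} (hx0 : 0 ≤ x) (hx : x < 1) : Summable (fun s : Bp => x ^ s.1.sum) := by
  have hq : ‖(x : ℂ)‖ < 1 := by simpa [abs_of_nonneg hx0] using hx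
  let c : Bp → ℕ := fun b => b.1.card
  rw [← (Equiv.sigmaFiberEquiv c).summable_iff]
  have key : ∀ k, HasSum (fun b : {b : Bp // c b = k} => ((x ^ b.1.1.sum : ℝ) : ℂ))
      ((x : ℂ) ^ k * (qp x k)⁻¹) := by
    intro k
    have h := hasSum_U hq k 0
    let e : {b : Bp // c b = k} ≃ {s : Multiset ℕ // s.card = k ∧ ∀ i ∈ s, 0 < i} :=
      { toFun := fun b => ⟨b.1.1, b.2, b.1.2⟩
        invFun := fun s => ⟨⟨s.1, s.2.2⟩, s.2.1⟩
        left_inv := fun _ => rfl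
        right_inv := fun _ => rfl }
    rw [← e.symm.hasSum_iff]
    convert h using 1
    · funext s; simp [e]
    · simp
  rw [summable_sigma_of_nonneg]
  · constructor
    · intro k
      have := (key k).summable
      exact Complex.summable_ofReal.1 this
    · have e1 : ∀ k, ((∑' b : {b : Bp // c b = k}, x ^ b.1.1.sum : ℝ) : ℂ) = (x : ℂ) ^ k * (qp x k)⁻¹ := by
        intro k
        rw [Complex.ofReal_tsum]; exact (key k).tsum_eq
      change Summable (fun k => (∑' b : {b : Bp // c b = k}, x ^ b.1.1.sum : ℝ))
      rw [← Complex.summable_ofReal]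
      simp_rw [e1]
      obtain ⟨D, hD0, hD⟩ := inv_bdd (qp_tendsto hq) (qinf_ne hq)
      refine Summable.of_norm_bounded (g := fun k => x ^ k * D) 
        ((summable_geometric_of_lt_one hx0 hx).mul_right _) fun k => ?_
      rw [norm_mul, norm_pow]
      simp only [Complex.norm_real, Real.norm_eq_abs, abs_of_nonneg hx0]
      gcongr
      exact hD k
  · intro p; simp only [Function.comp]; positivity

lemma crank_bij0 (m : ℕ) (hm : 2 ≤ m) : Function.Bijective
    (fun s : QT m => (⟨⟨⟨m ::ₘ s.1, by
        intro i hi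
        rcases Multiset.mem_cons.1 hi with h | h
        · omega
        · have := s.2 i h; omega⟩, by
        have h1 : (m ::ₘ s.1).count 1 = 0 := by
          rw [Multiset.count_eq_zero]
          intro hi
          rcases Multiset.mem_cons.1 hi with h | h
          · omega
          · have := s.2 1 h; omega
        simp only [multisetCrank, h1, if_true]
        norm_cast
        rw [Multiset.sup_cons]
        exact sup_eq_left.2 (Multiset.sup_le.2 fun b hb => (s.2 b hb).2)⟩, by
        change (m ::ₘ s.1).count 1 = 0
        rw [Multiset.count_eq_zero]
        intro hi
        rcases Multiset.mem_cons.1 hi with h | h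
        · omega
        · have := s.2 1 h; omega⟩ :
      {b : {b : Bp // multisetCrank b.1 = (m : ℤ)} // b.1.1.count 1 = 0})) := by
  constructor
  · rintro s s' h
    simp only [Subtype.mk.injEq, Multiset.cons_inj_right] at h
    exact Subtype.ext h
  · rintro ⟨⟨⟨b, hb⟩, hc⟩, h0⟩
    simp only at hc h0
    simp only [multisetCrank, h0, if_true] at hc
    norm_cast at hc
    have hle : ∀ i ∈ b, i ≤ m := fun i hi => hc ▸ Multiset.le_sup hi
    have hmem : m ∈ b := by
      by_contra hcon
      have : b.sup ≤ m - 1 := Multiset.sup_le.2 fun i hi => by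
        have := hle i hi
        have : i ≠ m := fun h => hcon (h ▸ hi)
        omega
      omega
    refine ⟨⟨b.erase m, ?_⟩, ?_⟩
    · intro i hi
      have hi' := Multiset.mem_of_mem_erase hi
      have := hle i hi'
      have := hb i hi'
      have : i ≠ 1 := by
        rintro rfl
        exact (Multiset.count_eq_zero.1 h0) hi'
      omega
    · simp only [Subtype.mk.injEq]
      exact Multiset.cons_erase hmem

end MA

open scoped BigOperators
open Filter MeasureTheory

namespace MA
open Topology Finset

abbrev UT (k j : ℕ) := {s : Multiset ℕ // s.card = k ∧ ∀ i ∈ s, j < i}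

lemma cnt1 {j k : ℕ} (hj : 1 ≤ j) (s : QT j) (u : UT k j) :
    (Multiset.replicate j 1 + s.1 + u.1).count 1 = j := by
  have h1 : s.1.count 1 = 0 := by
    rw [Multiset.count_eq_zero]; intro h; have := s.2 1 h; omega
  have h2 : u.1.count 1 = 0 := by
    rw [Multiset.count_eq_zero]; intro h; have := u.2.2 1 h; omega
  simp [h1, h2]

lemma filt {j k : ℕ} (hj : 1 ≤ j) (s : QT j) (u : UT k j) :
    (Multiset.replicate j 1 + s.1 + u.1).filter (fun p => j < p) = u.1 := by
  rw [Multiset.filter_add, Multiset.filter_add, Multiset.filter_eq_self.2 u.2.2,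
    Multiset.filter_eq_nil.2, Multiset.filter_eq_nil.2]
  · simp
  · intro i hi; have := s.2 i hi; omega
  · intro i hi; have := Multiset.eq_of_mem_replicate hi; omega

lemma crank_bij1 (m j : ℕ) (hj : 1 ≤ j) : Function.Bijective
    (fun p : QT j × UT (m + j) j => (⟨⟨⟨Multiset.replicate j 1 + p.1.1 + p.2.1, by
        intro i hi
        rcases Multiset.mem_add.1 hi with h | h
        · rcases Multiset.mem_add.1 h with h | h
          · have := Multiset.eq_of_mem_replicate h; omega
          · have := p.1.2 i h; omega
        · have := p.2.2.2 i h; omega⟩, by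
        simp only [multisetCrank, cnt1 hj p.1 p.2, filt hj p.1 p.2]
        rw [if_neg (by omega), p.2.2.1]
        push_cast; ring⟩, by
        exact cnt1 hj p.1 p.2⟩ :
      {b : {b : Bp // multisetCrank b.1 = (m : ℤ)} // b.1.1.count 1 = j})) := by
  constructor
  · rintro ⟨s, u⟩ ⟨s', u'⟩ h
    simp only [Subtype.mk.injEq] at h
    have h1 := congrArg (Multiset.filter (fun p => j < p)) h
    rw [filt hj, filt hj] at h1
    rw [h1] at h
    have h2 := add_left_cancel (add_right_cancel h)
    exact Prod.ext (Subtype.ext h2) (Subtype.ext h1)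
  · rintro ⟨⟨⟨b, hb⟩, hc⟩, h0⟩
    simp only at hc h0
    simp only [multisetCrank, h0] at hc
    rw [if_neg (by omega)] at hc
    refine ⟨⟨⟨(b.filter (fun p => ¬ j < p)).filter (fun p => ¬ p = 1), ?_⟩, ⟨b.filter (fun p => j < p), ?_, ?_⟩⟩, ?_⟩
    · intro i hi
      simp only [Multiset.mem_filter] at hi
      have := hb i hi.1.1
      omega
    · have hc2 : (((b.filter (fun p => j < p)).card : ℕ) : ℤ) - (j : ℤ) = m := hc
      omega
    · intro i hi
      exact (Multiset.mem_filter.1 hi).2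
    · simp only [Subtype.mk.injEq]
      have e1 : Multiset.replicate j 1 = (b.filter (fun p => ¬ j < p)).filter (fun p => p = 1) := by
        rw [Multiset.filter_eq', Multiset.count_filter, if_pos (by omega), h0]
      rw [e1, Multiset.filter_add_not, add_comm, Multiset.filter_add_not]

lemma norm_summable_Bp {q : ℂ} (hq : ‖q‖ < 1) : Summable (fun s : Bp => q ^ s.1.sum) := by
  refine Summable.of_norm ?_
  simp_rw [norm_pow]
  exact summable_Bp (norm_nonneg _) hq

lemma hasSum_M {q : ℂ} (hq : ‖q‖ < 1) (m : ℕ) (hm : 2 ≤ m) :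
    HasSum (fun b : {b : Bp // multisetCrank b.1 = (m : ℤ)} => q ^ b.1.1.sum)
      (q ^ m * ((1 - q) * G q m)) := by
  let c : {b : Bp // multisetCrank b.1 = (m : ℤ)} → ℕ := fun b => b.1.1.count 1
  have hs : Summable (fun b : {b : Bp // multisetCrank b.1 = (m : ℤ)} => q ^ b.1.1.sum) :=
    (norm_summable_Bp hq).comp_injective (i := fun b : {b : Bp // multisetCrank b.1 = (m : ℤ)} => b.1)
      Subtype.val_injective
  rw [← (Equiv.sigmaFiberEquiv c).hasSum_iff]
  refine HasSum.sigma_of_hasSum (g := fun j => q ^ m * ((1 - q) * Gt q m j)) ?_ ?_ ?_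
  · exact (((Gt_summable hq m).hasSum).mul_left _).mul_left _
  · intro j
    change HasSum (fun b : {b : {b : Bp // multisetCrank b.1 = (m : ℤ)} // b.1.1.count 1 = j} =>
      q ^ b.1.1.1.sum) _
    rcases Nat.eq_zero_or_pos j with rfl | hj
    · rw [← (Equiv.ofBijective _ (crank_bij0 m hm)).hasSum_iff]
      have := (hasSum_Q hq m (by omega)).mul_left (q ^ m)
      have e : q ^ m * ((1 - q) * Gt q m 0) = q ^ m * ((1 - q) * (qp q m)⁻¹) := by
        simp [Gt, qp_zero]
      rw [e]
      refine (HS_congr fun p => ?_).2 this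
      simp only [Function.comp, Equiv.ofBijective_apply, Multiset.sum_cons, pow_add]
    · rw [← (Equiv.ofBijective _ (crank_bij1 m j hj)).hasSum_iff]
      have := (HS_mul (hasSum_Q hq j hj) (hasSum_U hq (m + j) j)).mul_left (q ^ j)
      have e : q ^ m * ((1 - q) * Gt q m j) =
          q ^ j * ((1 - q) * (qp q j)⁻¹ * (q ^ ((j + 1) * (m + j)) * (qp q (m + j))⁻¹)) := by
        have p1 : q ^ m * q ^ (j ^ 2 + (m + 2) * j) = q ^ j * q ^ ((j + 1) * (m + j)) := by
          rw [← pow_add, ← pow_add]; ring_nf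
        unfold Gt
        rw [div_eq_mul_inv, mul_inv]
        linear_combination (1 - q) * (qp q j)⁻¹ * (qp q (m + j))⁻¹ * p1
      rw [e]
      refine (HS_congr fun p => ?_).2 this
      simp only [Function.comp, Equiv.ofBijective_apply, Multiset.sum_add, pow_add,
        Multiset.sum_replicate, smul_eq_mul, mul_one]
      ring
  · exact (Equiv.summable_iff _).2 hs

lemma crank_le (b : Bp) : multisetCrank b.1 ≤ (b.1.sum : ℤ) := by
  unfold multisetCrank
  split_ifs with h
  · norm_cast
    exact Multiset.sup_le.2 fun i hi => Multiset.le_sum_of_mem hi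
  · have h1 : (b.1.filter (fun part => b.1.count 1 < part)).card ≤ b.1.card :=
      Multiset.card_le_card (Multiset.filter_le _ _)
    have h2 : b.1.card ≤ b.1.sum := by
      have := Multiset.card_nsmul_le_sum (s := b.1) (a := 1) (fun i hi => b.2 i hi)
      simpa using this
    omega

/-- weight -/
noncomputable def W (r : ℕ) (m : ℤ) : ℂ :=
  if 1 ≤ m then (Nat.choose (m.toNat + (r - 1) / 2) r : ℂ) else 0

lemma W_nat (r m : ℕ) : W r ((m : ℤ) + 1) = (Nat.choose (m + 1 + (r - 1) / 2) r : ℂ) := by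
  unfold W
  rw [if_pos (by omega)]
  rfl

lemma W_summable {q : ℂ} (hq : ‖q‖ < 1) (r : ℕ) (hr : 1 ≤ r) :
    Summable (fun b : Bp => W r (multisetCrank b.1) * q ^ b.1.sum) := by
  obtain ⟨x, hx1, hx2⟩ := exists_between hq
  have hx0 : 0 < x := (norm_nonneg _).trans_lt hx1
  have hρ : ‖(‖q‖ / x)‖ < 1 := by
    rw [Real.norm_eq_abs, abs_of_nonneg (by positivity), div_lt_one hx0]; exact hx1
  have h1 := (summable_choose_mul_geometric_of_norm_lt_one (R := ℝ) r hρ).tendsto_atTop_zero.bddAbove_range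
  obtain ⟨C, hC⟩ := h1
  refine Summable.of_norm_bounded (g := fun b : Bp => C * x ^ b.1.sum)
    ((summable_Bp hx0.le hx2).mul_left C) fun b => ?_
  have h2 : ((b.1.sum + r).choose r : ℝ) * (‖q‖ / x) ^ b.1.sum ≤ C := hC ⟨b.1.sum, rfl⟩
  have h3 : ‖W r (multisetCrank b.1)‖ ≤ ((b.1.sum + r).choose r : ℝ) := by
    unfold W
    split_ifs with h
    · rw [Complex.norm_natCast]
      have := crank_le b
      exact_mod_cast Nat.choose_le_choose r (by omega)
    · simp
  rw [norm_mul, norm_pow]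
  calc _ ≤ ((b.1.sum + r).choose r : ℝ) * ‖q‖ ^ b.1.sum := by gcongr
    _ = (((b.1.sum + r).choose r : ℝ) * (‖q‖ / x) ^ b.1.sum) * x ^ b.1.sum := by
        rw [div_pow]; field_simp
    _ ≤ _ := by gcongr

lemma W_one (r : ℕ) (hr : 3 ≤ r) : W r 1 = 0 := by
  have := W_nat r 0
  simp only [Nat.cast_zero, zero_add] at this
  rw [this, Nat.choose_eq_zero_of_lt (by omega)]; simp

lemma hasSum_nat_of_int {f : ℤ → ℂ} {a : ℂ} (h : HasSum f a) (h0 : ∀ m : ℤ, m < 1 → f m = 0) :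
    HasSum (fun m : ℕ => f ((m : ℤ) + 1)) a := by
  have hinj : Function.Injective (fun m : ℕ => (m : ℤ) + 1) := fun a b h => by simpa using h
  refine (hinj.hasSum_iff (f := f) ?_).2 h
  intro x hx
  apply h0
  by_contra hcon
  exact hx ⟨(x - 1).toNat, by simp only; omega⟩

lemma hasSum_B {q : ℂ} (hq : ‖q‖ < 1) (r : ℕ) (hr : 3 ≤ r) :
    HasSum (fun m : ℕ => (Nat.choose (m + 1 + (r - 1) / 2) r : ℂ) * (q ^ (m + 1) * ((qinf q)⁻¹ * T q (m + 1))))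
      (∑' b : Bp, W r (multisetCrank b.1) * q ^ b.1.sum) := by
  let c : Bp → ℤ := fun b => multisetCrank b.1
  have hs := W_summable hq r (by omega)
  have h := hs.hasSum
  rw [← (Equiv.sigmaFiberEquiv c).hasSum_iff] at h
  have h2 := h.sigma (g := fun m => if 2 ≤ m then W r m * (q ^ m.toNat * ((1 - q) * G q m.toNat)) else 0) ?_
  · have h3 := hasSum_nat_of_int h2 (fun m hm => by simp only [ite_eq_right_iff]; intro; omega)
    refine (HS_congr fun m => ?_).2 h3
    have ht : ((m : ℤ) + 1).toNat = m + 1 := by omega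
    rw [← GT hq, W_nat, ht]
    split_ifs with h4
    · rfl
    · have : m = 0 := by omega
      subst this
      have := W_one r hr
      have h5 := W_nat r 0
      simp only [Nat.cast_zero, zero_add] at h5
      rw [zero_add, ← h5, this, zero_mul]
  · intro m
    change HasSum (fun b : {b : Bp // multisetCrank b.1 = m} => W r (multisetCrank b.1.1) * q ^ b.1.1.sum) _
    have e : ∀ b : {b : Bp // multisetCrank b.1 = m}, W r (multisetCrank b.1.1) * q ^ b.1.1.sum =
      W r m * q ^ b.1.1.sum := fun b => by rw [b.2]
    refine (HS_congr e).2 ?_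
    split_ifs with h4
    · obtain ⟨n, rfl⟩ : ∃ n : ℕ, m = n := ⟨m.toNat, by omega⟩
      exact (hasSum_M hq n (by omega)).mul_left _
    · have : W r m = 0 := by
        rcases lt_or_eq_of_le (show m ≤ 1 by omega) with h5 | h5
        · exact if_neg (by omega)
        · rw [h5]; exact W_one r hr
      simp only [this, zero_mul]
      exact hasSum_zero

abbrev Afs := {s : Finset ℕ // ∀ i ∈ s, 0 < i}

lemma hasSum_A {q : ℂ} (hq : ‖q‖ < 1) :
    HasSum (fun s : Afs => q ^ (s.1.sum id)) (qpinf q) := by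
  have h1 : Summable (fun s : Finset ℕ => ∏ i ∈ s, q ^ (i + 1)) :=
    summable_finsetProd_of_summable_norm (summ_pow hq)
  have h2 := h1.hasSum
  rw [← tprod_one_add h1] at h2
  have bij : Function.Bijective (fun s : Finset ℕ => (⟨s.map ⟨(· + 1), add_left_injective 1⟩, by simp⟩ : Afs)) := by
    constructor
    · intro s s' h
      simp only [Subtype.mk.injEq] at h
      exact Finset.map_injective _ h
    · rintro ⟨s, hs⟩
      refine ⟨s.image (· - 1), Subtype.ext ?_⟩
      ext x
      simp only [Finset.mem_map, Finset.mem_image, Function.Embedding.coeFn_mk]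
      constructor
      · rintro ⟨a, ⟨b, hb, rfl⟩, rfl⟩
        have := hs b hb
        rwa [Nat.sub_add_cancel this]
      · intro hx
        have := hs x hx
        exact ⟨x - 1, ⟨x, hx, rfl⟩, by omega⟩
  rw [← (Equiv.ofBijective _ bij).hasSum_iff]
  refine (HS_congr fun s => ?_).2 h2
  simp only [Function.comp, Equiv.ofBijective_apply, Finset.sum_map, Function.Embedding.coeFn_mk, id]
  rw [Finset.prod_pow_eq_pow_sum]

def ovEquiv : (Σ n, Overpartition n) ≃ Afs × Bp where
  toFun p := ⟨⟨p.2.overlined, p.2.overlined_pos⟩, ⟨p.2.nonoverlined, p.2.nonoverlined_pos⟩⟩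
  invFun p := ⟨_, ⟨p.1.1, p.2.1, p.1.2, p.2.2, rfl⟩⟩
  left_inv := by rintro ⟨n, ⟨a, b, ha, hb, rfl⟩⟩; rfl
  right_inv := by rintro ⟨⟨a, ha⟩, ⟨b, hb⟩⟩; rfl

lemma ov_finite (n : ℕ) : Finite (Overpartition n) := by
  by_contra hinf
  rw [not_finite_iff_infinite] at hinf
  have hq : ‖(1 / 2 : ℂ)‖ < 1 := by norm_num
  have h := (HS_mul (hasSum_A hq) (norm_summable_Bp hq).hasSum).summable
  rw [← ovEquiv.summable_iff] at h
  have h2 := h.comp_injective (i := fun p : Overpartition n => (⟨n, p⟩ : Σ n, Overpartition n))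
    (sigma_mk_injective)
  have h3 : ((fun p : Afs × Bp => (1 / 2 : ℂ) ^ (p.1.1.sum id) * (1 / 2 : ℂ) ^ p.2.1.sum) ∘ ovEquiv) ∘
      (fun p : Overpartition n => (⟨n, p⟩ : Σ n, Overpartition n)) = fun _ => (1 / 2 : ℂ) ^ n := by
    funext p
    simp only [Function.comp, ovEquiv, Equiv.coe_fn_mk]
    rw [← pow_add, p.total]
  rw [h3, summable_const_iff] at h2
  simp at h2

lemma mubar_fin (r n : ℕ) : HasSum (fun p : Overpartition n => W r p.crank) ((mubar r n : ℝ) : ℂ) := by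
  have := ov_finite n
  have := Fintype.ofFinite (Overpartition n)
  have h := hasSum_fintype (fun p : Overpartition n => W r p.crank)
  convert h using 1
  rw [← (Equiv.sigmaFiberEquiv (fun p : Overpartition n => p.crank)).hasSum_iff] at h
  have h2 := h.sigma (g := fun m => W r m * (Mbar m n : ℂ)) ?_
  · have h3 := hasSum_nat_of_int h2 (fun m hm => by
      have : W r m = 0 := if_neg (by omega)
      simp [this])
    rw [← h3.tsum_eq, mubar, Complex.ofReal_tsum]
    refine tsum_congr fun m => ?_
    rw [W_nat]
    push_cast
    rfl
  · intro m
    change HasSum (fun p : {p : Overpartition n // p.crank = m} => W r p.1.crank) _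
    have e : ∀ p : {p : Overpartition n // p.crank = m}, W r p.1.crank = W r m := fun p => by rw [p.2]
    refine (HS_congr e).2 ?_
    have := Fintype.ofFinite {p : Overpartition n // p.crank = m}
    have h5 := hasSum_fintype (fun p : {p : Overpartition n // p.crank = m} => W r m)
    convert h5 using 1
    simp [Mbar, Nat.card_eq_fintype_card, mul_comm]

noncomputable def St (r : ℕ) (q : ℂ) (n : ℕ) : ℂ :=
  (-1) ^ n * (q ^ (tri n + (n + 1) * (r - (r - 1) / 2)) / (1 - q ^ (n + 1)) ^ r)
noncomputable def S (r : ℕ) (q : ℂ) : ℂ := ∑' n, St r q n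

/-- m-sum -/
lemma hasSum_choose (r : ℕ) (hr : 1 ≤ r) {x : ℂ} (hx : ‖x‖ < 1) :
    HasSum (fun m : ℕ => (Nat.choose (m + 1 + (r - 1) / 2) r : ℂ) * x ^ (m + 1))
      (x ^ (r - (r - 1) / 2) / (1 - x) ^ (r + 1)) := by
  have h := (hasSum_choose_mul_geometric_of_norm_lt_one r hx).mul_left (x ^ (r - (r - 1) / 2))
  rw [mul_one_div] at h
  obtain ⟨d, hd⟩ : ∃ d, r - (r - 1) / 2 = d + 1 := ⟨r - (r - 1) / 2 - 1, by omega⟩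
  have hinj : Function.Injective (fun m : ℕ => m + d) := add_left_injective d
  refine (hinj.hasSum_iff ?_).1 ((HS_congr fun m => ?_).2 h)
  · intro m hm
    have : m < d := by
      by_contra hcon
      exact hm ⟨m - d, by simp only; omega⟩
    rw [Nat.choose_eq_zero_of_lt (by omega)]; simp
  · simp only [Function.comp]
    rw [show m + d + 1 + (r - 1) / 2 = m + r by omega, hd]
    ring

lemma B_eq {q : ℂ} (hq : ‖q‖ < 1) (r : ℕ) (hr : 3 ≤ r) :
    ∑' b : Bp, W r (multisetCrank b.1) * q ^ b.1.sum = (qinf q)⁻¹ * S r q := by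
  rw [← (hasSum_B hq r hr).tsum_eq]
  let F : ℕ → ℕ → ℂ := fun m n => (Nat.choose (m + 1 + (r - 1) / 2) r : ℂ) * (q ^ (m + 1) * Tt q (m + 1) n)
  have e1 : ∀ m : ℕ, (Nat.choose (m + 1 + (r - 1) / 2) r : ℂ) * (q ^ (m + 1) * ((qinf q)⁻¹ * T q (m + 1)))
      = (qinf q)⁻¹ * ∑' n, F m n := by
    intro m
    simp only [F, T]
    rw [tsum_mul_left, tsum_mul_left]; ring
  rw [tsum_congr e1, tsum_mul_left]
  congr 1
  have hF : Summable (Function.uncurry F) := by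
    have hb1 : Summable fun m : ℕ => (Nat.choose (m + 1 + (r - 1) / 2) r : ℝ) * ‖q‖ ^ (m + 1) := by
      have := (hasSum_choose r (by omega) (x := (‖q‖ : ℂ)) (by simpa using hq)).summable
      rw [← Complex.summable_ofReal]
      simpa using this
    have hb2 : Summable fun n : ℕ => 2 * ‖q‖ ^ n := (summable_geometric_of_lt_one (norm_nonneg _) hq).mul_left 2
    have hb := hb1.mul_of_nonneg hb2 (fun m => by positivity) (fun n => by positivity)
    refine Summable.of_norm_bounded hb ?_
    rintro ⟨m, n⟩
    simp only [Function.uncurry, F]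
    rw [norm_mul, norm_mul, norm_pow, Complex.norm_natCast, ← mul_assoc]
    refine mul_le_mul_of_nonneg_left ?_ (by positivity)
    refine (Tt_bound hq _ _).trans ?_
    refine mul_le_mul_of_nonneg_left ?_ (by norm_num)
    exact pow_le_pow_of_le_one (norm_nonneg _) hq.le (by have := tri_ge n; nlinarith)
  rw [← Summable.tsum_comm hF]
  unfold S
  refine tsum_congr fun n => ?_
  have h := (hasSum_choose r (by omega) (pow_lt_one' hq n)).mul_left ((-1) ^ n * q ^ tri n * (1 - q ^ (n + 1)))
  rw [tsum_congr (fun m => ?_), h.tsum_eq]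
  · unfold St
    have := one_sub_ne hq n
    rw [pow_add q (tri n), pow_mul q, pow_succ (1 - q ^ (n + 1))]
    field_simp
  · simp only [F, Tt]
    rw [← pow_mul]
    have : q ^ (m + 1) * q ^ (tri n + n * (m + 1)) = q ^ tri n * q ^ ((n + 1) * (m + 1)) := by
      rw [← pow_add, ← pow_add]; ring_nf
    linear_combination ((m + 1 + (r - 1) / 2).choose r : ℂ) * (-1) ^ n * (1 - q ^ (n + 1)) * this

theorem mubar_gf {q : ℂ} (hq : ‖q‖ < 1) (r : ℕ) (hr : 3 ≤ r) :
    HasSum (fun N : ℕ => ((mubar r N : ℝ) : ℂ) * q ^ N) (qpinf q / qinf q * S r q) := by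
  have h := HS_mul (hasSum_A hq) (W_summable hq r (by omega)).hasSum
  rw [B_eq hq r hr, ← ovEquiv.hasSum_iff] at h
  have h2 := h.sigma (g := fun N : ℕ => ((mubar r N : ℝ) : ℂ) * q ^ N) ?_
  · convert h2 using 1; rw [div_eq_mul_inv, mul_assoc]
  · intro n
    have := (mubar_fin r n).mul_right (q ^ n)
    refine (HS_congr fun p => ?_).2 this
    simp only [Function.comp, ovEquiv, Equiv.coe_fn_mk, Overpartition.crank]
    rw [mul_left_comm, ← pow_add, p.total]

end MA

open scoped BigOperators
open Filter MeasureTheory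

namespace MA
open Topology Finset

/-- overpartition generating function -/
noncomputable def Pb (q : ℂ) : ℂ := qpinf q / qinf q

lemma factor_le {z : ℂ} (hz : ‖z‖ < 1) :
    ‖(1 + z) / (1 - z)‖ ≤ (1 + ‖z‖) / (1 - ‖z‖) * Real.exp (-2 * (‖z‖ - z.re)) := by
  have key : ∀ w : ℂ, ‖w‖ < 1 → HasSum (fun n : ℕ => (((1 - (-1) ^ (n + 2)) / ((n : ℝ) + 2)) * (w ^ (n + 2)).re))
      ((Complex.log (1 + w) - Complex.log (1 - w)).re - 2 * w.re) := by
    intro w hw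
    have h1 := Complex.hasSum_taylorSeries_neg_log' hw
    have h2 := Complex.hasSum_taylorSeries_neg_log' (z := -w) (by simpa using hw)
    have h3 := h1.sub h2
    have h4 := (hasSum_nat_add_iff' 1).2 h3
    have h5 := Complex.hasSum_re h4
    convert h5 using 1
    · funext n
      have : w ^ (n + 1 + 1) / (((n + 1 : ℕ) : ℂ) + 1) - (-w) ^ (n + 1 + 1) / (((n + 1 : ℕ) : ℂ) + 1)
        = (((1 - (-1) ^ (n + 2)) / ((n : ℝ) + 2) : ℝ) : ℂ) * w ^ (n + 2) := by
        rw [neg_pow]; push_cast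
        ring
      rw [this, Complex.re_ofReal_mul]
    · simp
      ring
  have hρ : ‖((‖z‖ : ℝ) : ℂ)‖ < 1 := by simpa using hz
  have h := hasSum_le (fun n => ?_) (key z hz) (key _ hρ)
  · have ne1 : 1 - z ≠ 0 := by intro h; rw [← sub_eq_zero.mp h] at hz; simp at hz
    have ne2 : 1 + z ≠ 0 := by intro h; rw [← neg_eq_of_add_eq_zero_right h] at hz; simp at hz
    have e1 : ‖(1 + z) / (1 - z)‖ = Real.exp (Complex.log (1 + z) - Complex.log (1 - z)).re := by
      rw [← Complex.norm_exp, Complex.exp_sub, Complex.exp_log ne1, Complex.exp_log ne2]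
    have e2 : (1 + ‖z‖) / (1 - ‖z‖) = Real.exp (Complex.log (1 + (‖z‖ : ℂ)) - Complex.log (1 - (‖z‖ : ℂ))).re := by
      have := norm_nonneg z
      rw [show (1 + (‖z‖ : ℂ)) = ((1 + ‖z‖ : ℝ) : ℂ) by push_cast; ring,
        show (1 - (‖z‖ : ℂ)) = ((1 - ‖z‖ : ℝ) : ℂ) by push_cast; ring,
        ← Complex.ofReal_log (by linarith), ← Complex.ofReal_log (by linarith), ← Complex.ofReal_sub,
        Complex.ofReal_re, Real.exp_sub, Real.exp_log (by linarith), Real.exp_log (by linarith)]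
    rw [e1, e2, ← Real.exp_add]
    apply Real.exp_le_exp.2
    rw [Complex.ofReal_re] at h
    linarith
  · apply mul_le_mul_of_nonneg_left
    · refine (Complex.re_le_norm _).trans ?_
      rw [← Complex.ofReal_pow, Complex.ofReal_re, norm_pow]
    · apply div_nonneg
      · rcases neg_one_pow_eq_or ℝ (n + 2) with h | h <;> rw [h] <;> norm_num
      · positivity

lemma Pb_tendsto {q : ℂ} (hq : ‖q‖ < 1) :
    Tendsto (fun n => ∏ i ∈ range n, ((1 + q ^ (i + 1)) / (1 - q ^ (i + 1)))) atTop (𝓝 (Pb q)) := by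
  have h1 := (mult_sub hq).hasProd.tendsto_prod_nat
  have h2 := (mult_add hq).hasProd.tendsto_prod_nat
  have := h2.div h1 (qinf_ne hq)
  simp only [Finset.prod_div_distrib, Pb]
  exact this

lemma Pb_le {q : ℂ} (hq : ‖q‖ < 1) :
    ‖Pb q‖ ≤ ‖Pb (‖q‖ : ℂ)‖ * Real.exp (-2 * (‖q‖ / (1 - ‖q‖) - (q / (1 - q)).re)) := by
  have hρ : ‖((‖q‖ : ℝ) : ℂ)‖ < 1 := by simpa using hq
  have s1 : HasSum (fun i : ℕ => (‖q‖ ^ (i + 1) - (q ^ (i + 1)).re)) (‖q‖ / (1 - ‖q‖) - (q / (1 - q)).re) := by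
    have a := (hasSum_geometric_of_lt_one (norm_nonneg q) hq).mul_left ‖q‖
    have b := Complex.hasSum_re ((hasSum_geometric_of_norm_lt_one hq).mul_left q)
    simp_rw [← pow_succ'] at a b
    exact a.sub b
  have s2 := (s1.tendsto_sum_nat.const_mul (-2))
  have s3 := (Pb_tendsto hρ).norm.mul ((Real.continuous_exp.tendsto _).comp s2)
  refine le_of_tendsto_of_tendsto' (Pb_tendsto hq).norm s3 fun n => ?_
  simp only [Function.comp, norm_prod]
  rw [Finset.mul_sum, Real.exp_sum, ← Finset.prod_mul_distrib]
  refine Finset.prod_le_prod (fun i _ => norm_nonneg _) fun i _ => ?_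
  refine (factor_le (pow_lt_one' hq i)).trans (le_of_eq ?_)
  rw [norm_pow]
  congr 1
  have := pow_lt_one' hq i
  rw [norm_pow] at this
  have h0 : 0 ≤ ‖q‖ ^ (i + 1) := by positivity
  rw [← Complex.ofReal_pow, show (1 + ((‖q‖ ^ (i + 1) : ℝ) : ℂ)) / (1 - ((‖q‖ ^ (i + 1) : ℝ) : ℂ)) =
    (((1 + ‖q‖ ^ (i + 1)) / (1 - ‖q‖ ^ (i + 1)) : ℝ) : ℂ) by push_cast; ring, Complex.norm_real,
    Real.norm_of_nonneg (div_nonneg (by linarith) (by linarith))]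

lemma theta_eq {t : ℂ} (ht : 0 < t.re) :
    qinf (Complex.exp (-t)) / qpinf (Complex.exp (-t)) =
      jacobiTheta₂ (1 / 2) (Complex.I * t / Real.pi) := by
  have hq : ‖Complex.exp (-t)‖ < 1 := by
    rw [Complex.norm_exp]; simpa using ht
  have hpi : (Real.pi : ℂ) ≠ 0 := by exact_mod_cast Real.pi_ne_zero
  have hτ : 0 < (Complex.I * t / Real.pi).im := by
    rw [Complex.div_ofReal_im]; simp; positivity
  have h := (hasSum_jacobiTheta₂_term (1 / 2) hτ).nat_add_neg
  have term : ∀ n : ℤ, jacobiTheta₂_term n (1 / 2) (Complex.I * t / Real.pi) = (-1) ^ n.natAbs * Complex.exp (-t) ^ (n.natAbs ^ 2) := by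
    intro n
    unfold jacobiTheta₂_term
    rw [Complex.exp_add, ← Complex.exp_nat_mul]
    congr 1
    · rw [show 2 * (Real.pi : ℂ) * Complex.I * n * (1 / 2) = n * (Real.pi * Complex.I) by ring, Complex.exp_int_mul,
        Complex.exp_pi_mul_I]
      rcases Int.natAbs_eq n with h | h
      · conv_lhs => rw [h]
        rw [zpow_natCast]
      · conv_lhs => rw [h]
        rw [zpow_neg, zpow_natCast, ← inv_pow]; norm_num
    · congr 1
      have : ((n.natAbs ^ 2 : ℕ) : ℂ) = (n : ℂ) ^ 2 := by
        have h2 : ((n.natAbs : ℤ) : ℂ) ^ 2 = (n : ℂ) ^ 2 := by rw [← Int.cast_pow, Int.natAbs_sq, Int.cast_pow]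
        rw [Int.cast_natCast] at h2
        rw [Nat.cast_pow, h2]
      rw [this]
      field_simp
      linear_combination (n : ℂ) ^ 2 * t * Complex.I_sq
  have h2 := ((hasSum_nat_add_iff' 1).2 h).tendsto_sum_nat
  have h3 := (gauss hq).sub_const 1
  have h4 := tendsto_nhds_unique h2 (h3.congr fun n => ?_)
  · simp only [Finset.sum_range_one, term] at h4
    simp at h4
    rw [← h4, one_div]
  · simp only [term]
    rw [add_sub_cancel_left, Finset.mul_sum]
    refine Finset.sum_congr rfl fun i _ => ?_
    have e1 : (((i + 1 : ℕ) : ℤ)).natAbs = i + 1 := Int.natAbs_natCast _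
    have e2 : (-((i + 1 : ℕ) : ℤ)).natAbs = i + 1 := by rw [Int.natAbs_neg]; exact e1
    rw [e1, e2]; ring

lemma theta2_eq {t : ℂ} (ht : 0 < t.re) :
    HasSum (fun n : ℕ => 2 * Complex.exp (-(Real.pi ^ 2 / t)) ^ (n * (n + 1)))
      (jacobiTheta₂ ((1 / 2) / (Complex.I * t / Real.pi)) (-1 / (Complex.I * t / Real.pi))) := by
  have hpi : (Real.pi : ℂ) ≠ 0 := by exact_mod_cast Real.pi_ne_zero
  have ht0 : t ≠ 0 := by rintro rfl; simp at ht
  have hτ : 0 < (-1 / (Complex.I * t / Real.pi)).im := by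
    have : (-1 / (Complex.I * t / Real.pi)) = Complex.I * ((Real.pi : ℂ) * t⁻¹) := by
      field_simp
      rw [Complex.I_sq]
    rw [this, Complex.I_mul_im, Complex.re_ofReal_mul, Complex.inv_re]
    have : 0 < Complex.normSq t := Complex.normSq_pos.2 ht0
    positivity
  have h := hasSum_jacobiTheta₂_term ((1 / 2) / (Complex.I * t / Real.pi)) hτ
  rw [← (Equiv.neg ℤ).hasSum_iff] at h
  have h2 := h.nat_add_neg_add_one
  refine (HS_congr fun n => ?_).2 h2
  have term : ∀ m : ℤ, jacobiTheta₂_term m ((1 / 2) / (Complex.I * t / Real.pi)) (-1 / (Complex.I * t / Real.pi))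
    = Complex.exp (m * (m - 1) * (-(Real.pi ^ 2 / t))) := by
    intro m
    unfold jacobiTheta₂_term
    congr 1
    field_simp
    ring
  simp only [Function.comp, Equiv.neg_apply, term]
  rw [← Complex.exp_nat_mul, two_mul]
  push_cast
  congr 1 <;> congr 1 <;> ring

/-- main term for `Pb` -/
noncomputable def pm (t : ℂ) : ℂ := (1 / 2) * (t / Real.pi) ^ (1 / 2 : ℂ) * Complex.exp (Real.pi ^ 2 / (4 * t))

lemma inv_re_bounds {t : ℂ} (ht : 0 < t.re) (hc : |t.im| ≤ t.re) : 1 / (2 * t.re) ≤ (1 / t).re := by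
  rw [one_div t, Complex.inv_re, Complex.normSq_apply, div_le_div_iff₀ (by positivity) (by nlinarith [mul_self_nonneg t.im])]
  have : t.im ^ 2 ≤ t.re ^ 2 := sq_le_sq' (by linarith [abs_le.1 hc]) (abs_le.1 hc).2
  nlinarith

lemma Pb_cone {t : ℂ} (ht : 0 < t.re) (ht2 : t.re ≤ 1 / 2) (hc : |t.im| ≤ t.re) :
    ‖Pb (Complex.exp (-t)) - pm t‖ ≤ 4 * ‖t‖ ^ 2 * ‖pm t‖ := by
  have ht0 : t ≠ 0 := by rintro rfl; simp at ht
  have hpi : (Real.pi : ℂ) ≠ 0 := by exact_mod_cast Real.pi_ne_zero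
  set X := Complex.exp (-(Real.pi ^ 2 / t)) with hX
  have h := theta2_eq ht
  have h1 := (hasSum_nat_add_iff' 1).2 h
  have hfe := jacobiTheta₂_functional_equation (1 / 2) (Complex.I * t / Real.pi)
  set Θ := jacobiTheta₂ ((1 / 2) / (Complex.I * t / Real.pi)) (-1 / (Complex.I * t / Real.pi)) with hΘ
  simp only [Finset.sum_range_one, zero_mul, pow_zero, mul_one] at h1
  have hXn : ‖X‖ ≤ t.re ^ 2 := by
    rw [hX, Complex.norm_exp]
    have e : (-(Real.pi ^ 2 / t : ℂ)).re = - (Real.pi ^ 2 * (1 / t).re) := by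
      rw [Complex.neg_re, div_eq_mul_one_div, ← Complex.ofReal_pow, Complex.re_ofReal_mul]
    rw [e]
    have h3 := inv_re_bounds ht hc
    have h4 : 9 ≤ Real.pi ^ 2 := by nlinarith [Real.pi_gt_three]
    have h5 : 2 / t.re ≤ Real.pi ^ 2 * (1 / t).re := by
      calc 2 / t.re ≤ 9 * (1 / (2 * t.re)) := by rw [div_le_iff₀ ht]; field_simp; norm_num
        _ ≤ _ := by gcongr
    calc Real.exp (-(Real.pi ^ 2 * (1 / t).re)) ≤ Real.exp (-(2 / t.re)) := Real.exp_le_exp.2 (by linarith)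
      _ = (Real.exp (1 / t.re))⁻¹ ^ 2 := by
          rw [← Real.exp_neg, ← Real.exp_nat_mul]; congr 1; push_cast; ring
      _ ≤ t.re ^ 2 := by
          gcongr
          rw [inv_le_comm₀ (Real.exp_pos _) ht]
          have := Real.add_one_le_exp (1 / t.re)
          rw [← one_div]; linarith
  have hX4 : ‖X‖ ≤ 1 / 4 := hXn.trans (by nlinarith)
  have hX0 := norm_nonneg X
  have hε : ‖Θ - 2‖ ≤ 2 * (2 * t.re ^ 2) := by
    have g := ((hasSum_geometric_of_lt_one hX0 (by linarith)).mul_left (2 * ‖X‖))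
    have : ‖Θ - 2‖ ≤ 2 * ‖X‖ * (1 - ‖X‖)⁻¹ := by
      refine h1.norm_le_of_bounded g fun n => ?_
      rw [norm_mul, norm_pow, mul_assoc, ← pow_succ']
      simp only [Complex.norm_ofNat]
      gcongr 2 * ?_
      exact pow_le_pow_of_le_one hX0 (by linarith) (by nlinarith)
    refine this.trans ?_
    have i2 : (1 - ‖X‖)⁻¹ ≤ 2 := by
      rw [inv_le_comm₀ (by linarith) (by norm_num)]; linarith
    have i3 : 0 ≤ (1 - ‖X‖)⁻¹ := inv_nonneg.2 (by linarith)
    calc 2 * ‖X‖ * (1 - ‖X‖)⁻¹ ≤ 2 * t.re ^ 2 * 2 := by gcongr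
      _ = _ := by ring
  set ε := (Θ - 2) / 2 with hεd
  have hε2 : ‖ε‖ ≤ 2 * t.re ^ 2 := by
    rw [hεd, norm_div]; simp only [Complex.norm_ofNat]; linarith
  have hΘ2 : Θ = 2 * (1 + ε) := by rw [hεd]; ring
  have hε3 : 1 / 2 ≤ ‖1 + ε‖ := by
    have := norm_sub_norm_le (1 : ℂ) (-ε)
    rw [sub_neg_eq_add, norm_neg, norm_one] at this
    nlinarith
  have hε0 : 1 + ε ≠ 0 := by intro h; rw [h, norm_zero] at hε3; norm_num at hε3
  have hτ : -Complex.I * (Complex.I * t / Real.pi) = t / Real.pi := by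
    field_simp; linear_combination (-1 : ℂ) * Complex.I_sq
  have hex : -Real.pi * Complex.I * (1 / 2) ^ 2 / (Complex.I * t / Real.pi) = - (Real.pi ^ 2 / (4 * t) : ℂ) := by
    field_simp; norm_num
  have htp : (t / Real.pi : ℂ) ≠ 0 := div_ne_zero ht0 hpi
  have hcp : (t / Real.pi : ℂ) ^ (1 / 2 : ℂ) ≠ 0 := by
    rw [Ne, Complex.cpow_eq_zero_iff]; tauto
  have hP : Pb (Complex.exp (-t)) = pm t * (1 + ε)⁻¹ := by
    have : Pb (Complex.exp (-t)) = (qinf (Complex.exp (-t)) / qpinf (Complex.exp (-t)))⁻¹ := by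
      rw [Pb, inv_div]
    rw [this, theta_eq ht, hfe, hτ, hex, hΘ2, pm, Complex.exp_neg]
    have := Complex.exp_ne_zero (Real.pi ^ 2 / (4 * t) : ℂ)
    field_simp
  rw [hP, show pm t * (1 + ε)⁻¹ - pm t = pm t * (-ε * (1 + ε)⁻¹) by field_simp; ring, norm_mul, norm_mul,
    norm_neg, norm_inv, mul_comm]
  have i2 : ‖1 + ε‖⁻¹ ≤ 2 := by rw [inv_le_comm₀ (by linarith) (by norm_num)]; linarith
  have i3 : t.re ^ 2 ≤ ‖t‖ ^ 2 := by
    have := Complex.abs_re_le_norm t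
    rw [abs_of_pos ht] at this; gcongr
  refine mul_le_mul_of_nonneg_right ?_ (norm_nonneg _)
  calc ‖ε‖ * ‖1 + ε‖⁻¹ ≤ (2 * ‖t‖ ^ 2) * 2 := by gcongr; linarith
    _ = 4 * ‖t‖ ^ 2 := by ring

end MA

open scoped BigOperators
open Filter MeasureTheory

namespace MA
open Topology Finset

lemma pm_norm_le {t : ℂ} : ‖pm t‖ ≤ ‖t‖ ^ (1 / 2 : ℝ) * Real.exp (Real.pi ^ 2 / 4 * (1 / t).re) := by
  unfold pm
  rw [norm_mul, norm_mul, Complex.norm_exp, show (1 / 2 : ℂ) = ((1 / 2 : ℝ) : ℂ) by push_cast; ring,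
    Complex.norm_cpow_real, norm_div]
  have e : (Real.pi ^ 2 / (4 * t) : ℂ).re = Real.pi ^ 2 / 4 * (1 / t).re := by
    rw [show (Real.pi ^ 2 / (4 * t) : ℂ) = ((Real.pi ^ 2 / 4 : ℝ) : ℂ) * (1 / t) by push_cast; field_simp,
      Complex.re_ofReal_mul]
  rw [e]
  refine mul_le_mul_of_nonneg_right ?_ (Real.exp_pos _).le
  have h1 : (‖t‖ / ‖(Real.pi : ℂ)‖) ^ (1 / 2 : ℝ) ≤ ‖t‖ ^ (1 / 2 : ℝ) := by
    apply Real.rpow_le_rpow (by positivity) _ (by norm_num)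
    apply div_le_self (norm_nonneg _)
    rw [Complex.norm_real, Real.norm_of_nonneg Real.pi_pos.le]
    linarith [Real.pi_gt_three]
  have h2 : ‖((1 / 2 : ℝ) : ℂ)‖ ≤ 1 := by rw [Complex.norm_real]; norm_num
  have h3 : 0 ≤ (‖t‖ / ‖(Real.pi : ℂ)‖) ^ (1 / 2 : ℝ) := by positivity
  calc _ ≤ 1 * ‖t‖ ^ (1 / 2 : ℝ) := by gcongr
    _ = _ := one_mul _

lemma Pb_real {y : ℝ} (hy : 0 < y) (hy2 : y ≤ 1 / 2) :
    ‖Pb (Real.exp (-y) : ℝ)‖ ≤ 2 * Real.exp (Real.pi ^ 2 / 4 / y) := by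
  have h := Pb_cone (t := (y : ℂ)) (by simpa using hy) (by simpa using hy2) (by simpa using hy.le)
  have hp := pm_norm_le (t := (y : ℂ))
  have e1 : ‖(y : ℂ)‖ = y := by rw [Complex.norm_real, Real.norm_of_nonneg hy.le]
  have e2 : (1 / (y : ℂ)).re = 1 / y := by rw [← Complex.ofReal_one, ← Complex.ofReal_div, Complex.ofReal_re]
  rw [e1, e2] at hp
  rw [e1] at h
  have h1 : y ^ (1 / 2 : ℝ) ≤ 1 := Real.rpow_le_one hy.le (by linarith) (by norm_num)
  have h2 : ‖pm y‖ ≤ Real.exp (Real.pi ^ 2 / 4 / y) := by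
    refine hp.trans ?_
    rw [mul_one_div]
    calc _ ≤ 1 * Real.exp (Real.pi ^ 2 / 4 / y) := by gcongr
      _ = _ := one_mul _
  have h3 : ‖Pb (Real.exp (-y) : ℝ)‖ ≤ ‖Pb (Complex.exp (-y)) - pm y‖ + ‖pm y‖ := by
    have := norm_add_le (Pb (Complex.exp (-y)) - pm y) (pm y)
    rw [sub_add_cancel] at this
    rw [Complex.ofReal_exp]
    simpa using this
  have h4 : 4 * y ^ 2 * ‖pm y‖ ≤ 1 * ‖pm y‖ := by gcongr; nlinarith
  linarith

lemma Pb_outer : ∃ κ : ℝ, 0 < κ ∧ ∀ y x : ℝ, 0 < y → y ≤ 1 / 2 → y / 8 ≤ |x| → |x| ≤ Real.pi →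
    ‖Pb (Complex.exp (-(y + x * Complex.I)))‖ ≤ 2 * Real.exp ((Real.pi ^ 2 / 4 - κ) / y) := by
  set A := Real.sqrt (1 + 2 * (1 / 8) ^ 2 / Real.pi ^ 2) with hA
  have hpi := Real.pi_pos
  have hA2 : A ^ 2 = 1 + 2 * (1 / 8) ^ 2 / Real.pi ^ 2 := Real.sq_sqrt (by positivity)
  have hA1 : 1 < A := by
    rw [hA]; apply Real.lt_sqrt_of_sq_lt
    have : 0 < 2 * (1 / 8) ^ 2 / Real.pi ^ 2 := by positivity
    linarith
  have hκ : 0 < 1 - A⁻¹ := by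
    have := inv_lt_one_of_one_lt₀ hA1
    linarith
  refine ⟨1 - A⁻¹, hκ, fun y x hy hy2 hx1 hx2 => ?_⟩
  set q := Complex.exp (-(y + x * Complex.I)) with hq
  have hqn : ‖q‖ = Real.exp (-y) := by rw [hq, Complex.norm_exp]; simp
  have hρ1 : 1 - y ≤ ‖q‖ := by rw [hqn]; linarith [Real.add_one_le_exp (-y)]
  have hρ2 : ‖q‖ < 1 := by rw [hqn, Real.exp_lt_one_iff]; linarith
  have h := Pb_le hρ2
  rw [hqn] at h
  have hr := Pb_real hy hy2
  have e : q = (Real.exp (-y) : ℝ) * (Real.cos x - Real.sin x * Complex.I) := by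
    rw [hq, neg_add, Complex.exp_add, Complex.ofReal_exp, Complex.ofReal_neg, ← neg_mul, Complex.exp_mul_I]
    simp [Complex.cos_neg, Complex.sin_neg, sub_eq_add_neg]
  have hsq : ‖1 - q‖ ^ 2 = (1 - ‖q‖) ^ 2 + 2 * ‖q‖ * (1 - Real.cos x) := by
    rw [← Complex.normSq_eq_norm_sq, Complex.normSq_apply, hqn]
    have r1 : (1 - q).re = 1 - Real.exp (-y) * Real.cos x := by
      rw [e, Complex.sub_re, Complex.re_ofReal_mul]; simp [-Complex.ofReal_cos, -Complex.ofReal_sin]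
    have r2 : (1 - q).im = Real.exp (-y) * Real.sin x := by
      rw [e, Complex.sub_im, Complex.im_ofReal_mul]; simp [-Complex.ofReal_cos, -Complex.ofReal_sin]
    rw [r1, r2]
    linear_combination (Real.exp (-y)) ^ 2 * Real.sin_sq_add_cos_sq x
  have hcos := Real.cos_le_one_sub_mul_cos_sq hx2
  have hx3 : (y / 8) ^ 2 ≤ x ^ 2 := by rw [← sq_abs x]; gcongr
  have hlow : (A * (1 - ‖q‖)) ^ 2 ≤ ‖1 - q‖ ^ 2 := by
    rw [hsq, mul_pow, hA2]
    have a1 : 2 / Real.pi ^ 2 * (y / 8) ^ 2 ≤ 1 - Real.cos x := by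
      have : 2 / Real.pi ^ 2 * (y / 8) ^ 2 ≤ 2 / Real.pi ^ 2 * x ^ 2 := by gcongr
      linarith
    have a2 : (1 - ‖q‖) ^ 2 ≤ y ^ 2 := by
      apply pow_le_pow_left₀ (by linarith) (by linarith)
    have a3 : 2 * (1 / 8) ^ 2 / Real.pi ^ 2 * (1 - ‖q‖) ^ 2 ≤ 2 * (1 / 8) ^ 2 / Real.pi ^ 2 * y ^ 2 := by gcongr
    have a4 : 2 * (1 / 8) ^ 2 / Real.pi ^ 2 * y ^ 2 = 2 / Real.pi ^ 2 * (y / 8) ^ 2 := by ring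
    have a5 : 0 ≤ 2 / Real.pi ^ 2 * (y / 8) ^ 2 := by positivity
    nlinarith
  have hlow2 : A * (1 - ‖q‖) ≤ ‖1 - q‖ := by
    exact (pow_le_pow_iff_left₀ (by nlinarith) (norm_nonneg _) (by norm_num)).1 hlow
  have hρ3 : 0 < 1 - ‖q‖ := by linarith
  have hre : (q / (1 - q)).re ≤ ‖q‖ / (A * (1 - ‖q‖)) := by
    refine (Complex.re_le_norm _).trans ?_
    rw [norm_div]
    gcongr
  have hfin : (1 - A⁻¹) / y ≤ 2 * (‖q‖ / (1 - ‖q‖) - (q / (1 - q)).re) := by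
    have b1 : ‖q‖ / (A * (1 - ‖q‖)) = A⁻¹ * (‖q‖ / (1 - ‖q‖)) := by field_simp
    have b2 : 1 / (2 * y) ≤ ‖q‖ / (1 - ‖q‖) := by
      rw [div_le_div_iff₀ (by positivity) hρ3]; nlinarith
    have b3 : (1 - A⁻¹) * (1 / (2 * y)) ≤ (1 - A⁻¹) * (‖q‖ / (1 - ‖q‖)) := by gcongr
    have b4 : (1 - A⁻¹) / y = 2 * ((1 - A⁻¹) * (1 / (2 * y))) := by field_simp
    rw [b4]; rw [b1] at hre; linarith
  rw [hqn] at hfin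
  calc _ ≤ _ := h
    _ ≤ (2 * Real.exp (Real.pi ^ 2 / 4 / y)) * Real.exp (- ((1 - A⁻¹) / y)) := by
        gcongr
        linarith
    _ = _ := by rw [mul_assoc, ← Real.exp_add]; congr 2; ring

end MA

open scoped BigOperators
open Filter MeasureTheory

namespace MA
open Topology Finset

/-- sector -/
def V (c ε : ℝ) : Set ℂ := {z | c < z.re ∧ |z.im| < ε * z.re}

/-- forward difference -/
def dl (u : ℂ → ℂ) (z : ℂ) : ℂ := u z - u (z + 1)

lemma V_open (c ε : ℝ) : IsOpen (V c ε) := by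
  apply IsOpen.inter
  · exact isOpen_lt continuous_const Complex.continuous_re
  · exact isOpen_lt (continuous_abs.comp Complex.continuous_im) (continuous_const.mul Complex.continuous_re)

lemma zpow_comp {K a b : ℝ} (ha : 0 < a) (hb : 0 < b) (hK : 1 ≤ K) (h1 : a ≤ K * b) (h2 : b ≤ K * a) (p : ℤ) :
    a ^ p ≤ K ^ p.natAbs * b ^ p := by
  have hK0 : 0 < K := by linarith
  rcases Int.natAbs_eq p with h | h
  · rw [h]
    simp only [Int.natAbs_natCast, zpow_natCast]
    rw [← mul_pow]
    exact pow_le_pow_left₀ ha.le h1 _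
  · rw [h]
    simp only [Int.natAbs_neg, Int.natAbs_natCast, zpow_neg, zpow_natCast]
    rw [← inv_pow, ← inv_pow, ← mul_pow]
    apply pow_le_pow_left₀ (by positivity)
    rw [← div_eq_mul_inv, le_div_iff₀ hb, inv_mul_le_iff₀ ha]
    linarith

lemma V_add {c ε : ℝ} (hε : 0 ≤ ε) {z : ℂ} (hz : z ∈ V c ε) {s : ℝ} (hs : 0 ≤ s) : z + s ∈ V c ε := by
  obtain ⟨h1, h2⟩ := hz
  constructor
  · simp; linarith
  · simp; nlinarith

lemma V_ball {c ε : ℝ} (hc : 1 / 2 ≤ c) (hc1 : c ≤ 1) (he1 : ε ≤ 1) {w ζ : ℂ}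
    (hw : w ∈ V (c + 1 / 8) (ε - 1 / 32)) (hζ : ‖ζ - w‖ ≤ w.re / 64) : ζ ∈ V c ε := by
  obtain ⟨h1, h2⟩ := hw
  have a1 := abs_le.1 ((Complex.abs_re_le_norm (ζ - w)).trans hζ)
  have a2 := abs_le.1 ((Complex.abs_im_le_norm (ζ - w)).trans hζ)
  rw [Complex.sub_re] at a1
  rw [Complex.sub_im] at a2
  rw [abs_lt] at h2
  constructor
  · linarith [a1.1]
  · rw [abs_lt]
    have : (ε - 1 / 32) * w.re + w.re / 64 ≤ ε * ζ.re := by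
      by_cases h : 0 ≤ ε
      · nlinarith [mul_le_mul_of_nonneg_left a1.1 h]
      · nlinarith
    constructor <;> linarith [a2.1, a2.2, h2.1, h2.2]

lemma dl_bound (p : ℤ) : ∃ K : ℝ, 0 < K ∧ ∀ (c ε : ℝ) (_ : 1 / 2 ≤ c) (_ : c ≤ 1) (_ : 1 / 32 ≤ ε) (_ : ε ≤ 1)
    (u : ℂ → ℂ) (A : ℝ) (_ : 0 ≤ A) (_ : DifferentiableOn ℂ u (V c ε)) (_ : ∀ z ∈ V c ε, ‖u z‖ ≤ A * z.re ^ p),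
    DifferentiableOn ℂ (dl u) (V (c + 1 / 8) (ε - 1 / 32)) ∧
    ∀ z ∈ V (c + 1 / 8) (ε - 1 / 32), ‖dl u z‖ ≤ (A * K) * z.re ^ (p - 1) := by
  refine ⟨2 ^ p.natAbs * 64 * 3 ^ (p - 1).natAbs, by positivity, ?_⟩
  intro c ε hc hc1 hε hε1 u A hA hu hub
  have sub : ∀ w ∈ V (c + 1 / 8) (ε - 1 / 32), w ∈ V c ε := fun w hw =>
    V_ball hc hc1 hε1 hw (by simp; have := hw.1; linarith)
  have hd : ∀ w ∈ V (c + 1 / 8) (ε - 1 / 32), DifferentiableAt ℂ u w := fun w hw =>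
    hu.differentiableAt ((V_open c ε).mem_nhds (sub w hw))
  have hadd : ∀ w ∈ V (c + 1 / 8) (ε - 1 / 32), w + 1 ∈ V (c + 1 / 8) (ε - 1 / 32) := fun w hw => by
    have := V_add (by linarith) hw (s := 1) zero_le_one
    simpa using this
  constructor
  · intro z hz
    refine (DifferentiableAt.sub (hd z hz) ?_).differentiableWithinAt
    exact (hd _ (hadd z hz)).comp z (by fun_prop)
  · intro z hz
    have hz0 : 1 / 2 < z.re := by have := hz.1; linarith
    have hder : ∀ w ∈ segment ℝ z (z + 1), ‖deriv u w‖ ≤ A * (2 ^ p.natAbs * 64 * 3 ^ (p - 1).natAbs) * z.re ^ (p - 1) := by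
      intro w hw
      rw [segment_eq_image'] at hw
      obtain ⟨θ, ⟨hθ0, hθ1⟩, rfl⟩ := hw
      have hw : z + θ • (z + 1 - z) ∈ V (c + 1 / 8) (ε - 1 / 32) := by
        have := V_add (by linarith) hz hθ0
        simpa using this
      have hre : (z + θ • (z + 1 - z)).re = z.re + θ := by simp
      set w := z + θ • (z + 1 - z) with hwdef
      have hw0 : 0 < w.re := by linarith
      have hC : ∀ ζ ∈ Metric.sphere w (w.re / 64), ‖u ζ‖ ≤ A * (2 ^ p.natAbs * w.re ^ p) := by
        intro ζ hζ
        rw [mem_sphere_iff_norm] at hζ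
        refine (hub ζ (V_ball hc hc1 hε1 hw hζ.le)).trans ?_
        have a1 := abs_le.1 ((Complex.abs_re_le_norm (ζ - w)).trans hζ.le)
        rw [Complex.sub_re] at a1
        gcongr
        apply zpow_comp <;> linarith [a1.1, a1.2]
      have hdc : DiffContOnCl ℂ u (Metric.ball w (w.re / 64)) := by
        apply DifferentiableOn.diffContOnCl
        rw [closure_ball _ (by positivity)]
        intro ζ hζ
        rw [mem_closedBall_iff_norm] at hζ
        exact (hu.differentiableAt ((V_open c ε).mem_nhds (V_ball hc hc1 hε1 hw hζ))).differentiableWithinAt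
      refine (Complex.norm_deriv_le_of_forall_mem_sphere_norm_le (by positivity) hdc hC).trans ?_
      have e1 : w.re ^ (p - 1) ≤ 3 ^ (p - 1).natAbs * z.re ^ (p - 1) := by
        apply zpow_comp <;> linarith
      calc A * (2 ^ p.natAbs * w.re ^ p) / (w.re / 64) = A * (2 ^ p.natAbs * 64) * w.re ^ (p - 1) := by
            rw [zpow_sub₀ hw0.ne', zpow_one]; field_simp
        _ ≤ A * (2 ^ p.natAbs * 64) * (3 ^ (p - 1).natAbs * z.re ^ (p - 1)) := by gcongr
        _ = _ := by ring
    have := Convex.norm_image_sub_le_of_norm_deriv_le (𝕜 := ℂ) (f := u) (s := segment ℝ z (z + 1)) (fun w hw => ?_) hder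
      (convex_segment _ _) (right_mem_segment ℝ z (z + 1)) (left_mem_segment ℝ z (z + 1))
    · unfold dl
      simpa using this
    · rw [segment_eq_image'] at hw
      obtain ⟨θ, ⟨hθ0, hθ1⟩, rfl⟩ := hw
      apply hd
      have := V_add (by linarith) hz hθ0
      simpa using this

/-- alternating sum -/
noncomputable def As (u : ℂ → ℂ) : ℂ := ∑' n : ℕ, (-1) ^ n * u (n + 1)

lemma alt_summable {v : ℕ → ℂ} (h : Summable v) : Summable (fun n => (-1) ^ n * v n) := by
  refine Summable.of_norm_bounded h.norm fun n => ?_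
  simp

lemma dl_summable {u : ℂ → ℂ} (h : Summable (fun n : ℕ => u (n + 1))) : Summable (fun n : ℕ => dl u (n + 1)) := by
  have := (summable_nat_add_iff 1).2 h
  refine (h.sub this).congr fun n => ?_
  simp [dl]

lemma euler1 {u : ℂ → ℂ} (h : Summable (fun n : ℕ => u (n + 1))) : As u = u 1 / 2 + As (dl u) / 2 := by
  have h1 := (alt_summable h).hasSum
  have h2 := (hasSum_nat_add_iff' 1).2 h1
  have h3 := (h1.add h2)
  have h4 : As (dl u) = As u + (As u - u 1) := by
    refine HasSum.tsum_eq ?_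
    convert h3 using 1
    · funext n
      simp [dl, pow_succ]; ring
    · simp [As]
  rw [h4]; ring

/-- Euler transformed sum -/
noncomputable def Ls (u : ℂ → ℂ) : ℂ :=
  u 1 / 2 + dl u 1 / 4 + dl (dl u) 1 / 8 + As (dl (dl (dl u))) / 8

lemma Ls_eq {u : ℂ → ℂ} (h : Summable (fun n : ℕ => u (n + 1))) : Ls u = As u := by
  rw [euler1 h, euler1 (dl_summable h), euler1 (dl_summable (dl_summable h)), Ls]; ring

/-- summability of third differences -/
def Good (u : ℂ → ℂ) : Prop := Summable (fun n : ℕ => dl (dl (dl u)) (n + 1))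

lemma Ls_bound : ∃ K : ℝ, 0 < K ∧ ∀ (u : ℂ → ℂ) (A : ℝ) (_ : 0 ≤ A) (_ : DifferentiableOn ℂ u (V (1 / 2) (1 / 8)))
    (_ : ∀ z ∈ V (1 / 2) (1 / 8), ‖u z‖ ≤ A * z.re), Good u ∧ ‖Ls u‖ ≤ K * A := by
  obtain ⟨K1, hK1, H1⟩ := dl_bound 1
  obtain ⟨K2, hK2, H2⟩ := dl_bound 0
  obtain ⟨K3, hK3, H3⟩ := dl_bound (-1)
  have sm : Summable (fun n : ℕ => (((n : ℝ) + 1) ^ 2)⁻¹) := by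
    have := (summable_nat_add_iff 1).2 (Real.summable_nat_pow_inv.2 (show 1 < 2 by norm_num))
    simpa using this
  refine ⟨1 + K1 + K1 * K2 + K1 * K2 * K3 * ∑' n : ℕ, (((n : ℝ) + 1) ^ 2)⁻¹, ?_, ?_⟩
  · have : 0 ≤ ∑' n : ℕ, (((n : ℝ) + 1) ^ 2)⁻¹ := tsum_nonneg fun n => by positivity
    positivity
  intro u A hA hu hub
  obtain ⟨d1, b1⟩ := H1 (1 / 2) (1 / 8) (by norm_num) (by norm_num) (by norm_num) (by norm_num) u A hA hu
    (by simpa using hub)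
  obtain ⟨d2, b2⟩ := H2 _ _ (by norm_num) (by norm_num) (by norm_num) (by norm_num) _ (A * K1) (by positivity) d1
    (by simpa using b1)
  obtain ⟨d3, b3⟩ := H3 _ _ (by norm_num) (by norm_num) (by norm_num) (by norm_num) _ (A * K1 * K2) (by positivity) d2
    (by simpa using b2)
  have hn : ∀ n : ℕ, ((n : ℂ) + 1) ∈ V (1 / 2 + 1 / 8 + 1 / 8 + 1 / 8) (1 / 8 - 1 / 32 - 1 / 32 - 1 / 32) := by
    intro n
    constructor
    · simp; have : (0 : ℝ) ≤ n := by positivity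
      linarith
    · simp; have : (0 : ℝ) ≤ n := by positivity
      norm_num; linarith
  have mono : ∀ {c c' ε ε' : ℝ} {z : ℂ}, z ∈ V c ε → c' ≤ c → 0 ≤ c → ε ≤ ε' → z ∈ V c' ε' := by
    intro c c' ε ε' z hz h1 h0 h2
    exact ⟨by linarith [hz.1], hz.2.trans_le (by have := hz.1; gcongr; linarith)⟩
  have h1 : (1 : ℂ) ∈ V (1 / 2 + 1 / 8 + 1 / 8 + 1 / 8) (1 / 8 - 1 / 32 - 1 / 32 - 1 / 32) := by simpa using hn 0
  have B : ∀ n : ℕ, ‖dl (dl (dl u)) (n + 1)‖ ≤ A * K1 * K2 * K3 * (((n : ℝ) + 1) ^ 2)⁻¹ := by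
    intro n
    have := b3 _ (hn n)
    refine this.trans (le_of_eq ?_)
    congr 1
  have sB := sm.mul_left (A * K1 * K2 * K3)
  have good : Good u := Summable.of_norm_bounded sB B
  refine ⟨good, ?_⟩
  have n0 : ‖u 1‖ ≤ A := by simpa using hub 1 (mono h1 (by norm_num) (by norm_num) (by norm_num))
  have n1 : ‖dl u 1‖ ≤ A * K1 := by simpa using b1 1 (mono h1 (by norm_num) (by norm_num) (by norm_num))
  have n2 : ‖dl (dl u) 1‖ ≤ A * K1 * K2 := by simpa using b2 1 (mono h1 (by norm_num) (by norm_num) (by norm_num))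
  have n3 : ‖As (dl (dl (dl u)))‖ ≤ A * K1 * K2 * K3 * ∑' n : ℕ, (((n : ℝ) + 1) ^ 2)⁻¹ := by
    refine tsum_of_norm_bounded (sm.hasSum.mul_left (A * K1 * K2 * K3)) fun n => ?_
    simpa using B n
  have hK : 0 ≤ A * K1 * K2 * K3 * ∑' n : ℕ, (((n : ℝ) + 1) ^ 2)⁻¹ := (norm_nonneg _).trans n3
  unfold Ls
  have : ‖u 1 / 2 + dl u 1 / 4 + dl (dl u) 1 / 8 + As (dl (dl (dl u))) / 8‖ ≤ ‖u 1‖ / 2 + ‖dl u 1‖ / 4 +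
      ‖dl (dl u) 1‖ / 8 + ‖As (dl (dl (dl u)))‖ / 8 := by
    refine (norm_add₄_le).trans (le_of_eq ?_)
    simp
  have p1 : 0 ≤ A * K1 := by positivity
  have p2 : 0 ≤ A * K1 * K2 := by positivity
  calc _ ≤ _ := this
    _ ≤ A + A * K1 + A * K1 * K2 + A * K1 * K2 * K3 * ∑' n : ℕ, (((n : ℝ) + 1) ^ 2)⁻¹ := by linarith
    _ = _ := by ring

lemma Good.add {u v : ℂ → ℂ} (hu : Good u) (hv : Good v) : Good (fun z => u z + v z) := by
  refine (Summable.add hu hv).congr fun n => ?_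
  simp only [dl]; ring

lemma Good.smul {u : ℂ → ℂ} (hu : Good u) (k : ℂ) : Good (fun z => k * u z) := by
  refine (Summable.mul_left k hu).congr fun n => ?_
  simp only [dl]; ring

lemma Ls_add {u v : ℂ → ℂ} (hu : Good u) (hv : Good v) : Ls (fun z => u z + v z) = Ls u + Ls v := by
  have : As (dl (dl (dl (fun z => u z + v z)))) = As (dl (dl (dl u))) + As (dl (dl (dl v))) := by
    unfold As
    rw [← (alt_summable hu).tsum_add (alt_summable hv)]
    refine tsum_congr fun n => ?_
    simp only [dl]; ring
  unfold Ls
  rw [this]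
  simp only [dl]; ring

lemma Ls_smul {u : ℂ → ℂ} (k : ℂ) : Ls (fun z => k * u z) = k * Ls u := by
  have : As (dl (dl (dl (fun z => k * u z)))) = k * As (dl (dl (dl u))) := by
    unfold As
    rw [← tsum_mul_left]
    refine tsum_congr fun n => ?_
    simp only [dl]; ring
  unfold Ls
  rw [this]
  simp only [dl]; ring

end MA

open scoped BigOperators
open Filter MeasureTheory

namespace MA
open Topology Finset

lemma sinh_lower {x : ℂ} (hx : 0 ≤ x.re) : x.re ≤ ‖Complex.sinh x‖ := by
  have h1 : Real.exp x.re - Real.exp (-x.re) ≤ ‖Complex.exp x - Complex.exp (-x)‖ := by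
    have := norm_sub_norm_le (Complex.exp x) (Complex.exp (-x))
    rwa [Complex.norm_exp, Complex.norm_exp, Complex.neg_re] at this
  have h2 := Real.self_le_sinh_iff.2 hx
  rw [Real.sinh_eq] at h2
  rw [Complex.sinh, norm_div]
  simp only [Complex.norm_ofNat]
  linarith

lemma sinh_sub {x : ℂ} (hx : ‖x‖ ≤ 1) : ‖Complex.sinh x - x‖ ≤ ‖x‖ ^ 3 := by
  have h1 := Complex.exp_bound hx (n := 3) (by norm_num)
  have h2 := Complex.exp_bound (x := -x) (by simpa using hx) (n := 3) (by norm_num)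
  simp only [Finset.sum_range_succ, Finset.sum_range_zero, norm_neg] at h1 h2
  have e : Complex.sinh x - x = ((Complex.exp x - (0 + x ^ 0 / (Nat.factorial 0 : ℂ) + x ^ 1 / (Nat.factorial 1 : ℂ) + x ^ 2 / (Nat.factorial 2 : ℂ))) -
    (Complex.exp (-x) - (0 + (-x) ^ 0 / (Nat.factorial 0 : ℂ) + (-x) ^ 1 / (Nat.factorial 1 : ℂ) + (-x) ^ 2 / (Nat.factorial 2 : ℂ)))) / 2 := by
    rw [Complex.sinh]; simp [Nat.factorial]; ring
  rw [e, norm_div]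
  have h3 := norm_sub_le (Complex.exp x - (0 + x ^ 0 / (Nat.factorial 0 : ℂ) + x ^ 1 / (Nat.factorial 1 : ℂ) + x ^ 2 / (Nat.factorial 2 : ℂ)))
    (Complex.exp (-x) - (0 + (-x) ^ 0 / (Nat.factorial 0 : ℂ) + (-x) ^ 1 / (Nat.factorial 1 : ℂ) + (-x) ^ 2 / (Nat.factorial 2 : ℂ)))
  simp only [Complex.norm_ofNat]
  have h4 : ‖x‖ ^ 3 * (((3 : ℕ).succ : ℝ) * ((Nat.factorial 3 : ℝ) * ((3 : ℕ) : ℝ))⁻¹) ≤ ‖x‖ ^ 3 := by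
    apply mul_le_of_le_one_right (by positivity)
    norm_num [Nat.factorial]
  linarith

lemma h_bound {x : ℂ} (hx0 : x ≠ 0) (hx : ‖x‖ ≤ 2 * x.re) :
    ‖x / Complex.sinh x‖ ≤ 2 ∧ ‖x / Complex.sinh x - 1‖ ≤ 3 * ‖x‖ ^ 2 := by
  have hn : 0 < ‖x‖ := norm_pos_iff.2 hx0
  have hl := sinh_lower (x := x) (by linarith)
  have hs : 0 < ‖Complex.sinh x‖ := by linarith
  have hs0 : Complex.sinh x ≠ 0 := norm_pos_iff.1 hs
  have b1 : ‖x / Complex.sinh x‖ ≤ 2 := by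
    rw [norm_div, div_le_iff₀ hs]; linarith
  refine ⟨b1, ?_⟩
  by_cases h : ‖x‖ ≤ 1
  · rw [show x / Complex.sinh x - 1 = -(Complex.sinh x - x) / Complex.sinh x by field_simp; ring, norm_div, norm_neg,
      div_le_iff₀ hs]
    refine (sinh_sub h).trans ?_
    nlinarith [sq_nonneg ‖x‖]
  · have := norm_sub_le (x / Complex.sinh x) 1
    rw [norm_one] at this
    nlinarith

lemma pow_sub_one_bound (h : ℂ) (hh : ‖h‖ ≤ 2) (r : ℕ) : ‖h ^ r - 1‖ ≤ r * 2 ^ r * ‖h - 1‖ := by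
  induction r with
  | zero => simp
  | succ n ih =>
    rw [show h ^ (n + 1) - 1 = h * (h ^ n - 1) + (h - 1) by ring]
    refine (norm_add_le _ _).trans ?_
    rw [norm_mul]
    have : ‖h‖ * ‖h ^ n - 1‖ ≤ 2 * (n * 2 ^ n * ‖h - 1‖) := by gcongr
    have h2 : (1 : ℝ) ≤ 2 ^ (n + 1) := one_le_pow₀ (by norm_num)
    push_cast
    have h3 := mul_le_mul_of_nonneg_right h2 (norm_nonneg (h - 1))
    calc _ ≤ 2 * (n * 2 ^ n * ‖h - 1‖) + ‖h - 1‖ := by gcongr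
      _ ≤ 2 * (n * 2 ^ n * ‖h - 1‖) + 2 ^ (n + 1) * ‖h - 1‖ := by linarith
      _ = _ := by ring

lemma exp_bound2 {w : ℂ} (hw : 0 ≤ w.re) : ‖Complex.exp (-w) - 1 + w‖ ≤ 3 * ‖w‖ ^ 2 := by
  by_cases h : ‖w‖ ≤ 1
  · have := Complex.norm_exp_sub_one_sub_id_le (x := -w) (by simpa using h)
    rw [sub_neg_eq_add, norm_neg] at this
    nlinarith [sq_nonneg ‖w‖]
  · have h1 : ‖Complex.exp (-w)‖ ≤ 1 := by
      rw [Complex.norm_exp, Real.exp_le_one_iff, Complex.neg_re]; linarith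
    have h2 := norm_add_le (Complex.exp (-w) - 1) w
    have h3 := norm_sub_le (Complex.exp (-w)) 1
    rw [norm_one] at h3
    nlinarith

/-- the shift -/
noncomputable def rho (r : ℕ) : ℝ := (r : ℝ) / 2 - (((r - 1) / 2 : ℕ) : ℝ) - 1 / 2

lemma rho_bd (r : ℕ) (hr : 1 ≤ r) : 0 ≤ rho r ∧ rho r ≤ 1 / 2 := by
  unfold rho
  have h1 : 2 * ((r - 1) / 2) + 1 ≤ r := by omega
  have h2 : r ≤ 2 * ((r - 1) / 2) + 2 := by omega
  have h1' : 2 * (((r - 1) / 2 : ℕ) : ℝ) + 1 ≤ r := by exact_mod_cast h1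
  have h2' : (r : ℝ) ≤ 2 * (((r - 1) / 2 : ℕ) : ℝ) + 2 := by exact_mod_cast h2
  constructor <;> linarith

noncomputable def ww (r : ℕ) (t z : ℂ) : ℂ := t * z ^ 2 / 2 + t * rho r * z
noncomputable def ff (r : ℕ) (t z : ℂ) : ℂ := t ^ r * (Complex.exp (-ww r t z) / (2 * Complex.sinh (z * t / 2)) ^ r)

/-- cone for t -/
def Cone (t : ℂ) : Prop := 0 < t.re ∧ |t.im| ≤ t.re / 8

/-- remainder -/
noncomputable def rem (r : ℕ) (t z : ℂ) : ℂ :=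
  ff r t z - (z ^ r)⁻¹ + (t / 2) * (z ^ 2 / z ^ r) + (t * rho r) * (z / z ^ r)

lemma geom {t z : ℂ} (ht : Cone t) (hz : z ∈ V (1 / 2) (1 / 8)) :
    0 ≤ (t * z ^ 2).re ∧ 0 ≤ (t * z).re ∧ ‖z * t / 2‖ ≤ 2 * (z * t / 2).re ∧ ‖z‖ ≤ 2 * z.re := by
  obtain ⟨h1, h2⟩ := ht
  obtain ⟨h3, h4⟩ := hz
  have h2' := abs_le.1 h2
  have h4' := abs_lt.1 h4
  have p : 0 < t.re * z.re := mul_pos h1 (by linarith)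
  have hz0 : 0 < z.re := by linarith
  have q1 : |t.im * z.im| ≤ t.re * z.re / 64 := by
    rw [abs_mul]
    calc |t.im| * |z.im| ≤ (t.re / 8) * (1 / 8 * z.re) := by gcongr
      _ = _ := by ring
  have q2 : |t.re * z.im| ≤ t.re * z.re / 8 := by
    rw [abs_mul, abs_of_pos h1]
    calc t.re * |z.im| ≤ t.re * (1 / 8 * z.re) := by gcongr
      _ = _ := by ring
  have q3 : |t.im * z.re| ≤ t.re * z.re / 8 := by
    rw [abs_mul, abs_of_pos hz0]
    calc |t.im| * z.re ≤ (t.re / 8) * z.re := by gcongr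
      _ = _ := by ring
  have a1 := abs_le.1 q1
  have a2 := abs_le.1 q2
  have a3 := abs_le.1 q3
  have hre : (t * z).re = t.re * z.re - t.im * z.im := Complex.mul_re _ _
  have him : (t * z).im = t.re * z.im + t.im * z.re := Complex.mul_im _ _
  refine ⟨?_, ?_, ?_, ?_⟩
  · rw [show t * z ^ 2 = (t * z) * z by ring, Complex.mul_re, hre, him]
    have q4 : |(t.re * z.im + t.im * z.re) * z.im| ≤ (t.re * z.re / 4) * (1 / 8 * z.re) := by
      rw [abs_mul]
      gcongr
      rw [abs_le]; constructor <;> linarith [a2.1, a2.2, a3.1, a3.2]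
    have a4 := abs_le.1 q4
    have : (t.re * z.re / 2) * z.re ≤ (t.re * z.re - t.im * z.im) * z.re := by gcongr; linarith [a1.2]
    have pp : 0 < t.re * z.re * z.re := by positivity
    linarith [a4.2]
  · rw [hre]; linarith [a1.2]
  · have e : z * t / 2 = ((1 / 2 : ℝ) : ℂ) * (t * z) := by push_cast; ring
    rw [e, Complex.re_ofReal_mul, norm_mul, Complex.norm_real]
    have : ‖t * z‖ ≤ |(t * z).re| + |(t * z).im| := Complex.norm_le_abs_re_add_abs_im _
    have hp : 0 ≤ (t * z).re := by rw [hre]; linarith [a1.2]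
    rw [abs_of_nonneg hp] at this
    have h5 : |(t * z).im| ≤ (t * z).re := by
      rw [hre, him, abs_le]; constructor <;> linarith [a1.1, a1.2, a2.1, a2.2, a3.1, a3.2]
    rw [Real.norm_of_nonneg (by norm_num : (0:ℝ) ≤ 1/2)]
    linarith
  · have : ‖z‖ ≤ |z.re| + |z.im| := Complex.norm_le_abs_re_add_abs_im _
    rw [abs_of_pos hz0] at this
    linarith

lemma rem_bound (r : ℕ) (hr : 3 ≤ r) : ∃ K : ℝ, 0 < K ∧ ∀ t : ℂ, Cone t →
    DifferentiableOn ℂ (rem r t) (V (1 / 2) (1 / 8)) ∧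
    ∀ z ∈ V (1 / 2) (1 / 8), ‖rem r t z‖ ≤ K * ‖t‖ ^ 2 * z.re := by
  obtain ⟨ρ0, ρ1⟩ := rho_bd r (by omega)
  obtain ⟨k, rfl⟩ : ∃ k, r = k + 3 := ⟨r - 3, by omega⟩
  set r := k + 3 with hrdef
  refine ⟨(3 * (r * 2 ^ r) + 12) * 2 ^ (k + 1), by positivity, fun t ht => ⟨?_, ?_⟩⟩
  · intro z hz
    obtain ⟨g1, g2, g3, g4⟩ := geom ht hz
    have hz0 : z ≠ 0 := by rintro rfl; have := hz.1; simp at this; linarith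
    have ht0 : t ≠ 0 := by rintro rfl; have := ht.1; simp at this
    have hx0 : z * t / 2 ≠ 0 := by simp [hz0, ht0]
    have hs : Complex.sinh (z * t / 2) ≠ 0 := by
      have hn : 0 < ‖z * t / 2‖ := norm_pos_iff.2 hx0
      have := sinh_lower (x := z * t / 2) (by linarith)
      exact norm_pos_iff.1 (by linarith)
    apply DifferentiableAt.differentiableWithinAt
    unfold rem ff ww
    have n1 : z ^ r ≠ 0 := pow_ne_zero _ hz0
    have n2 : (2 * Complex.sinh (z * t / 2)) ^ r ≠ 0 := pow_ne_zero _ (mul_ne_zero two_ne_zero hs)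
    fun_prop (disch := assumption)
  · intro z hz
    obtain ⟨g1, g2, g3, g4⟩ := geom ht hz
    have hz0 : z ≠ 0 := by rintro rfl; have := hz.1; simp at this; linarith
    have ht0 : t ≠ 0 := by rintro rfl; have := ht.1; simp at this
    have hx0 : z * t / 2 ≠ 0 := by simp [hz0, ht0]
    have hs : Complex.sinh (z * t / 2) ≠ 0 := by
      have hn : 0 < ‖z * t / 2‖ := norm_pos_iff.2 hx0
      have := sinh_lower (x := z * t / 2) (by linarith)
      exact norm_pos_iff.1 (by linarith)
    set h := (z * t / 2) / Complex.sinh (z * t / 2) with hh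
    obtain ⟨b1, b2⟩ := h_bound hx0 g3
    rw [← hh] at b1 b2
    have e : rem r t z = (z ^ r)⁻¹ * (Complex.exp (-ww r t z) * (h ^ r - 1) + (Complex.exp (-ww r t z) - 1 + ww r t z)) := by
      have : h ^ r = z ^ r * t ^ r / (2 * Complex.sinh (z * t / 2)) ^ r := by
        rw [hh, ← mul_pow, ← div_pow]; congr 1; field_simp
      rw [this]
      have n1 : z ^ r ≠ 0 := pow_ne_zero _ hz0
      have n2 : (2 * Complex.sinh (z * t / 2)) ^ r ≠ 0 := pow_ne_zero _ (mul_ne_zero two_ne_zero hs)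
      unfold rem ff
      field_simp
      unfold ww
      ring
    have hzr : 1 / 2 < z.re := hz.1
    have hzn : 1 / 2 ≤ ‖z‖ := by linarith [Complex.re_le_norm z]
    have hwre : 0 ≤ (ww r t z).re := by
      have : ww r t z = ((1 / 2 : ℝ) : ℂ) * (t * z ^ 2) + (rho r : ℂ) * (t * z) := by unfold ww; push_cast; ring
      rw [this, Complex.add_re, Complex.re_ofReal_mul, Complex.re_ofReal_mul]
      positivity
    have hwn : ‖ww r t z‖ ≤ 2 * (‖t‖ * ‖z‖ ^ 2) := by
      have : ww r t z = ((1 / 2 : ℝ) : ℂ) * (t * z ^ 2) + (rho r : ℂ) * (t * z) := by unfold ww; push_cast; ring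
      rw [this]
      refine (norm_add_le _ _).trans ?_
      rw [norm_mul, norm_mul, norm_mul, norm_mul, Complex.norm_real, Complex.norm_real, norm_pow, Real.norm_of_nonneg ρ0,
        Real.norm_of_nonneg (by norm_num)]
      have h1 : rho r * (‖t‖ * ‖z‖) ≤ 1 / 2 * (‖t‖ * ‖z‖) := by gcongr
      have h2 : ‖t‖ * ‖z‖ ≤ ‖t‖ * (2 * ‖z‖ ^ 2) := by gcongr; nlinarith
      have h3 : 0 ≤ ‖t‖ * ‖z‖ ^ 2 := by positivity
      linarith
    have hexp : ‖Complex.exp (-ww r t z)‖ ≤ 1 := by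
      rw [Complex.norm_exp, Real.exp_le_one_iff, Complex.neg_re]; linarith
    have c1 := pow_sub_one_bound h b1 r
    have c2 := exp_bound2 hwre
    have c3 : ‖Complex.exp (-ww r t z) * (h ^ r - 1)‖ ≤ 3 * (r * 2 ^ r) * (‖t‖ ^ 2 * ‖z‖ ^ 4) := by
      rw [norm_mul]
      have hx2 : ‖z * t / 2‖ ^ 2 ≤ ‖t‖ ^ 2 * ‖z‖ ^ 4 := by
        rw [norm_div, norm_mul, Complex.norm_ofNat]
        have h14 : 1 / 4 ≤ ‖z‖ ^ 2 := by nlinarith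
        have : ‖z‖ ^ 2 ≤ 4 * ‖z‖ ^ 4 := by
          rw [show ‖z‖ ^ 4 = ‖z‖ ^ 2 * ‖z‖ ^ 2 by ring]; nlinarith
        calc (‖z‖ * ‖t‖ / 2) ^ 2 = ‖t‖ ^ 2 * (‖z‖ ^ 2 / 4) := by ring
          _ ≤ ‖t‖ ^ 2 * ‖z‖ ^ 4 := by gcongr; linarith
      calc _ ≤ 1 * (r * 2 ^ r * (3 * (‖t‖ ^ 2 * ‖z‖ ^ 4))) := by
            gcongr
            refine c1.trans ?_
            gcongr
            exact b2.trans (by linarith)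
        _ = _ := by ring
    have c4 : ‖Complex.exp (-ww r t z) - 1 + ww r t z‖ ≤ 12 * (‖t‖ ^ 2 * ‖z‖ ^ 4) := by
      refine c2.trans ?_
      calc 3 * ‖ww r t z‖ ^ 2 ≤ 3 * (2 * (‖t‖ * ‖z‖ ^ 2)) ^ 2 := by gcongr
        _ = _ := by ring
    rw [e, norm_mul, norm_inv, norm_pow]
    have c5 := norm_add_le (Complex.exp (-ww r t z) * (h ^ r - 1)) (Complex.exp (-ww r t z) - 1 + ww r t z)
    have c6 : ‖z‖⁻¹ ≤ 2 := by rw [inv_le_comm₀ (by linarith) (by norm_num)]; linarith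
    calc _ ≤ (‖z‖ ^ r)⁻¹ * ((3 * (r * 2 ^ r) + 12) * (‖t‖ ^ 2 * ‖z‖ ^ 4)) := by gcongr; linarith
      _ = (3 * (r * 2 ^ r) + 12) * ‖t‖ ^ 2 * (‖z‖⁻¹ ^ k * ‖z‖) := by
          have hzp : ‖z‖ ≠ 0 := (by linarith : 0 < ‖z‖).ne'
          have : (‖z‖ ^ r)⁻¹ * ‖z‖ ^ 4 = ‖z‖⁻¹ ^ k * ‖z‖ := by
            rw [hrdef, pow_add, inv_pow]; field_simp
          rw [← this]; ring
      _ ≤ (3 * (r * 2 ^ r) + 12) * ‖t‖ ^ 2 * (2 ^ k * (2 * z.re)) := by gcongr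
      _ = _ := by ring

end MA

open scoped BigOperators
open Filter MeasureTheory

namespace MA
open Topology Finset

lemma good_mon (j r : ℕ) (h : j ≤ r) : Good (fun z : ℂ => z ^ j / z ^ r) := by
  obtain ⟨K, hK, H⟩ := Ls_bound
  obtain ⟨m, rfl⟩ : ∃ m, r = j + m := ⟨r - j, by omega⟩
  have hz0 : ∀ z ∈ V (1 / 2) (1 / 8), z ≠ 0 := by
    rintro z hz rfl; have := hz.1; simp at this; linarith
  refine (H _ (2 ^ (m + 1)) (by positivity) ?_ ?_).1
  · intro z hz
    apply DifferentiableAt.differentiableWithinAt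
    have n1 : z ^ (j + m) ≠ 0 := pow_ne_zero _ (hz0 z hz)
    fun_prop (disch := assumption)
  · intro z hz
    have h0 := hz0 z hz
    have e : z ^ j / z ^ (j + m) = (z ^ m)⁻¹ := by rw [pow_add]; field_simp
    rw [e, norm_inv, norm_pow, ← inv_pow]
    have hzr : 1 / 2 < z.re := hz.1
    have hzn : 1 / 2 ≤ ‖z‖ := by linarith [Complex.re_le_norm z]
    have c6 : ‖z‖⁻¹ ≤ 2 := by rw [inv_le_comm₀ (by linarith) (by norm_num)]; linarith
    calc ‖z‖⁻¹ ^ m ≤ 2 ^ m := by gcongr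
      _ ≤ 2 ^ (m + 1) * z.re := by
        rw [pow_succ]; have : (0 : ℝ) < 2 ^ m := by positivity
        nlinarith

lemma tri_cast (n : ℕ) : (tri n : ℂ) = (n : ℂ) * (n + 1) / 2 := by
  induction n with
  | zero => simp [tri]
  | succ n ih => rw [tri_succ]; push_cast; rw [ih]; ring

lemma St_norm {q : ℂ} (hq : ‖q‖ < 1) (r : ℕ) (n : ℕ) : ‖St r q n‖ ≤ ‖q‖ ^ n * ((1 - ‖q‖) ^ r)⁻¹ := by
  unfold St
  rw [norm_mul, norm_pow, norm_neg, norm_one, one_pow, one_mul, norm_div, norm_pow, norm_pow, div_eq_mul_inv]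
  have h0 : 0 < 1 - ‖q‖ := by linarith
  gcongr ?_ * ?_
  · exact pow_le_pow_of_le_one (norm_nonneg _) hq.le (by have := tri_ge n; omega)
  · gcongr
    have := norm_sub_norm_le (1 : ℂ) (q ^ (n + 1))
    rw [norm_one, norm_pow] at this
    have h2 : ‖q‖ ^ (n + 1) ≤ ‖q‖ := pow_le_of_le_one (norm_nonneg _) hq.le (by omega)
    linarith

lemma St_summable {q : ℂ} (hq : ‖q‖ < 1) (r : ℕ) : Summable (St r q) :=
  Summable.of_norm_bounded ((summable_geometric_of_lt_one (norm_nonneg _) hq).mul_right _) (St_norm hq r)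

lemma S_norm {q : ℂ} (hq : ‖q‖ < 1) (r : ℕ) : ‖S r q‖ ≤ ((1 - ‖q‖) ^ (r + 1))⁻¹ := by
  have := tsum_of_norm_bounded ((hasSum_geometric_of_lt_one (norm_nonneg _) hq).mul_right (((1 - ‖q‖) ^ r)⁻¹)) (St_norm hq r)
  refine this.trans_eq ?_
  rw [pow_succ, mul_inv]; ring

lemma S_global {y x : ℝ} (hy : 0 < y) (hy2 : y ≤ 1 / 2) (r : ℕ) :
    ‖S r (Complex.exp (-(y + x * Complex.I)))‖ ≤ (2 / y) ^ (r + 1) := by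
  have hn : ‖Complex.exp (-(y + x * Complex.I))‖ = Real.exp (-y) := by
    rw [Complex.norm_exp]; simp
  have hq : ‖Complex.exp (-(y + x * Complex.I))‖ < 1 := by rw [hn, Real.exp_lt_one_iff]; linarith
  refine (S_norm hq r).trans ?_
  rw [hn, ← inv_pow]
  have h1 : y / 2 ≤ 1 - Real.exp (-y) := by
    have h2 : Real.exp (-y) ≤ 1 / (1 + y) := by
      rw [Real.exp_neg, one_div]; gcongr; linarith [Real.add_one_le_exp y]
    have h3 : 1 / (1 + y) ≤ 1 - y / 2 := by
      rw [div_le_iff₀ (by linarith)]; nlinarith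
    linarith
  have : 0 < 1 - Real.exp (-y) := by linarith
  gcongr
  rw [inv_le_comm₀ this (by positivity)]
  calc (2 / y)⁻¹ = y / 2 := by rw [inv_div]
    _ ≤ _ := h1

lemma ff_St (r : ℕ) (t : ℂ) (ht : 0 < t.re) (n : ℕ) :
    ff r t ((n : ℂ) + 1) = t ^ r * ((-1) ^ n * St r (Complex.exp (-t)) n) := by
  have hq : ‖Complex.exp (-t)‖ < 1 := by rw [Complex.norm_exp, Real.exp_lt_one_iff]; simpa using ht
  have hne := one_sub_ne hq n
  unfold ff St
  congr 1
  rw [← mul_assoc, ← mul_pow]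
  simp only [mul_neg, mul_one, neg_neg, one_pow, one_mul]
  have hf : (r - 1) / 2 ≤ r := by omega
  have e1 : 2 * Complex.sinh ((n + 1) * t / 2) = Complex.exp ((n + 1) * t / 2) * (1 - Complex.exp (-t) ^ (n + 1)) := by
    rw [Complex.sinh, mul_sub, ← Complex.exp_nat_mul, ← Complex.exp_add]
    rw [show (n + 1) * t / 2 + ((n + 1 : ℕ) : ℂ) * -t = -((n + 1) * t / 2) by push_cast; ring]
    ring
  rw [e1, mul_pow, ← Complex.exp_nat_mul _ r, ← Complex.exp_nat_mul _ (tri n + _)]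
  rw [div_mul_eq_div_div, ← Complex.exp_sub]
  congr 2
  unfold ww rho
  push_cast [Nat.cast_sub hf, tri_cast]
  ring

lemma ff_summable (r : ℕ) (t : ℂ) (ht : 0 < t.re) : Summable (fun n : ℕ => ff r t ((n : ℂ) + 1)) := by
  have hq : ‖Complex.exp (-t)‖ < 1 := by rw [Complex.norm_exp, Real.exp_lt_one_iff]; simpa using ht
  simp only [ff_St r t ht]
  exact (alt_summable (St_summable hq r)).mul_left _

lemma As_ff (r : ℕ) (t : ℂ) (ht : 0 < t.re) : As (ff r t) = t ^ r * S r (Complex.exp (-t)) := by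
  unfold As S
  rw [← tsum_mul_left]
  congr 1; funext n
  rw [ff_St r t ht]
  have : ((-1 : ℂ) ^ n) * (-1) ^ n = 1 := by rw [← mul_pow]; simp
  linear_combination t ^ r * St r (Complex.exp (-t)) n * this

theorem S_cone (r : ℕ) (hr : 3 ≤ r) : ∃ d : ℂ, ∃ K : ℝ, 0 < K ∧ ∀ t : ℂ, Cone t →
    ‖t ^ r * S r (Complex.exp (-t)) - (As (fun z => (z ^ r)⁻¹) + d * t)‖ ≤ K * ‖t‖ ^ 2 := by
  obtain ⟨K1, hK1, H1⟩ := rem_bound r hr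
  obtain ⟨K, hK, H⟩ := Ls_bound
  have g0 : Good (fun z : ℂ => z ^ 0 / z ^ r) := good_mon 0 r (by omega)
  have g1 : Good (fun z : ℂ => z ^ 1 / z ^ r) := good_mon 1 r (by omega)
  have g2 : Good (fun z : ℂ => z ^ 2 / z ^ r) := good_mon 2 r (by omega)
  refine ⟨-(1/2) * Ls (fun z : ℂ => z ^ 2 / z ^ r) - rho r * Ls (fun z : ℂ => z ^ 1 / z ^ r), K * K1, by positivity, ?_⟩
  intro t ht
  obtain ⟨D, B⟩ := H1 t ht
  obtain ⟨gr, br⟩ := H (rem r t) (K1 * ‖t‖ ^ 2) (by positivity) D B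
  have e : ff r t = fun z => (fun z => z ^ 0 / z ^ r) z + (fun z => (fun z => (-(t / 2)) * (fun z => z ^ 2 / z ^ r) z) z + (fun z => (fun z => (-(t * rho r)) * (fun z => z ^ 1 / z ^ r) z) z + rem r t z) z) z := by
    funext z
    unfold rem
    simp only [pow_zero, pow_one, one_div]
    ring
  have e2 : As (ff r t) = As (fun z => (z ^ r)⁻¹) + -(t / 2) * Ls (fun z : ℂ => z ^ 2 / z ^ r) + -(t * rho r) * Ls (fun z : ℂ => z ^ 1 / z ^ r) + Ls (rem r t) := by
    rw [← Ls_eq (ff_summable r t ht.1), e]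
    have k1 : Good (fun z => (fun z => (-(t * rho r)) * (fun z => z ^ 1 / z ^ r) z) z + rem r t z) := (g1.smul _).add gr
    have k2 := (g2.smul (-(t / 2))).add k1
    rw [Ls_add g0 k2, Ls_add (g2.smul _) k1, Ls_add (g1.smul _) gr, Ls_smul, Ls_smul]
    have : Ls (fun z => z ^ 0 / z ^ r) = As (fun z => (z ^ r)⁻¹) := by
      simp only [pow_zero, one_div]
      apply Ls_eq
      have := (summable_nat_add_iff 1).2 (Real.summable_one_div_nat_pow (p := r) |>.2 (by omega))
      refine Summable.of_norm_bounded this (fun n => ?_)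
      rw [norm_inv, norm_pow, one_div]
      have e3 : ‖(n : ℂ) + 1‖ = ((n + 1 : ℕ) : ℝ) := by
        rw [← Complex.norm_natCast]; push_cast; rfl
      rw [e3]
    rw [this]; ring
  rw [← As_ff r t ht.1, e2]
  calc _ = ‖Ls (rem r t)‖ := by congr 1; ring
    _ ≤ _ := br
    _ = _ := by ring

lemma eta_eq (r : ℕ) (hr : 3 ≤ r) : As (fun z => (z ^ r)⁻¹) = (((riemannZeta r).re * (1 - 2 ^ (1 - (r : ℝ))) : ℝ) : ℂ) := by
  have hs : Summable (fun n : ℕ => 1 / ((n : ℝ)) ^ r) := Real.summable_one_div_nat_pow.2 (by omega)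
  set f : ℕ → ℝ := fun n => 1 / ((n : ℝ)) ^ r with hf
  have hz : riemannZeta r = ((∑' n, f n : ℝ) : ℂ) := by
    rw [zeta_nat_eq_tsum_of_gt_one (by omega)]; push_cast; simp [hf]
  have hz' : (riemannZeta r).re = ∑' n, f n := by rw [hz, Complex.ofReal_re]
  have hf0 : f 0 = 0 := by simp [hf]; omega
  have hs1 : Summable (fun n => f (n + 1)) := (summable_nat_add_iff 1).2 hs
  have hz1 : ∑' n, f n = ∑' n, f (n + 1) := by rw [hs.tsum_eq_zero_add, hf0, zero_add]
  have hev : Summable (fun k => f (2 * k + 1)) := hs.comp_injective (fun a b h => by simpa using h)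
  have hod : Summable (fun k => f (2 * k + 1 + 1)) := hs1.comp_injective (i := fun k => 2 * k + 1) (fun a b h => by simpa using h)
  have s1 : ∑' n, f (n + 1) = ∑' k, f (2 * k + 1) + ∑' k, f (2 * k + 1 + 1) :=
    (tsum_even_add_odd (f := fun n => f (n + 1)) hev hod).symm
  have s2 : As (fun z => (z ^ r)⁻¹) = ((∑' k, f (2 * k + 1) - ∑' k, f (2 * k + 1 + 1) : ℝ) : ℂ) := by
    have : As (fun z => (z ^ r)⁻¹) = ((∑' n, (-1 : ℝ) ^ n * f (n + 1) : ℝ) : ℂ) := by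
      unfold As; push_cast; congr 1; funext n; simp [hf]
    rw [this]
    have := tsum_even_add_odd (f := fun n => (-1 : ℝ) ^ n * f (n + 1)) (by simpa [pow_mul] using hev) (by simpa [pow_succ, pow_mul] using hod.neg)
    rw [← this]
    simp [pow_succ, pow_mul, tsum_neg, sub_eq_add_neg]
  have s3 : ∑' k, f (2 * k + 1 + 1) = (1 / 2) ^ r * ∑' n, f (n + 1) := by
    rw [← tsum_mul_left]; congr 1; funext k
    simp only [hf]; push_cast
    rw [show (2 * (k : ℝ) + 1 + 1) = 2 * (k + 1) by ring, mul_pow, div_pow, one_pow]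
    field_simp
  rw [s2, hz', hz1]
  congr 1
  have : (2 : ℝ) ^ (1 - (r : ℝ)) = 2 * (1 / 2) ^ r := by
    rw [Real.rpow_sub (by norm_num), Real.rpow_one, Real.rpow_natCast, one_div, inv_pow]; ring
  rw [this]
  have := s1
  rw [s3] at this ⊢
  linear_combination -this

end MA

open scoped BigOperators
open Filter MeasureTheory

namespace MA
open Topology Finset

lemma gamma_cx {w : ℝ} (hw : 0 < w) {t : ℂ} (ht : 0 < t.re) :
    ∫ u in Set.Ioi (0 : ℝ), ((u ^ (w - 1) : ℝ) : ℂ) * Complex.exp (-(t * u)) = t ^ (-(w : ℂ)) * (Real.Gamma w : ℂ) := by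
  set f : ℝ → NNReal := fun u => Real.toNNReal (u ^ (w - 1)) with hf
  have hfm : Measurable f := by fun_prop
  set μ : Measure ℝ := (volume.restrict (Set.Ioi (0 : ℝ))).withDensity (fun u => f u) with hμ
  have hfv : ∀ u ∈ Set.Ioi (0 : ℝ), ((f u : NNReal) : ℝ) = u ^ (w - 1) := fun u hu => by
    simp only [hf]; exact Real.coe_toNNReal _ (Real.rpow_nonneg (le_of_lt hu) _)
  have hsub : Set.Iio (0 : ℝ) ⊆ ProbabilityTheory.integrableExpSet id μ := by
    intro s hs
    show Integrable _ μ
    rw [hμ, integrable_withDensity_iff_integrable_smul hfm]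
    have h1 := integrableOn_rpow_mul_exp_neg_mul_rpow (p := 1) (s := w - 1) (b := -s) (by linarith) one_pos (by simpa using hs)
    refine h1.congr_fun (fun u hu => ?_) measurableSet_Ioi
    simp only [NNReal.smul_def, smul_eq_mul, hfv u hu, Real.rpow_one, id]
    ring_nf
  have hsub' : Set.Iio (0 : ℝ) ⊆ interior (ProbabilityTheory.integrableExpSet id μ) := interior_maximal hsub isOpen_Iio
  have hJ : ∀ z : ℂ, ProbabilityTheory.complexMGF id μ z = ∫ u in Set.Ioi (0 : ℝ), ((u ^ (w - 1) : ℝ) : ℂ) * Complex.exp (z * u) := by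
    intro z
    unfold ProbabilityTheory.complexMGF
    rw [hμ, integral_withDensity_eq_integral_smul hfm]
    refine setIntegral_congr_fun measurableSet_Ioi (fun u hu => ?_)
    simp only [NNReal.smul_def, hfv u hu, id, Complex.real_smul]
  set U : Set ℂ := {z | z.re < 0} with hU
  have hUo : IsOpen U := isOpen_lt Complex.continuous_re continuous_const
  have hUc : IsPreconnected U := (convex_halfSpace_re_lt 0).isPreconnected
  have a1 : AnalyticOnNhd ℂ (ProbabilityTheory.complexMGF id μ) U :=
    ProbabilityTheory.analyticOnNhd_complexMGF.mono (fun z hz => hsub' hz)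
  have a2 : AnalyticOnNhd ℂ (fun z : ℂ => (-z) ^ (-(w : ℂ)) * (Real.Gamma w : ℂ)) U := by
    apply DifferentiableOn.analyticOnNhd _ hUo
    intro z hz
    apply DifferentiableAt.differentiableWithinAt
    have : -z ∈ Complex.slitPlane := Or.inl (by simpa [hU] using hz)
    apply DifferentiableAt.mul_const
    exact (differentiableAt_id.neg).cpow (differentiableAt_const _) this
  have key := a1.eqOn_of_preconnected_of_frequently_eq a2 hUc (z₀ := ((-1 : ℝ) : ℂ)) (by simp [hU]) (by
    have hreal : ∀ x : ℝ, x < 0 → ProbabilityTheory.complexMGF id μ x = (-(x : ℂ)) ^ (-(w : ℂ)) * (Real.Gamma w : ℂ) := by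
      intro x hx
      rw [hJ]
      have := Real.integral_rpow_mul_exp_neg_mul_Ioi hw (r := -x) (by linarith)
      have h2 : (∫ u in Set.Ioi (0 : ℝ), ((u ^ (w - 1) : ℝ) : ℂ) * Complex.exp (x * u)) = ((∫ u in Set.Ioi (0 : ℝ), u ^ (w - 1) * Real.exp (-(-x * u)) : ℝ) : ℂ) := by
        rw [← integral_complex_ofReal]
        congr 1; funext u; push_cast; congr 2; ring
      rw [h2, this, one_div, Real.inv_rpow (by linarith), ← Real.rpow_neg (by linarith)]
      push_cast
      rw [Complex.ofReal_cpow (by linarith)]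
      push_cast; rfl
    have ht : Tendsto (fun n : ℕ => (((-1 : ℝ) - 1 / ((n : ℝ) + 1) : ℝ) : ℂ)) atTop (𝓝[≠] ((-1 : ℝ) : ℂ)) := by
      apply tendsto_nhdsWithin_of_tendsto_nhds_of_eventually_within
      · apply (Complex.continuous_ofReal.tendsto _).comp
        have := (tendsto_const_nhds (x := (-1 : ℝ))).sub (tendsto_one_div_add_atTop_nhds_zero_nat (𝕜 := ℝ))
        simpa using this
      · refine Eventually.of_forall (fun n => ?_)
        have : (0 : ℝ) < 1 / ((n : ℝ) + 1) := by positivity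
        simp only [Set.mem_compl_iff, Set.mem_singleton_iff, Complex.ofReal_inj]
        linarith
    refine ht.frequently (Frequently.of_forall (fun n => ?_))
    have : (0 : ℝ) < 1 / ((n : ℝ) + 1) := by positivity
    exact hreal _ (by linarith))
  have := key (x := -t) (by simpa [hU] using ht)
  rw [hJ] at this
  simp only [neg_neg] at this
  rw [← this]
  congr 1; funext u; congr 2; ring

lemma norm_tt (y x : ℝ) : ‖(y : ℂ) + x * Complex.I‖ = Real.sqrt (y ^ 2 + x ^ 2) := by
  rw [Complex.norm_add_mul_I]

lemma tt_ne {y : ℝ} (hy : 0 < y) (x : ℝ) : (y : ℂ) + x * Complex.I ≠ 0 := fun h => by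
  have := congrArg Complex.re h; simp at this; linarith

lemma tt_slit {y : ℝ} (hy : 0 < y) (x : ℝ) : (y : ℂ) + x * Complex.I ∈ Complex.slitPlane := Or.inl (by simpa using hy)

lemma le_norm_tt {y : ℝ} (x : ℝ) : y ≤ ‖(y : ℂ) + x * Complex.I‖ := by
  have := Complex.re_le_norm ((y : ℂ) + x * Complex.I); simpa using this

lemma norm_tt_pow {y : ℝ} (hy : 0 < y) (w x : ℝ) : ‖(y : ℂ) + x * Complex.I‖ ^ (-w) = y ^ (-w) * (1 + ‖y⁻¹ * x‖ ^ 2) ^ (-w / 2) := by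
  rw [norm_tt, Real.sqrt_eq_rpow, ← Real.rpow_mul (by positivity)]
  have : y ^ 2 + x ^ 2 = y ^ 2 * (1 + ‖y⁻¹ * x‖ ^ 2) := by
    rw [Real.norm_eq_abs, sq_abs]; field_simp
  rw [this, Real.mul_rpow (by positivity) (by positivity), ← Real.rpow_natCast y 2, ← Real.rpow_mul hy.le]
  congr 2 <;> push_cast <;> ring

/-- universal constant -/
noncomputable def Bw (w : ℝ) : ℝ := ∫ x : ℝ, (1 + ‖x‖ ^ 2) ^ (-w / 2)

lemma Bw_nonneg (w : ℝ) : 0 ≤ Bw w := integral_nonneg (fun x => by positivity)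

lemma tt_int {y : ℝ} (hy : 0 < y) {w : ℝ} (hw : 1 < w) :
    Integrable (fun x : ℝ => ‖(y : ℂ) + x * Complex.I‖ ^ (-w)) ∧
      ∫ x : ℝ, ‖(y : ℂ) + x * Complex.I‖ ^ (-w) = y ^ (1 - w) * Bw w := by
  have h0 : Integrable (fun x : ℝ => (1 + ‖x‖ ^ 2) ^ (-w / 2)) := integrable_rpow_neg_one_add_norm_sq (by simpa using hw)
  simp only [norm_tt_pow hy]
  constructor
  · exact (h0.comp_mul_left' (inv_ne_zero hy.ne')).const_mul _
  · rw [integral_const_mul, Measure.integral_comp_mul_left (fun x : ℝ => (1 + ‖x‖ ^ 2) ^ (-w / 2))]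
    rw [inv_inv, abs_of_pos hy, smul_eq_mul, ← mul_assoc]
    unfold Bw
    congr 1
    rw [show (1 - w) = -w + 1 by ring, Real.rpow_add hy, Real.rpow_one]

lemma tt_cont {y : ℝ} (hy : 0 < y) (w : ℂ) : Continuous (fun x : ℝ => ((y : ℂ) + x * Complex.I) ^ w) := by
  apply Continuous.cpow (by fun_prop) continuous_const
  intro x; exact tt_slit hy x

open FourierTransform in
lemma inv_laplace {y : ℝ} (hy : 0 < y) {w : ℝ} (hw : 1 < w) {N : ℝ} (hN : 0 < N) :
    ∫ x : ℝ, Complex.exp (N * ((y : ℂ) + x * Complex.I)) * ((y : ℂ) + x * Complex.I) ^ (-(w : ℂ)) =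
      ((2 * Real.pi * (N ^ (w - 1) / Real.Gamma w) : ℝ) : ℂ) := by
  set f : ℝ → ℂ := Set.indicator (Set.Ioi 0) (fun u => ((u ^ (w - 1) : ℝ) : ℂ) * Complex.exp (-(y * u))) with hf
  have hG : Real.Gamma w ≠ 0 := (Real.Gamma_pos_of_pos (by linarith)).ne'
  have hfi : Integrable f := by
    rw [hf, integrable_indicator_iff measurableSet_Ioi]
    have h1 : IntegrableOn (fun u : ℝ => ((u ^ (w - 1) * Real.exp (-y * u ^ (1 : ℝ)) : ℝ) : ℂ)) (Set.Ioi 0) :=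
      Integrable.ofReal (integrableOn_rpow_mul_exp_neg_mul_rpow (p := 1) (s := w - 1) (b := y) (by linarith) one_pos hy)
    refine h1.congr_fun (fun u hu => ?_) measurableSet_Ioi
    simp
  have hF : ∀ ξ : ℝ, 𝓕 f ξ = ((y : ℂ) + ((2 * Real.pi * ξ : ℝ) : ℂ) * Complex.I) ^ (-(w : ℂ)) * (Real.Gamma w : ℂ) := by
    intro ξ
    rw [← gamma_cx (by linarith) (by simpa using hy), Real.fourier_real_eq_integral_exp_smul, ← integral_indicator measurableSet_Ioi]
    congr 1; funext u
    by_cases hu : u ∈ Set.Ioi (0 : ℝ)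
    · simp only [hf, Set.indicator_of_mem hu, smul_eq_mul]
      rw [mul_left_comm, ← Complex.exp_add]
      congr 2; push_cast; ring
    · simp [hf, Set.indicator_of_notMem hu]
  have hcN : ContinuousAt f N := by
    have : f =ᶠ[𝓝 N] (fun u => ((u ^ (w - 1) : ℝ) : ℂ) * Complex.exp (-(y * u))) := by
      filter_upwards [Ioi_mem_nhds hN] with u hu
      simp [hf, Set.indicator_of_mem hu]
    rw [continuousAt_congr this]
    have h1 : ContinuousAt (fun u : ℝ => u ^ (w - 1)) N := Real.continuousAt_rpow_const _ _ (Or.inl hN.ne')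
    have h2 : ContinuousAt (fun u : ℝ => Complex.exp (-(y * u))) N := by fun_prop
    exact (Complex.continuous_ofReal.continuousAt.comp h1).mul h2
  have hbase : Integrable (fun x : ℝ => ((y : ℂ) + x * Complex.I) ^ (-(w : ℂ))) := by
    refine (tt_int hy hw).1.mono' (tt_cont hy _).aestronglyMeasurable (Eventually.of_forall fun x => ?_)
    rw [show (-(w : ℂ)) = ((-w : ℝ) : ℂ) by push_cast; rfl, Complex.norm_cpow_real]
  have hFi : Integrable (𝓕 f) := by
    rw [show 𝓕 f = fun ξ : ℝ => ((y : ℂ) + ((2 * Real.pi * ξ : ℝ) : ℂ) * Complex.I) ^ (-(w : ℂ)) * (Real.Gamma w : ℂ) from funext hF]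
    exact (hbase.comp_mul_left' (R := 2 * Real.pi) (by positivity)).mul_const _
  have key := hfi.fourierInv_fourier_eq hFi hcN
  rw [Real.fourierInv_eq'] at key
  have e1 : (fun v : ℝ => Complex.exp (((2 * Real.pi * inner ℝ v N : ℝ) : ℂ) * Complex.I) • 𝓕 f v) =
      fun v : ℝ => (fun x : ℝ => Complex.exp (N * ((y : ℂ) + x * Complex.I)) * ((y : ℂ) + x * Complex.I) ^ (-(w : ℂ)) * (Real.Gamma w * Complex.exp (-(y * N)))) ((2 * Real.pi) * v) := by
    funext v
    rw [hF]
    simp only [smul_eq_mul, RCLike.inner_apply, conj_trivial]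
    have : Complex.exp (((2 * Real.pi * (N * v) : ℝ) : ℂ) * Complex.I) = Complex.exp (N * ((y : ℂ) + ((2 * Real.pi * v : ℝ) : ℂ) * Complex.I)) * Complex.exp (-(y * N)) := by
      rw [← Complex.exp_add]; congr 1; push_cast; ring
    rw [this]; ring
  rw [e1, Measure.integral_comp_mul_left (fun x : ℝ => Complex.exp (N * ((y : ℂ) + x * Complex.I)) * ((y : ℂ) + x * Complex.I) ^ (-(w : ℂ)) * (Real.Gamma w * Complex.exp (-(y * N)))),
    integral_mul_const, abs_of_pos (by positivity)] at key
  set J := ∫ x : ℝ, Complex.exp (N * ((y : ℂ) + x * Complex.I)) * ((y : ℂ) + x * Complex.I) ^ (-(w : ℂ)) with hJ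
  rw [hf, Set.indicator_of_mem (show N ∈ Set.Ioi (0 : ℝ) from hN), Complex.real_smul] at key
  have hE : Complex.exp (-(y * N)) ≠ 0 := Complex.exp_ne_zero _
  have hpi : (Real.pi : ℂ) ≠ 0 := by exact_mod_cast Real.pi_ne_zero
  have hG' : (Real.Gamma w : ℂ) ≠ 0 := by exact_mod_cast hG
  push_cast at key ⊢
  have k2 := mul_right_cancel₀ hE (a := (2 * (Real.pi : ℂ))⁻¹ * (J * (Real.Gamma w))) (c := ((N ^ (w - 1) : ℝ) : ℂ)) (by
    push_cast; linear_combination key)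
  field_simp at k2 ⊢
  linear_combination k2

end MA

open scoped BigOperators
open Filter MeasureTheory

namespace MA
open Topology Finset

/-- integrand -/
noncomputable def gg (N w : ℝ) (t : ℂ) : ℂ := Complex.exp (N * t + (Real.pi ^ 2 / 4 : ℝ) / t) * t ^ (-(w : ℂ))

lemma norm_cpow_neg (t : ℂ) (w : ℝ) : ‖t ^ (-(w : ℂ))‖ = ‖t‖ ^ (-w) := by
  rw [show (-(w : ℂ)) = ((-w : ℝ) : ℂ) by push_cast; rfl, Complex.norm_cpow_real]

lemma gg_norm (N w y x : ℝ) : ‖gg N w ((y : ℂ) + x * Complex.I)‖ =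
    Real.exp (N * y + Real.pi ^ 2 / 4 * (1 / ((y : ℂ) + x * Complex.I)).re) * ‖(y : ℂ) + x * Complex.I‖ ^ (-w) := by
  unfold gg
  rw [norm_mul, norm_cpow_neg, Complex.norm_exp]
  congr 3
  rw [Complex.add_re, div_eq_mul_one_div, Complex.re_ofReal_mul, Complex.re_ofReal_mul]
  simp

lemma gg_cont {y : ℝ} (hy : 0 < y) (N w : ℝ) : Continuous (fun x : ℝ => gg N w ((y : ℂ) + x * Complex.I)) := by
  unfold gg
  apply Continuous.mul _ (tt_cont hy _)
  apply Complex.continuous_exp.comp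
  apply Continuous.add (by fun_prop)
  exact Continuous.div (by fun_prop) (by fun_prop) (tt_ne hy)

lemma re_inv_le {y : ℝ} (hy : 0 < y) (x : ℝ) : (1 / ((y : ℂ) + x * Complex.I)).re ≤ 1 / y := by
  refine (Complex.re_le_norm _).trans ?_
  rw [norm_div, norm_one]
  exact one_div_le_one_div_of_le hy (le_norm_tt x)

lemma gg_int {y : ℝ} (hy : 0 < y) (N : ℝ) {w : ℝ} (hw : 1 < w) :
    Integrable (fun x : ℝ => gg N w ((y : ℂ) + x * Complex.I)) := by
  refine ((tt_int hy hw).1.const_mul (Real.exp (N * y + Real.pi ^ 2 / 4 * (1 / y)))).mono' (gg_cont hy N w).aestronglyMeasurable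
    (Eventually.of_forall fun x => ?_)
  rw [gg_norm]
  have := re_inv_le hy x
  gcongr

lemma gg_integral {y : ℝ} (hy : 0 < y) {N : ℝ} (hN : 0 < N) {s : ℝ} (hs : 0 < s) :
    ∫ x : ℝ, gg N (s + 1) ((y : ℂ) + x * Complex.I) =
      ((2 * Real.pi * (N ^ (s / 2) * (Real.pi / 2) ^ (-s) * besselI s (Real.pi * Real.sqrt N)) : ℝ) : ℂ) := by
  set a : ℝ := Real.pi ^ 2 / 4 with ha
  have hapos : 0 < a := by positivity
  clear_value a
  set F : ℕ → ℝ → ℂ := fun k x => ((a ^ k / k.factorial : ℝ) : ℂ) * (Complex.exp (N * ((y : ℂ) + x * Complex.I)) * ((y : ℂ) + x * Complex.I) ^ (-((s + 1 + k : ℝ) : ℂ))) with hF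
  have hnorm : ∀ k x, ‖F k x‖ ≤ (a / y) ^ k / k.factorial * (Real.exp (N * y) * ‖(y : ℂ) + x * Complex.I‖ ^ (-(s + 1))) := by
    intro k x
    have hp : 0 < ‖(y : ℂ) + x * Complex.I‖ := norm_pos_iff.2 (tt_ne hy x)
    simp only [hF]
    rw [norm_mul, norm_mul, norm_cpow_neg, Complex.norm_exp, Complex.norm_real, Real.norm_of_nonneg (by positivity)]
    rw [show -(s + 1 + (k : ℝ)) = -(s + 1) - k by ring, Real.rpow_sub hp, Real.rpow_natCast, div_pow]
    have e : (↑N * ((y : ℂ) + x * Complex.I)).re = N * y := by rw [Complex.re_ofReal_mul]; simp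
    rw [e]
    have := le_norm_tt (y := y) x
    calc _ ≤ a ^ k / k.factorial * (Real.exp (N * y) * (‖(y : ℂ) + x * Complex.I‖ ^ (-(s + 1)) / y ^ k)) := by gcongr
      _ = _ := by ring
  have hFc : ∀ k, Continuous (F k) := by
    intro k
    simp only [hF]
    exact continuous_const.mul ((by fun_prop : Continuous fun x : ℝ => Complex.exp (N * ((y : ℂ) + x * Complex.I))).mul (tt_cont hy _))
  have hb := (tt_int hy (w := s + 1) (by linarith)).1
  have hFi : ∀ k, Integrable (F k) := fun k =>
    ((hb.const_mul _).const_mul _).mono' (hFc k).aestronglyMeasurable (Eventually.of_forall (hnorm k))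
  have hsum : Summable fun k => ∫ x, ‖F k x‖ := by
    refine Summable.of_nonneg_of_le (fun k => integral_nonneg fun _ => norm_nonneg _)
      (fun k => integral_mono (hFi k).norm ((hb.const_mul _).const_mul _) (hnorm k)) ?_
    simp only [integral_const_mul]
    exact (Real.summable_pow_div_factorial (a / y)).mul_right _
  have key := hasSum_integral_of_summable_integral_norm hFi hsum
  have e1 : ∀ x : ℝ, ∑' k, F k x = gg N (s + 1) ((y : ℂ) + x * Complex.I) := by
    intro x
    have ht := tt_ne hy x
    set t := (y : ℂ) + x * Complex.I with htd
    have h1 : HasSum (fun k : ℕ => (a / t) ^ k / (k.factorial : ℂ)) (Complex.exp (a / t)) := by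
      rw [Complex.exp_eq_exp_ℂ]; exact NormedSpace.expSeries_div_hasSum_exp (a / t)
    have h2 := h1.mul_left (Complex.exp (N * t) * t ^ (-((s + 1 : ℝ) : ℂ)))
    unfold gg
    rw [Complex.exp_add, ← ha, mul_right_comm, ← h2.tsum_eq]
    congr 1; funext k
    simp only [hF]
    rw [← htd]
    have : t ^ (-((s + 1 + k : ℝ) : ℂ)) = t ^ (-((s + 1 : ℝ) : ℂ)) / t ^ k := by
      rw [show (-((s + 1 + k : ℝ) : ℂ)) = -((s + 1 : ℝ) : ℂ) - (k : ℂ) by push_cast; ring, Complex.cpow_sub _ _ ht, Complex.cpow_natCast]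
    rw [this, div_pow]; push_cast
    ring
  simp only [e1] at key
  have e2 : ∀ k : ℕ, ∫ x, F k x = ((2 * Real.pi * (N ^ (s / 2) * (Real.pi / 2) ^ (-s)) * ((Real.pi * Real.sqrt N / 2) ^ (2 * (k : ℝ) + s) / ((k.factorial : ℝ) * Real.Gamma ((k : ℝ) + s + 1))) : ℝ) : ℂ) := by
    intro k
    simp only [hF]
    rw [integral_const_mul, inv_laplace hy (by have : (0 : ℝ) ≤ k := by positivity
                                               linarith) hN, ← Complex.ofReal_mul]
    congr 1
    have hp2 : 0 < Real.pi / 2 := by positivity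
    rw [show s + 1 + (k : ℝ) = k + s + 1 by ring, show Real.pi * Real.sqrt N / 2 = (Real.pi / 2) * Real.sqrt N by ring,
      Real.mul_rpow hp2.le (Real.sqrt_nonneg _), Real.sqrt_eq_rpow, ← Real.rpow_mul hN.le]
    have e3 : N ^ ((k : ℝ) + s + 1 - 1) = N ^ (s / 2) * N ^ (1 / 2 * (2 * (k : ℝ) + s)) := by
      rw [← Real.rpow_add hN]; congr 1; ring
    have e4 : a ^ k = (Real.pi / 2) ^ (-s) * (Real.pi / 2) ^ (2 * (k : ℝ) + s) := by
      rw [← Real.rpow_add hp2, show -s + (2 * (k : ℝ) + s) = ((2 * k : ℕ) : ℝ) by push_cast; ring, Real.rpow_natCast, pow_mul]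
      congr 1; rw [ha]; ring
    rw [e3, e4]
    have hG : Real.Gamma ((k : ℝ) + s + 1) ≠ 0 := (Real.Gamma_pos_of_pos (by positivity)).ne'
    field_simp
  simp only [e2] at key
  rw [← key.tsum_eq, ← Complex.ofReal_tsum, tsum_mul_left]
  unfold besselI
  congr 1; ring

end MA

open scoped BigOperators
open Filter MeasureTheory

namespace MA
open Topology Finset

lemma exp_orth (y : ℝ) (k : ℤ) (hk : k ≠ 0) :
    ∫ x in (-Real.pi)..Real.pi, Complex.exp (k * ((y : ℂ) + x * Complex.I)) = 0 := by
  have hc : (k : ℂ) * Complex.I ≠ 0 := mul_ne_zero (by exact_mod_cast hk) Complex.I_ne_zero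
  have e : ∀ x : ℝ, Complex.exp (k * ((y : ℂ) + x * Complex.I)) = Complex.exp (k * y) * Complex.exp ((k * Complex.I) * x) := by
    intro x; rw [← Complex.exp_add]; congr 1; ring
  simp only [e]
  rw [intervalIntegral.integral_const_mul, integral_exp_mul_complex hc]
  have : Complex.exp (k * Complex.I * (Real.pi : ℝ)) = Complex.exp (k * Complex.I * ((-Real.pi : ℝ) : ℂ)) := by
    rw [Complex.exp_eq_exp_iff_exists_int]
    exact ⟨k, by push_cast; ring⟩
  rw [this]; simp

/-- integrand on the circle -/
noncomputable def HH (r N : ℕ) (y x : ℝ) : ℂ :=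
  Pb (Complex.exp (-((y : ℂ) + x * Complex.I))) * S r (Complex.exp (-((y : ℂ) + x * Complex.I))) * Complex.exp (N * ((y : ℂ) + x * Complex.I))

lemma HH_main (r : ℕ) (hr : 3 ≤ r) (N : ℕ) {y : ℝ} (hy : 0 < y) :
    Continuous (HH r N y) ∧ ∫ x in Set.Ioc (-Real.pi) Real.pi, HH r N y x = ((2 * Real.pi * mubar r N : ℝ) : ℂ) := by
  have hpi := Real.pi_pos
  have hnq : ∀ x : ℝ, ‖Complex.exp (-((y : ℂ) + x * Complex.I))‖ = Real.exp (-y) := by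
    intro x; rw [Complex.norm_exp]; simp
  have hq : ∀ x : ℝ, ‖Complex.exp (-((y : ℂ) + x * Complex.I))‖ < 1 := by
    intro x; rw [hnq, Real.exp_lt_one_iff]; linarith
  set F : ℕ → ℝ → ℂ := fun n x => ((mubar r n : ℝ) : ℂ) * Complex.exp (((N : ℤ) - (n : ℤ) : ℤ) * ((y : ℂ) + x * Complex.I)) with hF
  have hFs : ∀ x, HasSum (fun n => F n x) (HH r N y x) := by
    intro x
    have := (mubar_gf (hq x) r hr).mul_right (Complex.exp (N * ((y : ℂ) + x * Complex.I)))
    refine (HS_congr (fun n => ?_)).1 this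
    simp only [hF]
    rw [← Complex.exp_nat_mul, mul_assoc, ← Complex.exp_add]
    congr 2; push_cast; ring
  have hFn : ∀ n x, ‖F n x‖ = |mubar r n| * Real.exp (-y) ^ n * Real.exp (N * y) := by
    intro n x
    simp only [hF]
    rw [norm_mul, Complex.norm_real, Real.norm_eq_abs, Complex.norm_exp, ← Real.exp_nat_mul, mul_assoc, ← Real.exp_add]
    congr 2
    simp
    ring
  have hsu : Summable (fun n => |mubar r n| * Real.exp (-y) ^ n * Real.exp (N * y)) := by
    have := (mubar_gf (hq 0) r hr).summable.norm.mul_right (Real.exp (N * y))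
    refine this.congr (fun n => ?_)
    rw [norm_mul, norm_pow, hnq, Complex.norm_real, Real.norm_eq_abs]
  have hFc : ∀ n, Continuous (F n) := fun n => by simp only [hF]; fun_prop
  have hHe : HH r N y = fun x => ∑' n, F n x := funext fun x => (hFs x).tsum_eq.symm
  refine ⟨?_, ?_⟩
  · rw [hHe]
    exact continuous_tsum hFc hsu (fun n x => (hFn n x).le)
  · have hFi : ∀ n, Integrable (F n) (volume.restrict (Set.Ioc (-Real.pi) Real.pi)) := fun n =>
      ((hFc n).integrableOn_Icc).mono_set Set.Ioc_subset_Icc_self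
    have key := hasSum_integral_of_summable_integral_norm hFi (by
      simp only [hFn]
      simp only [integral_const]
      exact hsu.const_smul _)
    rw [← hHe] at key
    rw [← key.tsum_eq, tsum_eq_single N]
    · simp only [hF]
      simp
      rw [max_eq_left (by linarith)]
      left; push_cast; ring
    · intro n hn
      rw [← intervalIntegral.integral_of_le (by linarith)]
      simp only [hF]
      rw [intervalIntegral.integral_const_mul, exp_orth y _ (by omega), mul_zero]

lemma pm_eq {t : ℂ} (ht : 0 < t.re) : pm t = (((1 / 2) * Real.pi ^ (-(1 / 2) : ℝ) : ℝ) : ℂ) * (Complex.exp ((Real.pi ^ 2 / 4 : ℝ) / t) * t ^ (1 / 2 : ℂ)) := by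
  have ht0 : t ≠ 0 := by rintro rfl; simp at ht
  have hpi := Real.pi_pos
  unfold pm
  have e1 : (t / Real.pi) ^ (1 / 2 : ℂ) = ((Real.pi ^ (-(1 / 2) : ℝ) : ℝ) : ℂ) * t ^ (1 / 2 : ℂ) := by
    have h1 : t / Real.pi = ((Real.pi⁻¹ : ℝ) : ℂ) * t := by push_cast; rw [div_eq_mul_inv, mul_comm]
    have h2 : ((Real.pi⁻¹ : ℝ) : ℂ) ≠ 0 := by exact_mod_cast (inv_ne_zero hpi.ne')
    rw [h1, Complex.cpow_def_of_ne_zero (mul_ne_zero h2 ht0), Complex.cpow_def_of_ne_zero ht0, Complex.log_ofReal_mul (by positivity) ht0,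
      add_mul, Complex.exp_add, Real.rpow_def_of_pos hpi, Real.log_inv]
    congr 1
    push_cast; congr 1; ring
  have e2 : (Real.pi ^ 2 / (4 * t) : ℂ) = ((Real.pi ^ 2 / 4 : ℝ) : ℂ) / t := by push_cast; field_simp
  rw [e1, e2]; push_cast; ring

lemma exp_small (κ : ℝ) (hκ : 0 < κ) (p : ℕ) : ∃ M : ℝ, 0 < M ∧ ∀ y : ℝ, 0 < y → Real.exp (-κ / y) ≤ M * y ^ p := by
  refine ⟨p.factorial / κ ^ p, by positivity, fun y hy => ?_⟩
  have h := Real.pow_div_factorial_le_exp (κ / y) (by positivity) p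
  rw [neg_div, Real.exp_neg, inv_le_comm₀ (Real.exp_pos _) (by positivity)]
  refine le_trans (le_of_eq ?_) h
  rw [div_pow]; field_simp

end MA

open scoped BigOperators
open Filter MeasureTheory

namespace MA
open Topology Finset

/-- the main term -/
noncomputable def GG (c d : ℂ) (r N : ℕ) (y x : ℝ) : ℂ :=
  c * gg N (r - 1 / 2) ((y : ℂ) + x * Complex.I) + d * gg N (r - 3 / 2) ((y : ℂ) + x * Complex.I)

lemma gg_re (r N : ℕ) (j : ℝ) {t : ℂ} (ht : t ≠ 0) (e : ℕ) (hj : 1 / 2 + (e : ℝ) = j) :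
    gg N (r - j) t * t ^ r = Complex.exp (N * t) * (Complex.exp ((Real.pi ^ 2 / 4 : ℝ) / t) * t ^ (1 / 2 : ℂ)) * t ^ e := by
  unfold gg
  rw [Complex.exp_add]
  have : t ^ (-(((r : ℝ) - j : ℝ) : ℂ)) * t ^ r = t ^ (1 / 2 : ℂ) * t ^ e := by
    rw [← Complex.cpow_natCast t r, ← Complex.cpow_natCast t e, ← Complex.cpow_add _ _ ht, ← Complex.cpow_add _ _ ht, ← hj]
    congr 1; push_cast; ring
  rw [mul_assoc, this]
  push_cast; ring

lemma inner_bound (r : ℕ) (hr : 3 ≤ r) (η d : ℂ) (K : ℝ) (hK : 0 < K)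
    (hS : ∀ t : ℂ, Cone t → ‖t ^ r * S r (Complex.exp (-t)) - (η + d * t)‖ ≤ K * ‖t‖ ^ 2) :
    ∃ C : ℝ, 0 < C ∧ ∀ (N : ℕ) (y x : ℝ), 0 < y → y ≤ 1 / 2 → |x| ≤ y / 8 →
      ‖HH r N y x - GG (((1 / 2) * Real.pi ^ (-(1 / 2) : ℝ) : ℝ) * η) (((1 / 2) * Real.pi ^ (-(1 / 2) : ℝ) : ℝ) * d) r N y x‖ ≤
        C * (y ^ (5 / 2 - (r : ℝ)) * Real.exp (N * y + Real.pi ^ 2 / 4 * (1 / y))) := by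
  refine ⟨4 * (‖η‖ + ‖d‖ + K) + K, by positivity, fun N y x hy hy2 hx => ?_⟩
  have hc : Cone ((y : ℂ) + x * Complex.I) := ⟨by simpa using hy, by simpa using hx⟩
  have ht0 := tt_ne hy x
  have hre := re_inv_le hy x
  have hny := le_norm_tt (y := y) x
  have hn1 : ‖(y : ℂ) + x * Complex.I‖ ≤ 1 := by
    refine (Complex.norm_le_abs_re_add_abs_im _).trans ?_
    simp [abs_of_pos hy]; linarith
  unfold HH GG
  have htre : ((y : ℂ) + x * Complex.I).re = y := by simp
  have htim : ((y : ℂ) + x * Complex.I).im = x := by simp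
  set t := (y : ℂ) + x * Complex.I with ht
  have hSt := hS t hc
  have hP := Pb_cone (t := t) (by rw [htre]; exact hy) (by rw [htre]; exact hy2) (by rw [htre, htim]; linarith)
  have hpm := pm_norm_le (t := t)
  have hpe := pm_eq (t := t) (by rw [htre]; exact hy)
  clear_value t
  set c₀ : ℂ := (((1 / 2) * Real.pi ^ (-(1 / 2) : ℝ) : ℝ) : ℂ) with hc0
  clear_value c₀
  have e : t ^ r * (Pb (Complex.exp (-t)) * S r (Complex.exp (-t)) * Complex.exp (N * t) - (c₀ * η * gg N (r - 1 / 2) t + c₀ * d * gg N (r - 3 / 2) t))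
      = Complex.exp (N * t) * ((Pb (Complex.exp (-t)) - pm t) * (t ^ r * S r (Complex.exp (-t))) + pm t * (t ^ r * S r (Complex.exp (-t)) - (η + d * t))) := by
    have g1 := gg_re r N (1 / 2) ht0 0 (by norm_num)
    have g2 := gg_re r N (3 / 2) ht0 1 (by norm_num)
    rw [hpe]
    linear_combination (-c₀ * η) * g1 - (c₀ * d) * g2
  have hp : 0 < ‖t‖ := norm_pos_iff.2 ht0
  have b1 : ‖t ^ r * S r (Complex.exp (-t))‖ ≤ ‖η‖ + ‖d‖ + K := by
    have h1 := norm_sub_norm_le (t ^ r * S r (Complex.exp (-t))) (η + d * t)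
    have h2 := norm_add_le η (d * t)
    rw [norm_mul] at h2
    have h3 : ‖d‖ * ‖t‖ ≤ ‖d‖ := mul_le_of_le_one_right (norm_nonneg _) hn1
    have h4 : K * ‖t‖ ^ 2 ≤ K := mul_le_of_le_one_right hK.le (pow_le_one₀ hp.le hn1)
    linarith
  have b2 : ‖pm t‖ ≤ ‖t‖ ^ (1 / 2 : ℝ) * Real.exp (Real.pi ^ 2 / 4 * (1 / y)) := hpm.trans (by gcongr)
  have b3 : ‖(Pb (Complex.exp (-t)) - pm t) * (t ^ r * S r (Complex.exp (-t))) + pm t * (t ^ r * S r (Complex.exp (-t)) - (η + d * t))‖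
      ≤ (4 * (‖η‖ + ‖d‖ + K) + K) * (‖t‖ ^ 2 * ‖pm t‖) := by
    refine (norm_add_le _ _).trans ?_
    rw [norm_mul, norm_mul (pm t)]
    calc _ ≤ (4 * ‖t‖ ^ 2 * ‖pm t‖) * (‖η‖ + ‖d‖ + K) + ‖pm t‖ * (K * ‖t‖ ^ 2) := by gcongr
      _ = _ := by ring
  have b4 := congrArg norm e
  rw [norm_mul, norm_mul, norm_pow, Complex.norm_exp] at b4
  have e5 : (↑N * t : ℂ).re = N * y := by
    rw [← Complex.ofReal_natCast, Complex.re_ofReal_mul, htre]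
  rw [e5] at b4
  have hpr : 0 < ‖t‖ ^ r := by positivity
  refine le_of_mul_le_mul_left ?_ hpr
  rw [b4]
  have e6 : ‖t‖ ^ r * ‖t‖ ^ (5 / 2 - (r : ℝ)) = ‖t‖ ^ 2 * ‖t‖ ^ (1 / 2 : ℝ) := by
    rw [← Real.rpow_natCast, ← Real.rpow_natCast, ← Real.rpow_add hp, ← Real.rpow_add hp]
    congr 1; push_cast; ring
  have hr' : (3 : ℝ) ≤ r := by exact_mod_cast hr
  have e7 : ‖t‖ ^ (5 / 2 - (r : ℝ)) ≤ y ^ (5 / 2 - (r : ℝ)) :=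
    Real.rpow_le_rpow_of_nonpos hy hny (by linarith)
  calc _ ≤ Real.exp (N * y) * ((4 * (‖η‖ + ‖d‖ + K) + K) * (‖t‖ ^ 2 * (‖t‖ ^ (1 / 2 : ℝ) * Real.exp (Real.pi ^ 2 / 4 * (1 / y))))) := by
        gcongr
        exact b3.trans (by gcongr)
    _ = (4 * (‖η‖ + ‖d‖ + K) + K) * (‖t‖ ^ 2 * ‖t‖ ^ (1 / 2 : ℝ)) * (Real.exp (N * y) * Real.exp (Real.pi ^ 2 / 4 * (1 / y))) := by ring
    _ = ‖t‖ ^ r * ((4 * (‖η‖ + ‖d‖ + K) + K) * (‖t‖ ^ (5 / 2 - (r : ℝ)) * Real.exp (N * y + Real.pi ^ 2 / 4 * (1 / y)))) := by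
        rw [← e6, Real.exp_add]; ring
    _ ≤ _ := by gcongr

lemma re_inv_outer {y : ℝ} (hy : 0 < y) {x : ℝ} (hx : y / 8 ≤ |x|) :
    (1 / ((y : ℂ) + x * Complex.I)).re ≤ 64 / 65 * (1 / y) := by
  rw [one_div, Complex.inv_re, Complex.normSq_apply]
  simp only [Complex.add_re, Complex.ofReal_re, Complex.mul_re, Complex.I_re, mul_zero, Complex.ofReal_im, Complex.I_im, mul_one, sub_self, add_zero, Complex.add_im, Complex.mul_im, zero_add]
  have : (y / 8) ^ 2 ≤ x ^ 2 := by rw [← sq_abs x]; gcongr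
  rw [show 64 / 65 * (1 / y) = 64 / (65 * y) by field_simp, div_le_div_iff₀ (by nlinarith [mul_self_nonneg x, mul_pos hy hy]) (by positivity)]
  nlinarith

lemma GG_outer (c d : ℂ) (r N : ℕ) {y x : ℝ} (hy : 0 < y) (hx : y / 8 ≤ |x|) :
    ‖GG c d r N y x‖ ≤ Real.exp (N * y + Real.pi ^ 2 / 4 * (64 / 65 * (1 / y))) *
      (‖c‖ * ‖(y : ℂ) + x * Complex.I‖ ^ (-((r : ℝ) - 1 / 2)) + ‖d‖ * ‖(y : ℂ) + x * Complex.I‖ ^ (-((r : ℝ) - 3 / 2))) := by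
  unfold GG
  refine (norm_add_le _ _).trans ?_
  rw [norm_mul, norm_mul, gg_norm, gg_norm]
  have := re_inv_outer hy hx
  calc _ ≤ ‖c‖ * (Real.exp (N * y + Real.pi ^ 2 / 4 * (64 / 65 * (1 / y))) * ‖(y : ℂ) + x * Complex.I‖ ^ (-((r : ℝ) - 1 / 2)))
      + ‖d‖ * (Real.exp (N * y + Real.pi ^ 2 / 4 * (64 / 65 * (1 / y))) * ‖(y : ℂ) + x * Complex.I‖ ^ (-((r : ℝ) - 3 / 2))) := by gcongr
    _ = _ := by ring

end MA

open scoped BigOperators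
open Filter MeasureTheory

namespace MA
open Topology Finset

lemma core (r : ℕ) (hr : 3 ≤ r) : ∃ d : ℂ, ∃ C : ℝ, 0 < C ∧ ∀ (N : ℕ) (y : ℝ), 0 < N → 0 < y → y ≤ 1 / 2 →
    ‖((2 * Real.pi * mubar r N : ℝ) : ℂ) - ((((1 / 2) * Real.pi ^ (-(1 / 2) : ℝ) : ℝ) : ℂ) * (((riemannZeta r).re * (1 - 2 ^ (1 - (r : ℝ))) : ℝ) : ℂ) *
        (∫ x : ℝ, gg N (r - 1 / 2) ((y : ℂ) + x * Complex.I)) + d * ∫ x : ℝ, gg N (r - 3 / 2) ((y : ℂ) + x * Complex.I))‖ ≤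
      C * y ^ (7 / 2 - (r : ℝ)) * Real.exp (N * y + Real.pi ^ 2 / 4 * (1 / y)) := by
  have hr' : (3 : ℝ) ≤ r := by exact_mod_cast hr
  have hpi := Real.pi_gt_three
  obtain ⟨d, K, hK, hS⟩ := S_cone r hr
  rw [eta_eq r hr] at hS
  set η : ℂ := (((riemannZeta r).re * (1 - 2 ^ (1 - (r : ℝ))) : ℝ) : ℂ) with hη
  clear_value η
  obtain ⟨C1, hC1, H1⟩ := inner_bound r hr η d K hK hS
  set c₀ : ℂ := (((1 / 2) * Real.pi ^ (-(1 / 2) : ℝ) : ℝ) : ℂ) with hc0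
  clear_value c₀
  obtain ⟨κ, hκ, H2⟩ := Pb_outer
  obtain ⟨M1, hM1, E1⟩ := exp_small κ hκ 5
  obtain ⟨M2, hM2, E2⟩ := exp_small (Real.pi ^ 2 / 260) (by positivity) 2
  set c := c₀ * η with hc
  set d' := c₀ * d with hd'
  have B1n := Bw_nonneg ((r : ℝ) - 1 / 2)
  have B2n := Bw_nonneg ((r : ℝ) - 3 / 2)
  refine ⟨d', C1 / 4 + 2 * Real.pi * (2 * 2 ^ (r + 1) * M1) + M2 * (‖c‖ * Bw ((r : ℝ) - 1 / 2) + ‖d'‖ * Bw ((r : ℝ) - 3 / 2)), by positivity, ?_⟩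
  intro N y hN hy hy2
  obtain ⟨hHc, hHi⟩ := HH_main r hr N hy
  have g1 := gg_int hy (N : ℝ) (w := (r : ℝ) - 1 / 2) (by linarith)
  have g2 := gg_int hy (N : ℝ) (w := (r : ℝ) - 3 / 2) (by linarith)
  have t1 := tt_int hy (w := (r : ℝ) - 1 / 2) (by linarith)
  have t2 := tt_int hy (w := (r : ℝ) - 3 / 2) (by linarith)
  have hGi : Integrable (GG c d' r N y) := (g1.const_mul c).add (g2.const_mul d')
  have eG : c * (∫ x : ℝ, gg N (r - 1 / 2) ((y : ℂ) + x * Complex.I)) + d' * ∫ x : ℝ, gg N (r - 3 / 2) ((y : ℂ) + x * Complex.I) = ∫ x, GG c d' r N y x := by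
    rw [← integral_const_mul, ← integral_const_mul, ← integral_add (g1.const_mul c) (g2.const_mul d')]
    rfl
  set I0 := Set.Ioc (-Real.pi) Real.pi with hI0
  have hHI : Integrable (I0.indicator (HH r N y)) := by
    rw [integrable_indicator_iff measurableSet_Ioc]
    exact (hHc.integrableOn_Icc).mono_set Set.Ioc_subset_Icc_self
  rw [eG, ← hHi, ← integral_indicator measurableSet_Ioc, ← integral_sub hHI hGi]
  set Ex := Real.exp (N * y + Real.pi ^ 2 / 4 * (1 / y)) with hEx
  set b1 : ℝ := C1 * (y ^ (5 / 2 - (r : ℝ)) * Ex) with hb1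
  set b2 : ℝ := 2 * Real.exp ((Real.pi ^ 2 / 4 - κ) / y) * (2 / y) ^ (r + 1) * Real.exp (N * y) with hb2
  set b3 : ℝ := Real.exp (N * y + Real.pi ^ 2 / 4 * (64 / 65 * (1 / y))) with hb3
  set A := Set.Icc (-(y / 8)) (y / 8) with hA
  set bd : ℝ → ℝ := fun x => (A.indicator (fun _ => b1) x + I0.indicator (fun _ => b2) x) +
    b3 * (‖c‖ * ‖(y : ℂ) + x * Complex.I‖ ^ (-((r : ℝ) - 1 / 2)) + ‖d'‖ * ‖(y : ℂ) + x * Complex.I‖ ^ (-((r : ℝ) - 3 / 2))) with hbd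
  have iA : Integrable (A.indicator (fun _ : ℝ => b1)) := by
    rw [integrable_indicator_iff measurableSet_Icc]
    exact integrableOn_const (by simp [hA])
  have iI : Integrable (I0.indicator (fun _ : ℝ => b2)) := by
    rw [integrable_indicator_iff measurableSet_Ioc]
    exact integrableOn_const (by simp [hI0])
  have iG2 : Integrable (fun x : ℝ => (‖c‖ * ‖(y : ℂ) + x * Complex.I‖ ^ (-((r : ℝ) - 1 / 2)) + ‖d'‖ * ‖(y : ℂ) + x * Complex.I‖ ^ (-((r : ℝ) - 3 / 2)))) :=
    (t1.1.const_mul ‖c‖).add (t2.1.const_mul ‖d'‖)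
  have iG : Integrable (fun x : ℝ => b3 * (‖c‖ * ‖(y : ℂ) + x * Complex.I‖ ^ (-((r : ℝ) - 1 / 2)) + ‖d'‖ * ‖(y : ℂ) + x * Complex.I‖ ^ (-((r : ℝ) - 3 / 2)))) := iG2.const_mul b3
  have iAI : Integrable (fun x : ℝ => A.indicator (fun _ => b1) x + I0.indicator (fun _ => b2) x) := iA.add iI
  have ib : Integrable bd := iAI.add iG
  have hb1n : 0 ≤ b1 := by positivity
  have hb2n : 0 ≤ b2 := by positivity
  have hpt : ∀ x, ‖I0.indicator (HH r N y) x - GG c d' r N y x‖ ≤ bd x := by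
    intro x
    have p2 : 0 ≤ I0.indicator (fun _ : ℝ => b2) x := Set.indicator_nonneg (fun _ _ => hb2n) x
    have p1 : 0 ≤ A.indicator (fun _ : ℝ => b1) x := Set.indicator_nonneg (fun _ _ => hb1n) x
    have p3 : 0 ≤ b3 * (‖c‖ * ‖(y : ℂ) + x * Complex.I‖ ^ (-((r : ℝ) - 1 / 2)) + ‖d'‖ * ‖(y : ℂ) + x * Complex.I‖ ^ (-((r : ℝ) - 3 / 2))) := by positivity
    by_cases hx : |x| ≤ y / 8
    · have hx' := abs_le.1 hx
      have hxI : x ∈ I0 := ⟨by linarith [hx'.1], by linarith [hx'.2]⟩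
      have hxA : x ∈ A := hx'
      rw [Set.indicator_of_mem hxI]
      have := H1 N y x hy hy2 hx
      have e : A.indicator (fun _ : ℝ => b1) x = b1 := Set.indicator_of_mem hxA _
      simp only [hbd]
      linarith
    · have hx2 : y / 8 ≤ |x| := (not_le.1 hx).le
      refine (norm_sub_le _ _).trans ?_
      have hg := GG_outer c d' r N hy hx2
      have hh : ‖I0.indicator (HH r N y) x‖ ≤ I0.indicator (fun _ : ℝ => b2) x := by
        by_cases hxI : x ∈ I0
        · rw [Set.indicator_of_mem hxI, Set.indicator_of_mem hxI]
          have hxp : |x| ≤ Real.pi := abs_le.2 ⟨hxI.1.le, hxI.2⟩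
          unfold HH
          rw [norm_mul, norm_mul]
          have e5 : ‖Complex.exp (N * ((y : ℂ) + x * Complex.I))‖ = Real.exp (N * y) := by
            rw [Complex.norm_exp, ← Complex.ofReal_natCast, Complex.re_ofReal_mul]; simp
          rw [e5]
          have q1 := H2 y x hy hy2 hx2 hxp
          have q2 := S_global (x := x) hy hy2 r
          rw [hb2]
          gcongr
        · rw [Set.indicator_of_notMem hxI, Set.indicator_of_notMem hxI, norm_zero]
      simp only [hbd]
      linarith
  refine (norm_integral_le_of_norm_le ib (Eventually.of_forall hpt)).trans ?_
  have eI : ∫ x, bd x = (y / 4 * b1 + 2 * Real.pi * b2) + b3 * (‖c‖ * (y ^ (1 - ((r : ℝ) - 1 / 2)) * Bw ((r : ℝ) - 1 / 2)) + ‖d'‖ * (y ^ (1 - ((r : ℝ) - 3 / 2)) * Bw ((r : ℝ) - 3 / 2))) := by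
    simp only [hbd]
    rw [integral_add iAI iG, integral_add iA iI, integral_const_mul, integral_add (t1.1.const_mul ‖c‖) (t2.1.const_mul ‖d'‖),
      integral_const_mul, integral_const_mul, t1.2, t2.2, integral_indicator measurableSet_Icc, integral_indicator measurableSet_Ioc,
      setIntegral_const, setIntegral_const]
    congr 2
    · simp only [hA, smul_eq_mul, Real.volume_real_Icc]
      rw [max_eq_left (by linarith)]; ring
    · simp only [hI0, smul_eq_mul, Real.volume_real_Ioc]
      rw [max_eq_left (by linarith)]; ring
  rw [eI]
  have hy1 : y ≤ 1 := by linarith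
  have f1 : y / 4 * b1 = C1 / 4 * (y ^ (7 / 2 - (r : ℝ)) * Ex) := by
    rw [hb1, show (7 / 2 - (r : ℝ)) = (5 / 2 - r) + 1 by ring, Real.rpow_add_one hy.ne']; ring
  have f2 : b2 ≤ 2 * 2 ^ (r + 1) * M1 * (y ^ (7 / 2 - (r : ℝ)) * Ex) := by
    have : Real.exp ((Real.pi ^ 2 / 4 - κ) / y) * Real.exp (N * y) = Real.exp (-κ / y) * Ex := by
      rw [hEx, ← Real.exp_add, ← Real.exp_add]; congr 1; ring
    have h3 : y ^ 5 * (1 / y) ^ (r + 1) ≤ y ^ (7 / 2 - (r : ℝ)) := by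
      have : y ^ 5 * (1 / y) ^ (r + 1) = y ^ (4 - (r : ℝ)) := by
        rw [show (4 - (r : ℝ)) = ((5 : ℕ) : ℝ) - ((r + 1 : ℕ) : ℝ) by push_cast; ring, Real.rpow_sub hy, Real.rpow_natCast, Real.rpow_natCast,
          one_div, inv_pow, div_eq_mul_inv]
      rw [this]
      exact Real.rpow_le_rpow_of_exponent_ge hy hy1 (by linarith)
    calc b2 = 2 * (2 / y) ^ (r + 1) * (Real.exp (-κ / y) * Ex) := by rw [hb2, ← this]; ring
      _ ≤ 2 * (2 / y) ^ (r + 1) * ((M1 * y ^ 5) * Ex) := by gcongr; exact E1 y hy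
      _ = 2 * 2 ^ (r + 1) * M1 * ((y ^ 5 * (1 / y) ^ (r + 1)) * Ex) := by
        rw [show 2 / y = 2 * (1 / y) by ring, mul_pow]; ring
      _ ≤ _ := by gcongr
  have f3 : b3 ≤ M2 * y ^ 2 * Ex := by
    have : b3 = Real.exp (-(Real.pi ^ 2 / 260) / y) * Ex := by
      rw [hb3, hEx, ← Real.exp_add]; congr 1; field_simp; ring
    rw [this]; gcongr; exact E2 y hy
  have f4 : y ^ 2 * y ^ (1 - ((r : ℝ) - 1 / 2)) = y ^ (7 / 2 - (r : ℝ)) := by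
    rw [← Real.rpow_natCast, ← Real.rpow_add hy]; congr 1; push_cast; ring
  have f5 : y ^ 2 * y ^ (1 - ((r : ℝ) - 3 / 2)) ≤ y ^ (7 / 2 - (r : ℝ)) := by
    rw [← Real.rpow_natCast, ← Real.rpow_add hy]
    exact Real.rpow_le_rpow_of_exponent_ge hy hy1 (by push_cast; linarith)
  have f6 : b3 * (‖c‖ * (y ^ (1 - ((r : ℝ) - 1 / 2)) * Bw ((r : ℝ) - 1 / 2)) + ‖d'‖ * (y ^ (1 - ((r : ℝ) - 3 / 2)) * Bw ((r : ℝ) - 3 / 2)))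
      ≤ M2 * (‖c‖ * Bw ((r : ℝ) - 1 / 2) + ‖d'‖ * Bw ((r : ℝ) - 3 / 2)) * (y ^ (7 / 2 - (r : ℝ)) * Ex) := by
    calc _ ≤ (M2 * y ^ 2 * Ex) * (‖c‖ * (y ^ (1 - ((r : ℝ) - 1 / 2)) * Bw ((r : ℝ) - 1 / 2)) + ‖d'‖ * (y ^ (1 - ((r : ℝ) - 3 / 2)) * Bw ((r : ℝ) - 3 / 2))) := by gcongr
      _ = M2 * Ex * (‖c‖ * Bw ((r : ℝ) - 1 / 2) * (y ^ 2 * y ^ (1 - ((r : ℝ) - 1 / 2))) + ‖d'‖ * Bw ((r : ℝ) - 3 / 2) * (y ^ 2 * y ^ (1 - ((r : ℝ) - 3 / 2)))) := by ring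
      _ ≤ M2 * Ex * (‖c‖ * Bw ((r : ℝ) - 1 / 2) * y ^ (7 / 2 - (r : ℝ)) + ‖d'‖ * Bw ((r : ℝ) - 3 / 2) * y ^ (7 / 2 - (r : ℝ))) := by
        rw [f4]; gcongr
      _ = _ := by ring
  have f7 : 2 * Real.pi * b2 ≤ 2 * Real.pi * (2 * 2 ^ (r + 1) * M1 * (y ^ (7 / 2 - (r : ℝ)) * Ex)) := by gcongr
  rw [f1]
  calc _ ≤ C1 / 4 * (y ^ (7 / 2 - (r : ℝ)) * Ex) + 2 * Real.pi * (2 * 2 ^ (r + 1) * M1 * (y ^ (7 / 2 - (r : ℝ)) * Ex)) + M2 * (‖c‖ * Bw ((r : ℝ) - 1 / 2) + ‖d'‖ * Bw ((r : ℝ) - 3 / 2)) * (y ^ (7 / 2 - (r : ℝ)) * Ex) := by linarith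
    _ = _ := by ring

theorem main (r : ℕ) (hr : 3 ≤ r) :
    ∃ d : ℝ, ∃ C : ℝ, 0 < C ∧ ∃ N₀ : ℕ, ∀ N : ℕ, N₀ ≤ N →
      |mubar r N -
          (2 ^ ((r : ℝ) - 5 / 2) * Real.pi ^ (1 - (r : ℝ)) * (riemannZeta r).re *
              (1 - 2 ^ (1 - (r : ℝ)))) *
            (N : ℝ) ^ ((r : ℝ) / 2 - 3 / 4) * besselI ((r : ℝ) - 3 / 2) (Real.pi * Real.sqrt N) -
          d * (N : ℝ) ^ ((r : ℝ) / 2 - 5 / 4) *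
            besselI ((r : ℝ) - 5 / 2) (Real.pi * Real.sqrt N)| ≤
        C * (N : ℝ) ^ ((r : ℝ) / 2 - 7 / 4) * Real.exp (Real.pi * Real.sqrt N) := by
  have hr' : (3 : ℝ) ≤ r := by exact_mod_cast hr
  have hpi := Real.pi_gt_three
  have hpi4 := Real.pi_lt_four
  obtain ⟨d, C, hC, H⟩ := core r hr
  refine ⟨d.re * (Real.pi / 2) ^ (-((r : ℝ) - 5 / 2)), C * (Real.pi / 2) ^ (7 / 2 - (r : ℝ)) / (2 * Real.pi), by positivity, 16, fun N hN => ?_⟩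
  have hN' : (16 : ℝ) ≤ N := by exact_mod_cast hN
  have hN0 : (0 : ℝ) < N := by linarith
  have hs4 : 4 ≤ Real.sqrt N := Real.le_sqrt_of_sq_le (by linarith)
  have hsp : 0 < Real.sqrt N := by linarith
  have hss : Real.sqrt N * Real.sqrt N = N := Real.mul_self_sqrt hN0.le
  have hy : 0 < Real.pi / 2 / Real.sqrt N := by positivity
  have hy2 : Real.pi / 2 / Real.sqrt N ≤ 1 / 2 := by
    rw [div_le_iff₀ hsp]; linarith
  have h := H N _ (by omega) hy hy2
  have g1 := gg_integral hy hN0 (s := (r : ℝ) - 3 / 2) (by linarith)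
  have g2 := gg_integral hy hN0 (s := (r : ℝ) - 5 / 2) (by linarith)
  rw [show (r : ℝ) - 3 / 2 + 1 = r - 1 / 2 by ring] at g1
  rw [show (r : ℝ) - 5 / 2 + 1 = r - 3 / 2 by ring] at g2
  rw [g1, g2] at h
  have hre := (Complex.abs_re_le_norm _).trans h
  rw [Complex.sub_re, Complex.add_re, Complex.ofReal_re, ← Complex.ofReal_mul, ← Complex.ofReal_mul, Complex.ofReal_re, Complex.re_mul_ofReal] at hre
  have e1 : (N : ℝ) * (Real.pi / 2 / Real.sqrt N) + Real.pi ^ 2 / 4 * (1 / (Real.pi / 2 / Real.sqrt N)) = Real.pi * Real.sqrt N := by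
    field_simp; rw [Real.sq_sqrt hN0.le]; ring
  have e2 : (Real.pi / 2 / Real.sqrt N) ^ (7 / 2 - (r : ℝ)) = (Real.pi / 2) ^ (7 / 2 - (r : ℝ)) * (N : ℝ) ^ ((r : ℝ) / 2 - 7 / 4) := by
    rw [Real.div_rpow (by positivity) hsp.le, Real.sqrt_eq_rpow, ← Real.rpow_mul hN0.le, div_eq_mul_inv, ← Real.rpow_neg hN0.le]
    congr 2; ring
  rw [e1, e2] at hre
  have e3 : (1 / 2) * Real.pi ^ (-(1 / 2) : ℝ) * (Real.pi / 2) ^ (-((r : ℝ) - 3 / 2)) = 2 ^ ((r : ℝ) - 5 / 2) * Real.pi ^ (1 - (r : ℝ)) := by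
    rw [Real.div_rpow (by positivity) (by norm_num), Real.rpow_neg (by norm_num : (0 : ℝ) ≤ 2) ((r : ℝ) - 3 / 2), div_inv_eq_mul,
      show (2 : ℝ) ^ ((r : ℝ) - 3 / 2) = 2 ^ ((r : ℝ) - 5 / 2) * 2 by rw [← Real.rpow_add_one (by norm_num)]; congr 1; ring,
      show Real.pi ^ (1 - (r : ℝ)) = Real.pi ^ (-(1 / 2) : ℝ) * Real.pi ^ (-((r : ℝ) - 3 / 2)) by rw [← Real.rpow_add (by positivity)]; congr 1; ring]
    ring
  rw [show (r : ℝ) / 2 - 3 / 4 = (r - 3 / 2) / 2 by ring, show (r : ℝ) / 2 - 5 / 4 = (r - 5 / 2) / 2 by ring, ← e3]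
  have h2p : (0 : ℝ) < 2 * Real.pi := by positivity
  refine le_of_mul_le_mul_left ?_ h2p
  rw [← abs_of_pos h2p, ← abs_mul, abs_of_pos h2p]
  refine (le_of_eq ?_).trans (hre.trans (le_of_eq ?_))
  · congr 1; ring
  · field_simp

end MA

/-- Asymptotic formula for the positive symmetrized crank moments via Bessel functions. -/
theorem mubar_asymptotic (r : ℕ) (hr : 3 ≤ r) :
    ∃ d : ℝ, ∃ C : ℝ, 0 < C ∧ ∃ N₀ : ℕ, ∀ N : ℕ, N₀ ≤ N →
      |mubar r N -
          (2 ^ ((r : ℝ) - 5 / 2) * Real.pi ^ (1 - (r : ℝ)) * (riemannZeta r).re *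
              (1 - 2 ^ (1 - (r : ℝ)))) *
            (N : ℝ) ^ ((r : ℝ) / 2 - 3 / 4) * besselI ((r : ℝ) - 3 / 2) (Real.pi * Real.sqrt N) -
          d * (N : ℝ) ^ ((r : ℝ) / 2 - 5 / 4) *
            besselI ((r : ℝ) - 5 / 2) (Real.pi * Real.sqrt N)| ≤
        C * (N : ℝ) ^ ((r : ℝ) / 2 - 7 / 4) * Real.exp (Real.pi * Real.sqrt N) := by
  exact MA.main r hr
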